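/- Let N ≥ 2, 0 < R₀ < R₁ and p ∈ (1,∞). Then the function s ↦ λ₁(p, Ω_s) is strictly decreasing on [0, R₁ − R₀): for all s₁, s₂ with 0 ≤ s₁ < s₂ < R₁ − R₀ one has λ₁(p, Ω_{s₂}) < λ₁(p, Ω_{s₁}). -/

import Mathlib

open MeasureTheory Metric Set Filter
open scoped RealInnerProductSpace ENNReal Topology

/-- The first Dirichlet eigenvalue of the p-Laplacian on `Ω`, defined variationally as the
infimum of Rayleigh quotients of smooth, not identically zero functions with compact
support contained in `Ω`. -/
noncomputable def lam1 {N : ℕ} (p : ℝ) (Ω : Set (EuclideanSpace ℝ (Fin N))) : ℝ :=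
  sInf { r : ℝ | ∃ u : EuclideanSpace ℝ (Fin N) → ℝ,
    ContDiff ℝ (⊤ : ℕ∞) u ∧ u ≠ 0 ∧ HasCompactSupport u ∧ tsupport u ⊆ Ω ∧
    r = (∫ x in Ω, ‖gradient u x‖ ^ p) / (∫ x in Ω, |u x| ^ p) }

/-- The first standard basis vector `e₁` of `ℝ^N`. -/
noncomputable def e1 (N : ℕ) : EuclideanSpace ℝ (Fin N) :=
  (WithLp.equiv 2 (Fin N → ℝ)).symm (fun i => if (i : ℕ) = 0 then 1 else 0)

/-- The eccentric annulus `Ω_s = B_{R₁}(0) \ closure (B_{R₀}(s e₁))`. -/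
noncomputable def Om (N : ℕ) (R₀ R₁ s : ℝ) : Set (EuclideanSpace ℝ (Fin N)) :=
  ball 0 R₁ \ closure (ball (s • e1 N) R₀)

/-- `u` is a first eigenfunction of the p-Laplacian on `Ω` with eigenvalue `lam`:
C¹ on an open set containing the closure of `Ω`, positive in `Ω`, zero on `∂Ω`, and a weak
solution of `−Δ_p u = lam · u^{p−1}`. -/
def IsFirstEigenfunction {N : ℕ} (p : ℝ) (Ω : Set (EuclideanSpace ℝ (Fin N)))
    (lam : ℝ) (u : EuclideanSpace ℝ (Fin N) → ℝ) : Prop :=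
  (∃ V : Set (EuclideanSpace ℝ (Fin N)), IsOpen V ∧ closure Ω ⊆ V ∧ ContDiffOn ℝ 1 u V) ∧
  (∀ x ∈ Ω, 0 < u x) ∧
  (∀ x ∈ frontier Ω, u x = 0) ∧
  (∀ φ : EuclideanSpace ℝ (Fin N) → ℝ, ContDiff ℝ (⊤ : ℕ∞) φ → HasCompactSupport φ →
    tsupport φ ⊆ Ω →
    ∫ x in Ω, ‖gradient u x‖ ^ (p - 2) * ⟪gradient u x, gradient φ x⟫ =
      lam * ∫ x in Ω, (u x) ^ (p - 1) * φ x)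

set_option linter.unusedSectionVars false
set_option linter.unusedVariables false

section PartA

theorem pl_jensen {α : Type*} [MeasurableSpace α] (ν : Measure α) [IsProbabilityMeasure ν]
    {p : ℝ} (hp : 1 < p) (g : α → ℝ≥0∞) (hg : AEMeasurable g ν) :
    (∫⁻ a, g a ∂ν) ^ p ≤ ∫⁻ a, g a ^ p ∂ν := by
  have h := ENNReal.lintegral_mul_le_Lp_mul_Lq ν (Real.HolderConjugate.conjExponent hp)
    hg (g := fun _ => 1) aemeasurable_const
  simp only [Pi.mul_apply, mul_one, ENNReal.one_rpow, lintegral_const, measure_univ] at h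
  calc _ ≤ ((∫⁻ a, g a ^ p ∂ν) ^ (1/p)) ^ p := ENNReal.rpow_le_rpow h (by linarith)
    _ = _ := by
      rw [← ENNReal.rpow_mul, one_div, inv_mul_cancel₀ (by linarith), ENNReal.rpow_one]

variable {E : Type*} [NormedAddCommGroup E] [InnerProductSpace ℝ E] [FiniteDimensional ℝ E]
  [MeasurableSpace E] [BorelSpace E]

/-- nonnegative C¹ functions with compact support in `Ω`. -/
structure C1c (Ω : Set E) (u : E → ℝ) : Prop where
  cd : ContDiff ℝ 1 u
  cs : HasCompactSupport u
  ts : tsupport u ⊆ Ω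
  nn : ∀ x, 0 ≤ u x

/-- the `p`-th power integral -/
noncomputable def Ip {G : Type*} [NormedAddCommGroup G] (p : ℝ) (F : E → G) : ℝ≥0∞ :=
  ∫⁻ x, ‖F x‖ₑ ^ p

theorem grad_norm (u : E → ℝ) (x : E) : ‖gradient u x‖ = ‖fderiv ℝ u x‖ := by
  rw [gradient]; simp

theorem grad_cont {u : E → ℝ} (hu : ContDiff ℝ 1 u) : Continuous (gradient u) := by
  unfold gradient
  exact (InnerProductSpace.toDual ℝ E).symm.continuous.comp (hu.continuous_fderiv (by norm_num))

theorem grad_hasCS {u : E → ℝ} (hu : HasCompactSupport u) : HasCompactSupport (gradient u) := by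
  have := hu.fderiv (𝕜 := ℝ)
  exact this.comp_left (g := (InnerProductSpace.toDual ℝ E).symm) (by simp)

theorem grad_comp {u : E → ℝ} {x : E} {φ : ℝ → ℝ} {φ' : ℝ} (hφ : HasDerivAt φ φ' (u x))
    (hu : DifferentiableAt ℝ u x) : gradient (fun y => φ (u y)) x = φ' • gradient u x := by
  have h1 : HasFDerivAt (fun y => φ (u y)) (φ' • fderiv ℝ u x) x :=
    hφ.comp_hasFDerivAt x hu.hasFDerivAt
  rw [gradient, h1.fderiv, gradient, map_smul]

theorem grad_zero_of_notMem {u : E → ℝ} {x : E} (hx : x ∉ tsupport u) : gradient u x = 0 := by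
  rw [gradient, fderiv_of_notMem_tsupport ℝ hx, map_zero]

theorem transl_pt {f : E → ℝ} (hf : ContDiff ℝ 1 f) (h x : E) :
    ‖f (x + h) - f x‖ₑ ≤ ∫⁻ t in Ioc (0:ℝ) 1, ‖h‖ₑ * ‖gradient f (x + t • h)‖ₑ := by
  have hd : ∀ t ∈ uIcc (0:ℝ) 1, HasDerivAt (fun t : ℝ => f (x + t • h))
      (fderiv ℝ f (x + t • h) h) t := by
    intro t _
    have h1 : HasFDerivAt f (fderiv ℝ f (x + t • h)) (x + t • h) :=
      (hf.differentiable (by norm_num) _).hasFDerivAt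
    have h2 : HasDerivAt (fun t : ℝ => x + t • h) h t := by
      simpa using ((hasDerivAt_id t).smul_const h).const_add x
    exact h1.comp_hasDerivAt t h2
  have hc : Continuous (fun t : ℝ => fderiv ℝ f (x + t • h) h) := by
    have := hf.continuous_fderiv (by norm_num)
    fun_prop
  have := intervalIntegral.integral_eq_sub_of_hasDerivAt hd (hc.intervalIntegrable _ _)
  simp only [one_smul, zero_smul, add_zero] at this
  rw [← this, intervalIntegral.integral_of_le zero_le_one]
  refine (enorm_integral_le_lintegral_enorm _).trans (lintegral_mono fun t => ?_)
  rw [← inner_gradient_left]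
  simp only [enorm_eq_nnnorm, ← ENNReal.coe_mul, ENNReal.coe_le_coe]
  rw [mul_comm]; exact nnnorm_inner_le_nnnorm _ _

theorem transl {p : ℝ} (hp : 1 < p) {f : E → ℝ} (hf : ContDiff ℝ 1 f) (h : E) {S T : Set E}
    (hS : MeasurableSet S) (hT : MeasurableSet T)
    (hST : ∀ x ∈ S, ∀ t ∈ Icc (0:ℝ) 1, x + t • h ∈ T) :
    ∫⁻ x in S, ‖f (x + h) - f x‖ₑ ^ p ≤ ‖h‖ₑ ^ p * ∫⁻ x in T, ‖gradient f x‖ₑ ^ p := by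
  have hg := grad_cont hf
  have : IsProbabilityMeasure (volume.restrict (Ioc (0:ℝ) 1)) := ⟨by simp⟩
  have hp0 : 0 ≤ p := by linarith
  calc ∫⁻ x in S, ‖f (x + h) - f x‖ₑ ^ p
      ≤ ∫⁻ x in S, ∫⁻ t in Ioc (0:ℝ) 1, ‖h‖ₑ ^ p * ‖gradient f (x + t • h)‖ₑ ^ p := by
        refine lintegral_mono fun x => ?_
        refine (ENNReal.rpow_le_rpow (transl_pt hf h x) hp0).trans ?_
        refine (pl_jensen _ hp _ ?_).trans (le_of_eq ?_)
        · fun_prop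
        · simp only [ENNReal.mul_rpow_of_nonneg _ _ hp0]
    _ = ∫⁻ t in Ioc (0:ℝ) 1, ∫⁻ x in S, ‖h‖ₑ ^ p * ‖gradient f (x + t • h)‖ₑ ^ p := by
        rw [lintegral_lintegral_swap]
        fun_prop
    _ ≤ ∫⁻ t in Ioc (0:ℝ) 1, ‖h‖ₑ ^ p * ∫⁻ x in T, ‖gradient f x‖ₑ ^ p := by
        refine setLIntegral_mono' measurableSet_Ioc fun t ht => ?_
        have hm : Measurable (gradient f) := hg.measurable
        rw [lintegral_const_mul _ (by fun_prop)]
        refine mul_le_mul_right ?_ _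
        rw [← lintegral_indicator hS, ← lintegral_indicator hT,
          ← lintegral_add_right_eq_self (T.indicator fun x => ‖gradient f x‖ₑ ^ p) (t • h)]
        refine lintegral_mono fun x => ?_
        by_cases hx : x ∈ S
        · rw [indicator_of_mem hx, indicator_of_mem (hST x hx t ⟨ht.1.le, ht.2⟩)]
        · rw [indicator_of_notMem hx]; exact zero_le
    _ = _ := by simp

theorem transl_univ {p : ℝ} (hp : 1 < p) {f : E → ℝ} (hf : ContDiff ℝ 1 f) (h : E) :
    ∫⁻ x, ‖f (x + h) - f x‖ₑ ^ p ≤ ‖h‖ₑ ^ p * Ip p (gradient f) := by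
  have := transl hp hf h MeasurableSet.univ MeasurableSet.univ (fun _ _ _ _ => mem_univ _)
  simpa [Ip] using this

end PartA

section PartB

/-- cut-off slope -/
noncomputable def thF (ε t : ℝ) : ℝ := min 1 (max 0 (t / ε))
/-- C¹ approximation of the positive part -/
noncomputable def hF (ε s : ℝ) : ℝ := ∫ t in (0:ℝ)..s, thF ε t
/-- C¹ approximation of the absolute value vanishing near zero -/
noncomputable def gF (ε t : ℝ) : ℝ := hF ε (t - ε) + hF ε (-t - ε)
/-- derivative of `gF` -/
noncomputable def gD (ε t : ℝ) : ℝ := thF ε (t - ε) - thF ε (-t - ε)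

theorem thF_cont (ε : ℝ) : Continuous (thF ε) := by unfold thF; fun_prop
theorem thF_nonneg (ε t : ℝ) : 0 ≤ thF ε t := by unfold thF; positivity
theorem thF_le (ε t : ℝ) : thF ε t ≤ 1 := min_le_left _ _
theorem thF_zero {ε t : ℝ} (hε : 0 < ε) (ht : t ≤ 0) : thF ε t = 0 := by
  unfold thF
  rw [max_eq_left (div_nonpos_of_nonpos_of_nonneg ht hε.le)]; simp
theorem thF_one {ε t : ℝ} (hε : 0 < ε) (ht : ε ≤ t) : thF ε t = 1 := by
  unfold thF
  rw [min_eq_left]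
  exact le_max_of_le_right ((one_le_div hε).2 ht)

theorem hF_deriv (ε s : ℝ) : HasDerivAt (hF ε) (thF ε s) s :=
  intervalIntegral.integral_hasDerivAt_right ((thF_cont ε).intervalIntegrable _ _)
    ((thF_cont ε).stronglyMeasurableAtFilter _ _) (thF_cont ε).continuousAt

theorem hF_cd (ε : ℝ) : ContDiff ℝ 1 (hF ε) := by
  rw [contDiff_one_iff_deriv]
  refine ⟨fun s => (hF_deriv ε s).differentiableAt, ?_⟩
  have : deriv (hF ε) = thF ε := funext fun s => (hF_deriv ε s).deriv
  rw [this]; exact thF_cont ε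

theorem hF_zero {ε s : ℝ} (hε : 0 < ε) (hs : s ≤ 0) : hF ε s = 0 := by
  unfold hF
  rw [intervalIntegral.integral_symm, intervalIntegral.integral_of_le hs,
    setIntegral_eq_zero_of_forall_eq_zero, neg_zero]
  intro t ht; exact thF_zero hε ht.2

theorem hF_nonneg {ε : ℝ} (hε : 0 < ε) (s : ℝ) : 0 ≤ hF ε s := by
  rcases le_total s 0 with h | h
  · rw [hF_zero hε h]
  · exact intervalIntegral.integral_nonneg h fun t _ => thF_nonneg _ _

theorem hF_le {ε : ℝ} (hε : 0 < ε) (s : ℝ) : hF ε s ≤ max s 0 := by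
  rcases le_total s 0 with h | h
  · rw [hF_zero hε h]; exact le_max_right _ _
  · rw [max_eq_left h]
    have := intervalIntegral.integral_mono_on (μ := volume) h
      ((thF_cont ε).intervalIntegrable _ _)
      ((continuous_const (y := (1:ℝ))).intervalIntegrable _ _) fun t _ => thF_le ε t
    unfold hF; simpa using this

theorem hF_ge {ε : ℝ} (hε : 0 < ε) (s : ℝ) : s - ε ≤ hF ε s := by
  rcases le_total s ε with h | h
  · exact (sub_nonpos.2 h).trans (hF_nonneg hε s)
  · have h1 := intervalIntegral.integral_add_adjacent_intervals (μ := volume)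
      ((thF_cont ε).intervalIntegrable 0 ε) ((thF_cont ε).intervalIntegrable ε s)
    have h2 : ∫ t in ε..s, thF ε t = s - ε := by
      rw [intervalIntegral.integral_congr (g := fun _ => (1:ℝ))]
      · simp
      · intro t ht
        rw [uIcc_of_le h] at ht
        exact thF_one hε ht.1
    have h3 : 0 ≤ ∫ t in (0:ℝ)..ε, thF ε t := hF_nonneg hε ε
    unfold hF; linarith

theorem gF_deriv (ε t : ℝ) : HasDerivAt (gF ε) (gD ε t) t := by
  have h1 : HasDerivAt (fun t : ℝ => t - ε) 1 t := (hasDerivAt_id t).sub_const ε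
  have h2 : HasDerivAt (fun t : ℝ => -t - ε) (-1) t := ((hasDerivAt_id t).neg).sub_const ε
  have := ((hF_deriv ε (t - ε)).comp t h1).add ((hF_deriv ε (-t - ε)).comp t h2)
  convert! this using 1
  unfold gD; ring

theorem gF_cd (ε : ℝ) : ContDiff ℝ 1 (gF ε) := by
  have := hF_cd ε
  unfold gF; fun_prop

theorem gF_even (ε t : ℝ) : gF ε (-t) = gF ε t := by
  unfold gF; rw [neg_neg, add_comm]
theorem gD_odd (ε t : ℝ) : gD ε (-t) = - gD ε t := by
  unfold gD; rw [neg_neg]; ring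
theorem gF_zero {ε t : ℝ} (hε : 0 < ε) (ht : |t| ≤ ε) : gF ε t = 0 := by
  have := abs_le.1 ht
  unfold gF; rw [hF_zero hε (by linarith), hF_zero hε (by linarith), add_zero]
theorem gF_nonneg {ε : ℝ} (hε : 0 < ε) (t : ℝ) : 0 ≤ gF ε t :=
  add_nonneg (hF_nonneg hε _) (hF_nonneg hε _)
theorem gF_abs (ε t : ℝ) : gF ε |t| = gF ε t := by
  rcases abs_choice t with h | h <;> rw [h]
  exact gF_even _ _
theorem gF_pos {ε t : ℝ} (hε : 0 < ε) (ht : 0 ≤ t) : gF ε t = hF ε (t - ε) := by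
  unfold gF; rw [hF_zero (s := -t - ε) hε (by linarith), add_zero]
theorem gF_le {ε : ℝ} (hε : 0 < ε) (t : ℝ) : gF ε t ≤ |t| := by
  rw [← gF_abs, gF_pos hε (abs_nonneg t)]
  refine (hF_le hε _).trans (max_le (by linarith) (abs_nonneg t))
theorem gF_ge {ε : ℝ} (hε : 0 < ε) (t : ℝ) : |t| - 2 * ε ≤ gF ε t := by
  rw [← gF_abs, gF_pos hε (abs_nonneg t)]
  have := hF_ge hε (|t| - ε)
  linarith
theorem gD_abs {ε : ℝ} (hε : 0 < ε) (t : ℝ) : |gD ε t| ≤ 1 := by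
  have h1 := thF_nonneg ε (t - ε)
  have h2 := thF_nonneg ε (-t - ε)
  have h3 := thF_le ε (t - ε)
  have h4 := thF_le ε (-t - ε)
  unfold gD; rw [abs_le]; constructor <;> linarith
theorem gD_zero {ε t : ℝ} (hε : 0 < ε) (ht : |t| ≤ ε) : gD ε t = 0 := by
  have := abs_le.1 ht
  unfold gD; rw [thF_zero hε (by linarith), thF_zero hε (by linarith), sub_zero]

end PartB

section PartC
open scoped Pointwise
variable {E : Type*} [NormedAddCommGroup E] [InnerProductSpace ℝ E] [FiniteDimensional ℝ E]
  [MeasurableSpace E] [BorelSpace E]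

theorem Ip_dom {G : Type*} [NormedAddCommGroup G] {p : ℝ} (hp : 1 < p)
    {F : ℕ → E → G} {F0 : E → G} {K : Set E} (hK : IsCompact K) {C : ℝ}
    (hF : ∀ n, Continuous (F n)) (hC : ∀ n x, ‖F n x‖ ≤ C)
    (h0 : ∀ n, ∀ x ∉ K, F n x = 0) (ht : ∀ x, Tendsto (fun n => F n x) atTop (𝓝 (F0 x))) :
    Tendsto (fun n => Ip p (F n)) atTop (𝓝 (Ip p F0)) := by
  have hp0 : 0 < p := by linarith
  unfold Ip
  refine tendsto_lintegral_of_dominated_convergence'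
    (K.indicator fun _ => (ENNReal.ofReal C) ^ p) ?_ ?_ ?_ ?_
  · intro n
    have := (hF n).enorm.measurable
    exact (this.pow_const p).aemeasurable
  · intro n
    refine Eventually.of_forall fun x => ?_
    by_cases hx : x ∈ K
    · rw [indicator_of_mem hx]
      refine ENNReal.rpow_le_rpow ?_ hp0.le
      rw [← ofReal_norm]; exact ENNReal.ofReal_le_ofReal (hC n x)
    · simp only [h0 n x hx, indicator_of_notMem hx]; simp [hp0]
  · rw [lintegral_indicator hK.measurableSet, setLIntegral_const]
    exact ENNReal.mul_ne_top (ENNReal.rpow_ne_top_of_nonneg hp0.le ENNReal.ofReal_ne_top)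
      hK.measure_lt_top.ne
  · refine Eventually.of_forall fun x => ?_
    exact ((ht x).enorm).ennrpow_const p

theorem conv_bdd (φ : ℕ → ContDiffBump (0 : E)) {G : Type*} [NormedAddCommGroup G]
    [NormedSpace ℝ G] [CompleteSpace G]
    (f : E → G) (hf : Continuous f) (hfc : HasCompactSupport f) : ∃ C, ∀ n x,
      ‖convolution ((φ n).normed volume) f (ContinuousLinearMap.lsmul ℝ ℝ) volume x‖ ≤ C := by
  obtain ⟨C, hC⟩ := hf.bounded_above_of_compact_support hfc
  refine ⟨3 * C, fun n x => ?_⟩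
  have := ContDiffBump.dist_normed_convolution_le (φ := φ n) (μ := volume) (g := f)
    (x₀ := x) (ε := 2 * C) hf.aestronglyMeasurable (fun y _ => by
      rw [dist_eq_norm]
      have := norm_sub_le (f y) (f x); linarith [hC x, hC y])
  rw [dist_eq_norm] at this
  have h2 := norm_sub_norm_le (convolution ((φ n).normed volume) f
    (ContinuousLinearMap.lsmul ℝ ℝ) volume x) (f x)
  linarith [hC x]

theorem smooth_approx {p : ℝ} (hp : 1 < p) {Ω : Set E} (hΩ : IsOpen Ω) {u : E → ℝ}
    (hu : ContDiff ℝ 1 u) (hc : HasCompactSupport u) (hs : tsupport u ⊆ Ω) :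
    ∃ v : ℕ → E → ℝ, (∀ n, ContDiff ℝ (⊤ : ℕ∞) (v n)) ∧ (∀ n, HasCompactSupport (v n)) ∧
      (∀ n, tsupport (v n) ⊆ Ω) ∧ Tendsto (fun n => Ip p (v n)) atTop (𝓝 (Ip p u)) ∧
      Tendsto (fun n => Ip p (gradient (v n))) atTop (𝓝 (Ip p (gradient u))) := by
  obtain ⟨δ, hδ, hδΩ⟩ := hc.exists_cthickening_subset_open hΩ hs
  set K := cthickening δ (tsupport u) with hKdef
  have hK : IsCompact K := hc.cthickening
  have hrpos : ∀ n : ℕ, 0 < δ / (n + 1 : ℝ) := fun n => by positivity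
  have hrle : ∀ n : ℕ, δ / (n + 1 : ℝ) ≤ δ := fun n =>
    div_le_self hδ.le (by linarith [Nat.cast_nonneg (α := ℝ) n])
  let φ : ℕ → ContDiffBump (0 : E) := fun n =>
    ⟨δ / (n + 1) / 2, δ / (n + 1), half_pos (hrpos n), half_lt_self (hrpos n)⟩
  have hφr : Tendsto (fun n => (φ n).rOut) atTop (𝓝 0) := by
    have := tendsto_one_div_add_atTop_nhds_zero_nat.const_mul δ
    simpa [φ, div_eq_mul_inv] using this
  let L := ContinuousLinearMap.lsmul ℝ ℝ (E := ℝ)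
  let v : ℕ → E → ℝ := fun n => convolution ((φ n).normed volume) u L volume
  have hfd := hu.continuous_fderiv (by norm_num)
  have hvd : ∀ n x, HasFDerivAt (v n) ((convolution ((φ n).normed volume) (fderiv ℝ u)
      (ContinuousLinearMap.lsmul ℝ ℝ) volume) x) x := by
    intro n x
    exact hc.hasFDerivAt_convolution_right L ((φ n).continuous_normed.locallyIntegrable) hu x
  have hzero : ∀ n, ∀ x, v n x ≠ 0 → x ∈ K := by
    intro n x hx
    have h1 : x ∈ Function.support ((φ n).normed volume) + Function.support u :=
      support_convolution_subset L hx
    obtain ⟨a, ha, b, hb, rfl⟩ := h1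
    rw [(φ n).support_normed_eq, mem_ball_zero_iff] at ha
    refine mem_cthickening_of_dist_le (a + b) b δ _ (subset_tsupport _ hb) ?_
    rw [dist_eq_norm, add_sub_cancel_right]
    exact ha.le.trans (hrle n)
  have hts : ∀ n, tsupport (v n) ⊆ K := fun n =>
    closure_minimal (fun x hx => hzero n x hx) isClosed_cthickening
  have hsm : ∀ n, ContDiff ℝ (⊤ : ℕ∞) (v n) := fun n =>
    ((φ n).hasCompactSupport_normed).contDiff_convolution_left L (φ n).contDiff_normed
      (hu.continuous.locallyIntegrable)
  refine ⟨v, hsm, fun n => ?_, fun n => (hts n).trans hδΩ, ?_, ?_⟩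
  · exact hK.of_isClosed_subset (isClosed_tsupport _) (hts n)
  · obtain ⟨C, hC⟩ := conv_bdd φ u hu.continuous hc
    refine Ip_dom hp hK (fun n => (hsm n).continuous) hC
      (fun n x hx => by by_contra h; exact hx (hzero n x h)) fun x => ?_
    exact ContDiffBump.convolution_tendsto_right_of_continuous hφr hu.continuous x
  · obtain ⟨C, hC⟩ := conv_bdd φ (fderiv ℝ u) hfd (hc.fderiv ℝ)
    refine Ip_dom hp hK (C := C) (fun n => grad_cont ((hsm n).of_le (by exact_mod_cast le_top)))
      (fun n x => ?_) (fun n x hx => grad_zero_of_notMem fun h => hx (hts n h)) fun x => ?_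
    · rw [grad_norm, (hvd n x).fderiv]; exact hC n x
    · unfold gradient
      refine ((InnerProductSpace.toDual ℝ E).symm.continuous.tendsto _).comp ?_
      simp only [(hvd _ x).fderiv]
      exact ContDiffBump.convolution_tendsto_right_of_continuous hφr hfd x

end PartC

section PartD
variable {E : Type*} [NormedAddCommGroup E] [InnerProductSpace ℝ E] [FiniteDimensional ℝ E]
  [MeasurableSpace E] [BorelSpace E]

theorem Ip_ne_top {G : Type*} [NormedAddCommGroup G] {p : ℝ} (hp : 1 < p) {F : E → G}
    (hF : Continuous F) (hc : HasCompactSupport F) : Ip p F ≠ ⊤ := by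
  have h := (hF.memLp_of_hasCompactSupport (p := ENNReal.ofReal p) (μ := volume) hc)
  have := lintegral_rpow_enorm_lt_top_of_eLpNorm_lt_top (by simp; linarith) (by simp) h.2
  rw [ENNReal.toReal_ofReal (by linarith)] at this
  exact this.ne

theorem Ip_eq_ofReal {G : Type*} [NormedAddCommGroup G] {p : ℝ} (hp : 1 < p) {F : E → G}
    (hF : Continuous F) (hc : HasCompactSupport F) :
    Ip p F = ENNReal.ofReal (∫ x, ‖F x‖ ^ p) := by
  have hp0 : 0 ≤ p := by linarith
  rw [ofReal_integral_eq_lintegral_ofReal]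
  · unfold Ip
    refine lintegral_congr fun x => ?_
    rw [← ENNReal.ofReal_rpow_of_nonneg (norm_nonneg _) hp0, ofReal_norm]
  · refine Continuous.integrable_of_hasCompactSupport ?_ ?_
    · exact hF.norm.rpow_const (fun _ => Or.inr hp0)
    · exact hc.norm.comp_left (g := fun t : ℝ => t ^ p) (Real.zero_rpow (by linarith))
  · exact Eventually.of_forall fun x => by positivity

theorem Ip_zero_iff {p : ℝ} (hp : 1 < p) {F : E → ℝ} (hF : Continuous F) :
    Ip p F = 0 ↔ F = 0 := by
  unfold Ip
  rw [lintegral_eq_zero_iff (hF.enorm.measurable.pow_const p)]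
  constructor
  · intro h
    refine (hF.ae_eq_iff_eq volume continuous_zero).1 ?_
    filter_upwards [h] with x hx
    simpa [show 0 < p by linarith, not_lt.2 (show 0 ≤ p by linarith)] using hx
  · rintro rfl
    exact Eventually.of_forall fun x => by simp [show 0 < p by linarith]

theorem Ip_smul {G : Type*} [NormedAddCommGroup G] [NormedSpace ℝ G] {p : ℝ} (hp : 1 < p)
    (F : E → G) (c : ℝ) : Ip p (fun x => c • F x) = ‖c‖ₑ ^ p * Ip p F := by
  unfold Ip
  simp only [enorm_smul, ENNReal.mul_rpow_of_nonneg _ _ (show 0 ≤ p by linarith)]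
  rw [lintegral_const_mul' _ _ (ENNReal.rpow_ne_top_of_nonneg (by linarith) enorm_ne_top)]

theorem grad_smul {u : E → ℝ} (hu : ContDiff ℝ 1 u) (c : ℝ) :
    gradient (fun x => c * u x) = fun x => c • gradient u x := by
  funext x
  refine grad_comp (φ := fun t => c * t) ?_ (hu.differentiable (by norm_num) x)
  simpa using (hasDerivAt_id (u x)).const_mul c

theorem C1c.smul {Ω : Set E} {u : E → ℝ} (hu : C1c Ω u) {c : ℝ} (hc : 0 ≤ c) :
    C1c Ω (fun x => c * u x) where
  cd := contDiff_const.mul hu.cd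
  cs := hu.cs.mul_left
  ts := (closure_mono (fun x hx => by
    simp only [Function.mem_support] at hx ⊢; exact right_ne_zero_of_mul hx)).trans hu.ts
  nn := fun x => mul_nonneg hc (hu.nn x)

/-- `L` is the value of the variational problem on `Ω`. -/
structure IsL (p : ℝ) (Ω : Set E) (L : ℝ≥0∞) : Prop where
  ne_top : L ≠ ⊤
  poinc : ∀ φ : E → ℝ, C1c Ω φ → L * Ip p φ ≤ Ip p (gradient φ)
  seq : ∃ φ : ℕ → E → ℝ, (∀ k, C1c Ω (φ k)) ∧ (∀ k, Ip p (φ k) = 1) ∧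
    Tendsto (fun k => Ip p (gradient (φ k))) atTop (𝓝 L)

theorem C1c.normalize {p : ℝ} (hp : 1 < p) {Ω : Set E} {u : E → ℝ} (hu : C1c Ω u)
    (h0 : Ip p u ≠ 0) {M : ℝ≥0∞} (hM : Ip p (gradient u) ≤ M * Ip p u) :
    ∃ v, C1c Ω v ∧ Ip p v = 1 ∧ Ip p (gradient v) ≤ M := by
  have hp0 : 0 < p := by linarith
  have hT := Ip_ne_top hp hu.cd.continuous hu.cs
  set c : ℝ := ((Ip p u) ^ (-(1/p))).toReal with hcdef
  have hne : (Ip p u) ^ (-(1/p)) ≠ ⊤ := by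
    simp [ENNReal.rpow_eq_top_iff, h0, hT]
  have hcp : ‖c‖ₑ ^ p = (Ip p u)⁻¹ := by
    rw [Real.enorm_eq_ofReal ENNReal.toReal_nonneg, ENNReal.ofReal_toReal hne,
      ← ENNReal.rpow_mul, neg_mul, one_div, inv_mul_cancel₀ hp0.ne', ENNReal.rpow_neg_one]
  refine ⟨fun x => c * u x, hu.smul ENNReal.toReal_nonneg, ?_, ?_⟩
  · have := Ip_smul hp u c
    simp only [smul_eq_mul] at this
    rw [this, hcp, ENNReal.inv_mul_cancel h0 hT]
  · rw [grad_smul hu.cd, Ip_smul hp, hcp]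
    calc _ ≤ (Ip p u)⁻¹ * (M * Ip p u) := mul_le_mul_right hM _
      _ = M := by rw [mul_comm M, ← mul_assoc, ENNReal.inv_mul_cancel h0 hT, one_mul]

theorem IsL.mk' {p : ℝ} (hp : 1 < p) {Ω : Set E} {L : ℝ≥0∞} (ht : L ≠ ⊤)
    (hpo : ∀ φ : E → ℝ, C1c Ω φ → L * Ip p φ ≤ Ip p (gradient φ))
    (h : ∀ M : ℝ≥0∞, L < M → ∃ φ, C1c Ω φ ∧ Ip p φ ≠ 0 ∧ Ip p (gradient φ) ≤ M * Ip p φ) :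
    IsL p Ω L := by
  refine ⟨ht, hpo, ?_⟩
  have hM : ∀ k : ℕ, L < L + ((k:ℝ≥0∞) + 1)⁻¹ := fun k =>
    ENNReal.lt_add_right ht (by simp)
  have : ∀ k : ℕ, ∃ v, C1c Ω v ∧ Ip p v = 1 ∧ Ip p (gradient v) ≤ L + ((k:ℝ≥0∞) + 1)⁻¹ := by
    intro k
    obtain ⟨φ, h1, h2, h3⟩ := h _ (hM k)
    exact h1.normalize hp h2 h3
  choose v hv1 hv2 hv3 using this
  refine ⟨v, hv1, hv2, ?_⟩
  refine tendsto_of_tendsto_of_tendsto_of_le_of_le tendsto_const_nhds ?_ (fun k => ?_) hv3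
  · have h1 : Tendsto (fun k : ℕ => ((k:ℝ≥0∞) + 1)⁻¹) atTop (𝓝 0) := by
      have := (tendsto_add_atTop_iff_nat 1).2 ENNReal.tendsto_inv_nat_nhds_zero
      simpa using this
    simpa using h1.const_add L
  · have := hpo _ (hv1 k)
    rwa [hv2, mul_one] at this

/-- regularised absolute value of a C¹ function. -/
theorem C1c_gF {p : ℝ} (hp : 1 < p) {Ω : Set E} {u : E → ℝ} (hu : ContDiff ℝ 1 u)
    (hc : HasCompactSupport u) (hs : tsupport u ⊆ Ω) {ε : ℝ} (hε : 0 < ε) :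
    C1c Ω (fun x => gF ε (u x)) ∧ Ip p (gradient fun x => gF ε (u x)) ≤ Ip p (gradient u) := by
  have hg0 : gF ε 0 = 0 := gF_zero hε (by simp [hε.le])
  refine ⟨⟨(gF_cd ε).comp hu, hc.comp_left hg0, ?_, fun x => gF_nonneg hε _⟩, ?_⟩
  · refine (closure_mono fun x hx => ?_).trans hs
    simp only [Function.mem_support] at hx ⊢
    exact fun h => hx (by rw [h, hg0])
  · refine lintegral_mono fun x => ENNReal.rpow_le_rpow ?_ (by linarith)
    rw [grad_comp (gF_deriv ε (u x)) (hu.differentiable (by norm_num) x), enorm_smul]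
    refine mul_le_of_le_one_left zero_le ?_
    rw [← ofReal_norm, Real.norm_eq_abs]
    exact ENNReal.ofReal_le_one.2 (gD_abs hε _)

theorem gF_Ip_tendsto {p : ℝ} (hp : 1 < p) {u : E → ℝ} (hu : ContDiff ℝ 1 u)
    (hc : HasCompactSupport u) :
    Tendsto (fun n : ℕ => Ip p (fun x => gF (1 / ((n:ℝ) + 1)) (u x))) atTop (𝓝 (Ip p u)) := by
  have hpos : ∀ n : ℕ, 0 < 1 / ((n:ℝ) + 1) := fun n => by positivity
  have : Ip p u = Ip p (fun x => |u x|) := by simp [Ip]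
  rw [this]
  obtain ⟨C, hC⟩ := hu.continuous.bounded_above_of_compact_support hc
  refine Ip_dom hp hc (C := C) (fun n => (gF_cd _).continuous.comp hu.continuous)
    (fun n x => ?_) (fun n x hx => ?_) fun x => ?_
  · rw [Real.norm_eq_abs, abs_of_nonneg (gF_nonneg (hpos n) _)]
    exact (gF_le (hpos n) _).trans (hC x)
  · rw [image_eq_zero_of_notMem_tsupport hx]
    exact gF_zero (hpos n) (by simpa using (hpos n).le)
  · have h1 := tendsto_one_div_add_atTop_nhds_zero_nat (𝕜 := ℝ)
    refine tendsto_of_tendsto_of_tendsto_of_le_of_le (g := fun n : ℕ => |u x| - 2 * (1 / ((n:ℝ) + 1)))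
      ?_ tendsto_const_nhds (fun n => gF_ge (hpos n) _) (fun n => gF_le (hpos n) _)
    simpa using (h1.const_mul 2).const_sub |u x|

theorem lam1_nonneg {N : ℕ} (p : ℝ) (Ω : Set (EuclideanSpace ℝ (Fin N))) : 0 ≤ lam1 p Ω := by
  refine Real.sInf_nonneg ?_
  rintro r ⟨u, -, -, -, -, rfl⟩
  exact div_nonneg (integral_nonneg fun x => by positivity) (integral_nonneg fun x => by positivity)

theorem rayleigh_eq {N : ℕ} {p : ℝ} (hp : 1 < p) {Ω : Set (EuclideanSpace ℝ (Fin N))}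
    {u : EuclideanSpace ℝ (Fin N) → ℝ} (hu : ContDiff ℝ (⊤ : ℕ∞) u) (h0 : u ≠ 0)
    (hc : HasCompactSupport u) (hs : tsupport u ⊆ Ω) :
    ENNReal.ofReal ((∫ x in Ω, ‖gradient u x‖ ^ p) / (∫ x in Ω, |u x| ^ p)) * Ip p u =
      Ip p (gradient u) := by
  have hu1 : ContDiff ℝ 1 u := hu.of_le (by exact_mod_cast le_top)
  have hp0 : p ≠ 0 := by linarith
  have e1 : (∫ x in Ω, ‖gradient u x‖ ^ p) = ∫ x, ‖gradient u x‖ ^ p := by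
    refine setIntegral_eq_integral_of_forall_compl_eq_zero fun x hx => ?_
    rw [grad_zero_of_notMem fun h => hx (hs h), norm_zero, Real.zero_rpow hp0]
  have e2 : (∫ x in Ω, |u x| ^ p) = ∫ x, |u x| ^ p := by
    refine setIntegral_eq_integral_of_forall_compl_eq_zero fun x hx => ?_
    rw [image_eq_zero_of_notMem_tsupport fun h => hx (hs h), abs_zero, Real.zero_rpow hp0]
  have i1 := Ip_eq_ofReal hp hu.continuous hc
  have i2 := Ip_eq_ofReal hp (grad_cont hu1) (grad_hasCS hc)
  simp only [Real.norm_eq_abs] at i1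
  have hn : Ip p u ≠ 0 := fun h => h0 ((Ip_zero_iff hp hu.continuous).1 h)
  have hpos : 0 < ∫ x, |u x| ^ p := by
    rw [i1] at hn; simpa using hn
  rw [e1, e2, i1, i2, ← ENNReal.ofReal_mul (div_nonneg (integral_nonneg fun x => by positivity)
    hpos.le), div_mul_cancel₀ _ hpos.ne']

theorem isL_lam1 {N : ℕ} {p : ℝ} (hp : 1 < p) {Ω : Set (EuclideanSpace ℝ (Fin N))}
    (hΩ : IsOpen Ω) (hne : Ω.Nonempty) : IsL p Ω (ENNReal.ofReal (lam1 p Ω)) := by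
  have hsm : ∀ u : EuclideanSpace ℝ (Fin N) → ℝ, ContDiff ℝ (⊤ : ℕ∞) u → HasCompactSupport u →
      tsupport u ⊆ Ω → ENNReal.ofReal (lam1 p Ω) * Ip p u ≤ Ip p (gradient u) := by
    intro u hu hc hs
    by_cases h0 : u = 0
    · rw [(Ip_zero_iff hp hu.continuous).2 h0, mul_zero]; exact zero_le
    · rw [← rayleigh_eq hp hu h0 hc hs]
      refine mul_le_mul_left (ENNReal.ofReal_le_ofReal ?_) _
      unfold lam1
      refine csInf_le ⟨0, ?_⟩ ⟨u, hu, h0, hc, hs, rfl⟩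
      rintro r ⟨u, -, -, -, -, rfl⟩
      exact div_nonneg (integral_nonneg fun x => by positivity)
        (integral_nonneg fun x => by positivity)
  refine IsL.mk' hp ENNReal.ofReal_ne_top ?_ ?_
  · intro φ hφ
    obtain ⟨v, h1, h2, h3, h4, h5⟩ := smooth_approx hp hΩ hφ.cd hφ.cs hφ.ts
    refine le_of_tendsto_of_tendsto' ?_ h5 fun n => hsm _ (h1 n) (h2 n) (h3 n)
    exact ENNReal.Tendsto.const_mul h4 (Or.inr ENNReal.ofReal_ne_top)
  · intro M hM
    obtain ⟨r, hr1, hr2⟩ : ∃ r : ℝ, lam1 p Ω < r ∧ ENNReal.ofReal r < M := by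
      obtain ⟨c, hc1, hc2⟩ := exists_between hM
      refine ⟨c.toReal, ?_, by rwa [ENNReal.ofReal_toReal hc2.ne_top]⟩
      exact (ENNReal.ofReal_lt_iff_lt_toReal (lam1_nonneg p Ω) hc2.ne_top).1 hc1
    have hnes : ∃ u : EuclideanSpace ℝ (Fin N) → ℝ, ContDiff ℝ (⊤ : ℕ∞) u ∧ u ≠ 0 ∧
        HasCompactSupport u ∧ tsupport u ⊆ Ω := by
      obtain ⟨x, hx⟩ := hne
      obtain ⟨f, hf1, hf2, hf3, -, hf5⟩ := exists_contDiff_tsupport_subset (n := (⊤ : ℕ∞))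
        (hΩ.mem_nhds hx)
      exact ⟨f, hf3, fun h => by simp [h] at hf5, hf2, hf1⟩
    obtain ⟨u0, hu0⟩ := hnes
    unfold lam1 at hr1
    obtain ⟨r', ⟨u, hu, h0, hc, hs, rfl⟩, hr'⟩ := exists_lt_of_csInf_lt
      (by exact ⟨_, u0, hu0.1, hu0.2.1, hu0.2.2.1, hu0.2.2.2, rfl⟩) hr1
    have hu1 : ContDiff ℝ 1 u := hu.of_le (by exact_mod_cast le_top)
    have hray := rayleigh_eq hp hu h0 hc hs
    have hn : Ip p u ≠ 0 := fun h => h0 ((Ip_zero_iff hp hu.continuous).1 h)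
    have hT := Ip_ne_top hp hu.continuous hc
    have hlt : Ip p (gradient u) < M * Ip p u := by
      rw [← hray]
      exact ENNReal.mul_lt_mul_left hn hT ((ENNReal.ofReal_le_ofReal hr'.le).trans_lt hr2)
    have ht := gF_Ip_tendsto hp hu1 hc
    have ht2 : Tendsto (fun n : ℕ => M * Ip p (fun x => gF (1 / ((n:ℝ) + 1)) (u x))) atTop
        (𝓝 (M * Ip p u)) := ENNReal.Tendsto.const_mul ht (Or.inl hn)
    obtain ⟨n, hn1, hn2⟩ := ((ht2.eventually_const_lt hlt).and
      (ht.eventually_ne hn)).exists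
    have := C1c_gF (p := p) hp hu1 hc hs (ε := 1 / ((n:ℝ) + 1)) (by positivity)
    exact ⟨_, this.1, hn2, this.2.trans hn1.le⟩

end PartD

section PartE
variable {E : Type*} [NormedAddCommGroup E] [InnerProductSpace ℝ E] [FiniteDimensional ℝ E]
  [MeasurableSpace E] [BorelSpace E]
variable {G : Type*} [NormedAddCommGroup G]

theorem Ip_eLp {p : ℝ} (hp : 1 < p) (F : E → G) :
    eLpNorm F (ENNReal.ofReal p) volume = (Ip p F) ^ (1 / p) := by
  rw [eLpNorm_eq_lintegral_rpow_enorm_toReal (by simp; linarith) (by simp),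
    ENNReal.toReal_ofReal (by linarith)]
  rfl

theorem Ip_eLp' {p : ℝ} (hp : 1 < p) (F : E → G) :
    Ip p F = (eLpNorm F (ENNReal.ofReal p) volume) ^ p := by
  rw [Ip_eLp hp, ← ENNReal.rpow_mul, one_div, inv_mul_cancel₀ (by linarith), ENNReal.rpow_one]

theorem Ip_add {p : ℝ} (hp : 1 < p) {F H : E → G} (hF : AEStronglyMeasurable F volume) :
    Ip p (fun x => F x + H x) ≤ 2 ^ (p - 1) * (Ip p F + Ip p H) := by
  unfold Ip
  rw [← lintegral_add_left' (hF.enorm.pow_const p),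
    ← lintegral_const_mul' _ _ (by simp [hp.le])]
  refine lintegral_mono fun x => ?_
  refine (ENNReal.rpow_le_rpow (enorm_add_le _ _) (by linarith)).trans ?_
  exact ENNReal.rpow_add_le_mul_rpow_add_rpow _ _ hp.le

theorem Ip_neg {p : ℝ} (F : E → G) : Ip p (fun x => - F x) = Ip p F := by simp [Ip]

theorem Ip_sub_comm {p : ℝ} (F H : E → G) :
    Ip p (fun x => F x - H x) = Ip p (fun x => H x - F x) := by
  unfold Ip; simp only [enorm_sub_rev]

theorem Ip_dom' {p : ℝ} (hp : 1 < p)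
    {F : ℕ → E → G} {F0 : E → G} {K : Set E} (hK : IsCompact K) {C : ℝ}
    (hF : ∀ n, AEStronglyMeasurable (F n) volume) (hC : ∀ n x, ‖F n x‖ ≤ C)
    (h0 : ∀ n, ∀ x ∉ K, F n x = 0) (ht : ∀ x, Tendsto (fun n => F n x) atTop (𝓝 (F0 x))) :
    Tendsto (fun n => Ip p (F n)) atTop (𝓝 (Ip p F0)) := by
  have hp0 : 0 < p := by linarith
  unfold Ip
  refine tendsto_lintegral_of_dominated_convergence'
    (K.indicator fun _ => (ENNReal.ofReal C) ^ p) ?_ ?_ ?_ ?_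
  · intro n
    exact (hF n).enorm.pow_const p
  · intro n
    refine Eventually.of_forall fun x => ?_
    by_cases hx : x ∈ K
    · rw [indicator_of_mem hx]
      refine ENNReal.rpow_le_rpow ?_ hp0.le
      rw [← ofReal_norm]; exact ENNReal.ofReal_le_ofReal (hC n x)
    · simp only [h0 n x hx, indicator_of_notMem hx]; simp [hp0]
  · rw [lintegral_indicator hK.measurableSet, setLIntegral_const]
    exact ENNReal.mul_ne_top (ENNReal.rpow_ne_top_of_nonneg hp0.le ENNReal.ofReal_ne_top)
      hK.measure_lt_top.ne
  · refine Eventually.of_forall fun x => ?_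
    exact ((ht x).enorm).ennrpow_const p

/-- completeness of `L^p`, in terms of `Ip`. -/
theorem Ip_complete [CompleteSpace G] {p : ℝ} (hp : 1 < p) {f : ℕ → E → G}
    (hf : ∀ n, AEStronglyMeasurable (f n) volume) (hfin : ∀ n, Ip p (f n) ≠ ⊤)
    (hcau : ∀ ε : ℝ≥0∞, 0 < ε → ∃ K, ∀ j ≥ K, ∀ k ≥ K, Ip p (fun x => f j x - f k x) ≤ ε) :
    ∃ u : E → G, StronglyMeasurable u ∧ Ip p u ≠ ⊤ ∧
      Tendsto (fun n => Ip p (fun x => f n x - u x)) atTop (𝓝 0) := by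
  have hp0 : 0 < p := by linarith
  have hq : Fact (1 ≤ ENNReal.ofReal p) := ⟨by simpa using hp.le⟩
  have hm : ∀ n, MemLp (f n) (ENNReal.ofReal p) volume := fun n =>
    ⟨hf n, by rw [Ip_eLp hp]; exact ENNReal.rpow_lt_top_of_nonneg (by positivity) (hfin n)⟩
  have hC : CauchySeq (fun n => (hm n).toLp (f n)) := by
    rw [EMetric.cauchySeq_iff]
    intro ε hε
    obtain ⟨δ, hδ0, hδ⟩ : ∃ δ, 0 < δ ∧ δ < ε := exists_between hε
    obtain ⟨K, hK⟩ := hcau (δ ^ p) (ENNReal.rpow_pos_of_nonneg hδ0 hp0.le)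
    refine ⟨K, fun j hj k hk => ?_⟩
    rw [Lp.edist_toLp_toLp, Ip_eLp hp]
    refine lt_of_le_of_lt ?_ hδ
    calc _ ≤ (δ ^ p) ^ (1/p) := ENNReal.rpow_le_rpow (hK j hj k hk) (by positivity)
      _ = δ := by rw [← ENNReal.rpow_mul, mul_one_div_cancel hp0.ne', ENNReal.rpow_one]
  obtain ⟨u, hu⟩ := cauchySeq_tendsto_of_complete hC
  refine ⟨u, Lp.stronglyMeasurable u, ?_, ?_⟩
  · rw [Ip_eLp' hp]
    exact ENNReal.rpow_ne_top_of_nonneg hp0.le (Lp.eLpNorm_ne_top u)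
  · have h2 := (tendsto_iff_edist_tendsto_0).1 hu
    have h3 := h2.ennrpow_const p
    rw [ENNReal.zero_rpow_of_pos hp0] at h3
    refine h3.congr fun n => ?_
    rw [Lp.edist_def, Ip_eLp' hp]
    congr 1
    refine eLpNorm_congr_ae ?_
    filter_upwards [(hm n).coeFn_toLp] with x hx
    simp [hx]

/-- average over a small ball -/
noncomputable def bavg (δ : ℝ) (u : E → ℝ) (x : E) : ℝ :=
  ∫ h, u (x + h) ∂(ProbabilityTheory.cond (volume : Measure E) (ball 0 δ))

theorem bavg_prob {δ : ℝ} (hδ : 0 < δ) :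
    IsProbabilityMeasure (ProbabilityTheory.cond (volume : Measure E) (ball 0 δ)) :=
  ProbabilityTheory.cond_isProbabilityMeasure_of_finite (measure_ball_pos _ _ hδ).ne'
    measure_ball_lt_top.ne

theorem cond_lint_le {δ : ℝ} (f : E → ℝ≥0∞) :
    ∫⁻ h, f h ∂(ProbabilityTheory.cond (volume : Measure E) (ball 0 δ)) ≤
      (volume (ball (0:E) δ))⁻¹ * ∫⁻ h, f h := by
  unfold ProbabilityTheory.cond
  rw [lintegral_smul_measure, smul_eq_mul]
  exact mul_le_mul_right (setLIntegral_le_lintegral _ _) _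

theorem bavg_diff {p : ℝ} (hp : 1 < p) {δ : ℝ} (hδ : 0 < δ) {u v : E → ℝ} (hu : Continuous u)
    (hv : Continuous v) (huc : HasCompactSupport u) (hvc : HasCompactSupport v) (x y : E) :
    ‖bavg δ u x - bavg δ v y‖ₑ ^ p ≤ ∫⁻ h, ‖u (x + h) - v (y + h)‖ₑ ^ p
      ∂(ProbabilityTheory.cond (volume : Measure E) (ball 0 δ)) := by
  have := bavg_prob (E := E) hδ
  have hi : ∀ {w : E → ℝ} (z : E), Continuous w → HasCompactSupport w → Integrable
      (fun h => w (z + h)) (ProbabilityTheory.cond (volume : Measure E) (ball 0 δ)) := by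
    intro w z hw hwc
    refine Continuous.integrable_of_hasCompactSupport (by fun_prop) ?_
    exact hwc.comp_homeomorph (Homeomorph.addLeft z)
  unfold bavg
  rw [← integral_sub (hi x hu huc) (hi y hv hvc)]
  refine (ENNReal.rpow_le_rpow (enorm_integral_le_lintegral_enorm _) (by linarith)).trans ?_
  exact pl_jensen _ hp _ (by fun_prop)

theorem bavg_lip {p : ℝ} (hp : 1 < p) {δ : ℝ} (hδ : 0 < δ) {u : E → ℝ} (hu : ContDiff ℝ 1 u)
    (huc : HasCompactSupport u) (x y : E) :
    ‖bavg δ u x - bavg δ u y‖ₑ ^ p ≤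
      (volume (ball (0:E) δ))⁻¹ * (‖x - y‖ₑ ^ p * Ip p (gradient u)) := by
  refine (bavg_diff hp hδ hu.continuous hu.continuous huc huc x y).trans ?_
  refine (cond_lint_le _).trans (mul_le_mul_right ?_ _)
  refine le_trans (le_of_eq ?_) (transl_univ hp hu (x - y))
  rw [← lintegral_add_left_eq_self (fun h => ‖u (h + (x - y)) - u h‖ₑ ^ p) y]
  refine lintegral_congr fun h => ?_
  congr 4; abel

theorem bavg_bdd {p : ℝ} (hp : 1 < p) {δ : ℝ} (hδ : 0 < δ) {u : E → ℝ} (hu : ContDiff ℝ 1 u)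
    (huc : HasCompactSupport u) (x : E) :
    ‖bavg δ u x‖ₑ ^ p ≤ (volume (ball (0:E) δ))⁻¹ * Ip p u := by
  have h := bavg_diff hp hδ hu.continuous (v := fun _ => 0) continuous_const huc
    HasCompactSupport.zero x x
  have h0 : bavg δ (fun _ : E => (0:ℝ)) x = 0 := by simp [bavg]
  simp only [h0, sub_zero] at h
  refine h.trans ((cond_lint_le _).trans (mul_le_mul_right (le_of_eq ?_) _))
  exact lintegral_add_left_eq_self (fun h => ‖u h‖ₑ ^ p) x

theorem bavg_close {p : ℝ} (hp : 1 < p) {δ : ℝ} (hδ : 0 < δ) {u : E → ℝ} (hu : ContDiff ℝ 1 u)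
    (huc : HasCompactSupport u) :
    Ip p (fun x => u x - bavg δ u x) ≤ ENNReal.ofReal δ ^ p * Ip p (gradient u) := by
  have := bavg_prob (E := E) hδ
  have hc := hu.continuous
  have h1 : ∀ x, ‖u x - bavg δ u x‖ₑ ^ p ≤ ∫⁻ h, ‖u (x + h) - u x‖ₑ ^ p
      ∂(ProbabilityTheory.cond (volume : Measure E) (ball 0 δ)) := by
    intro x
    have hi : Integrable (fun h => u (x + h))
        (ProbabilityTheory.cond (volume : Measure E) (ball 0 δ)) := by
      refine Continuous.integrable_of_hasCompactSupport (by fun_prop) ?_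
      exact huc.comp_homeomorph (Homeomorph.addLeft x)
    have e : bavg δ u x - u x = ∫ h, (u (x + h) - u x)
        ∂(ProbabilityTheory.cond (volume : Measure E) (ball 0 δ)) := by
      rw [integral_sub hi (integrable_const _)]; simp [bavg]
    rw [enorm_sub_rev, e]
    refine (ENNReal.rpow_le_rpow (enorm_integral_le_lintegral_enorm _) (by linarith)).trans ?_
    exact pl_jensen _ hp _ (by fun_prop)
  refine (lintegral_mono h1).trans ?_
  rw [lintegral_lintegral_swap (by fun_prop)]
  have hae : ∀ᵐ h ∂(ProbabilityTheory.cond (volume : Measure E) (ball 0 δ)), h ∈ ball (0:E) δ :=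
    ProbabilityTheory.ae_cond_mem measurableSet_ball
  calc _ ≤ ∫⁻ h, ENNReal.ofReal δ ^ p * Ip p (gradient u)
        ∂(ProbabilityTheory.cond (volume : Measure E) (ball 0 δ)) := by
        refine lintegral_mono_ae ?_
        filter_upwards [hae] with h hh
        refine (transl_univ hp hu h).trans (mul_le_mul_left ?_ _)
        refine ENNReal.rpow_le_rpow ?_ (by linarith)
        rw [← ofReal_norm]
        exact ENNReal.ofReal_le_ofReal (mem_ball_zero_iff.1 hh).le
    _ = _ := by simp

theorem bavg_zero {δ R : ℝ} (hδ : 0 < δ) (hδ1 : δ ≤ 1) {u : E → ℝ}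
    (hu : tsupport u ⊆ ball 0 R) {x : E} (hx : R + 1 ≤ ‖x‖) : bavg δ u x = 0 := by
  have hae : ∀ᵐ h ∂(ProbabilityTheory.cond (volume : Measure E) (ball 0 δ)), h ∈ ball (0:E) δ :=
    ProbabilityTheory.ae_cond_mem measurableSet_ball
  unfold bavg
  refine integral_eq_zero_of_ae ?_
  filter_upwards [hae] with h hh
  by_contra hne
  have h1 := mem_ball_zero_iff.1 (hu (subset_tsupport _ hne))
  have h2 := mem_ball_zero_iff.1 hh
  have h3 := norm_sub_le (x + h) h
  rw [add_sub_cancel_right] at h3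
  linarith

end PartE

section PartF
variable {E : Type*} [NormedAddCommGroup E] [InnerProductSpace ℝ E] [FiniteDimensional ℝ E]
  [MeasurableSpace E] [BorelSpace E]

theorem enorm_le_of_rpow {p : ℝ} (hp : 1 < p) {a : ℝ} {c : ℝ≥0∞} (hc : c ≠ ⊤)
    (h : ‖a‖ₑ ^ p ≤ c) : ‖a‖ ≤ (c ^ (1/p)).toReal := by
  have hp0 : 0 < p := by linarith
  have h1 : ‖a‖ₑ ≤ c ^ (1/p) := by
    rw [one_div]; exact (ENNReal.le_rpow_inv_iff hp0).2 h
  have := ENNReal.toReal_mono (ENNReal.rpow_ne_top_of_nonneg (by positivity) hc) h1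
  simpa using this

theorem rellich {p : ℝ} (hp : 1 < p) {R : ℝ} {φ : ℕ → E → ℝ} (hφ : ∀ k, ContDiff ℝ 1 (φ k))
    (hφc : ∀ k, HasCompactSupport (φ k)) (hφt : ∀ k, tsupport (φ k) ⊆ ball 0 R)
    {M : ℝ≥0∞} (hM : M ≠ ⊤) (h1 : ∀ k, Ip p (φ k) ≤ M) (h2 : ∀ k, Ip p (gradient (φ k)) ≤ M) :
    ∃ ns : ℕ → ℕ, StrictMono ns ∧ ∃ u : E → ℝ, StronglyMeasurable u ∧ Ip p u ≠ ⊤ ∧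
      Tendsto (fun n => Ip p (fun x => φ (ns n) x - u x)) atTop (𝓝 0) := by
  have hp0 : 0 < p := by linarith
  let δ : ℕ → ℝ := fun m => 1 / ((m:ℝ) + 1)
  have hδ : ∀ m, 0 < δ m := fun m => by positivity
  have hδ1 : ∀ m, δ m ≤ 1 := fun m => by
    rw [div_le_one (by positivity)]; linarith [Nat.cast_nonneg (α := ℝ) m]
  let T : ℕ → ℕ → E → ℝ := fun m n => bavg (δ m) (φ n)
  let c : ℕ → ℝ≥0∞ := fun m => (volume (ball (0:E) (δ m)))⁻¹
  have hc : ∀ m, c m ≠ ⊤ := fun m => ENNReal.inv_ne_top.2 (measure_ball_pos _ _ (hδ m)).ne'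
  let C : ℕ → ℝ := fun m => ((c m * M) ^ (1/p)).toReal
  have hTb : ∀ m n x, ‖T m n x‖ ≤ C m := fun m n x =>
    enorm_le_of_rpow hp (ENNReal.mul_ne_top (hc m) hM)
      ((bavg_bdd hp (hδ m) (hφ n) (hφc n) x).trans (mul_le_mul_right (h1 n) _))
  have hTl : ∀ m n x y, ‖T m n x - T m n y‖ ≤ C m * ‖x - y‖ := by
    intro m n x y
    have := enorm_le_of_rpow (c := ‖x - y‖ₑ ^ p * (c m * M)) hp (ENNReal.mul_ne_top
      (ENNReal.rpow_ne_top_of_nonneg hp0.le enorm_ne_top) (ENNReal.mul_ne_top (hc m) hM))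
      ((bavg_lip hp (hδ m) (hφ n) (hφc n) x y).trans (by
        calc _ ≤ c m * (‖x - y‖ₑ ^ p * M) := by gcongr; exact h2 n
          _ = _ := by ring))
    rw [ENNReal.mul_rpow_of_nonneg _ _ (by positivity), ← ENNReal.rpow_mul,
      mul_one_div_cancel hp0.ne', ENNReal.rpow_one, ENNReal.toReal_mul, toReal_enorm, mul_comm] at this
    exact this
  have hC0 : ∀ m, 0 ≤ C m := fun m => ENNReal.toReal_nonneg
  -- diagonal subsequence
  let a : ℕ → (ℕ × ℕ) → ℝ := fun n mi => T mi.1 n (TopologicalSpace.denseSeq E mi.2)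
  have hcomp : IsCompact (Set.pi univ fun mi : ℕ × ℕ => closedBall (0:ℝ) (C mi.1)) :=
    isCompact_univ_pi fun _ => isCompact_closedBall _ _
  obtain ⟨b, -, ns, hns, hlim⟩ := hcomp.tendsto_subseq (x := a) fun n => by
    intro mi _
    rw [mem_closedBall_zero_iff]; exact hTb _ _ _
  refine ⟨ns, hns, ?_⟩
  have hlim' : ∀ m i, Tendsto (fun n => T m (ns n) (TopologicalSpace.denseSeq E i)) atTop
      (𝓝 (b (m, i))) := fun m i => (tendsto_pi_nhds.1 hlim) (m, i)
  have hpt : ∀ m x, ∃ g, Tendsto (fun n => T m (ns n) x) atTop (𝓝 g) := by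
    intro m x
    refine cauchySeq_tendsto_of_complete ?_
    rw [Metric.cauchySeq_iff']
    intro ε hε
    obtain ⟨i, hi⟩ := (TopologicalSpace.denseRange_denseSeq E).exists_dist_lt x
      (ε := ε / (4 * (C m + 1))) (by have := hC0 m; positivity)
    have hcau := (hlim' m i).cauchySeq
    rw [Metric.cauchySeq_iff'] at hcau
    obtain ⟨K, hK⟩ := hcau (ε / 4) (by positivity)
    refine ⟨K, fun n hn => ?_⟩
    have h3 := hK n hn
    have hsm : C m * ‖x - TopologicalSpace.denseSeq E i‖ ≤ ε / 4 := by
      rw [dist_eq_norm] at hi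
      have h5 := hC0 m
      calc _ ≤ (C m + 1) * (ε / (4 * (C m + 1))) := by gcongr; linarith
        _ = ε / 4 := by field_simp
    have h4 := hTl m (ns n) x (TopologicalSpace.denseSeq E i)
    have h5 := hTl m (ns K) x (TopologicalSpace.denseSeq E i)
    rw [Real.dist_eq] at h3 ⊢
    rw [Real.norm_eq_abs] at h4 h5
    have e1 := abs_le.1 (h4.trans hsm)
    have e2 := abs_le.1 (h5.trans hsm)
    have e3 := abs_lt.1 h3
    rw [abs_lt]; constructor <;> linarith [e1.1, e1.2, e2.1, e2.2, e3.1, e3.2]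
  choose g hg using hpt
  have hTc : ∀ m n, Continuous (T m n) := fun m n =>
    (LipschitzWith.of_dist_le_mul (K := ⟨C m, hC0 m⟩) fun x y => by
      rw [dist_eq_norm, dist_eq_norm]; exact hTl m n x y).continuous
  have hgm : ∀ m, Measurable (g m) := fun m =>
    measurable_of_tendsto_metrizable (fun n => (hTc m (ns n)).measurable)
      (tendsto_pi_nhds.2 (hg m))
  have hgT : ∀ m, Tendsto (fun n => Ip p (fun x => T m (ns n) x - g m x)) atTop (𝓝 0) := by
    intro m
    have h0 : Ip p (fun _ : E => (0:ℝ)) = 0 := by simp [Ip, hp0]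
    rw [← h0]
    have hgb : ∀ x, ‖g m x‖ ≤ C m := fun x =>
      le_of_tendsto (hg m x).norm (Eventually.of_forall fun n => hTb m _ x)
    have hT0 : ∀ n, ∀ x ∉ closedBall (0:E) (R + 1), T m n x = 0 := fun n x hx => by
      rw [mem_closedBall_zero_iff, not_le] at hx
      exact bavg_zero (hδ m) (hδ1 m) (hφt n) hx.le
    refine Ip_dom' hp (isCompact_closedBall (0:E) (R + 1)) (C := C m + C m)
      (fun n => ((hTc m _).measurable.sub (hgm m)).aestronglyMeasurable)
      (fun n x => (norm_sub_le _ _).trans (add_le_add (hTb _ _ _) (hgb x))) (fun n x hx => ?_)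
      fun x => ?_
    · have : g m x = 0 := by
        refine tendsto_nhds_unique (hg m x) ?_
        simp only [hT0 _ x hx]; exact tendsto_const_nhds
      rw [hT0 _ x hx, this, sub_zero]
    · simpa using (hg m x).sub_const (g m x)
  -- Cauchy
  set A : ℝ≥0∞ := 2 ^ (p - 1) with hA
  have hAt : A ≠ ⊤ := by simp [A]
  have hcl : ∀ m n, Ip p (fun x => φ n x - T m n x) ≤ ENNReal.ofReal (δ m) ^ p * M := fun m n =>
    (bavg_close hp (hδ m) (hφ n) (hφc n)).trans (mul_le_mul_right (h2 n) _)
  have hone : ∀ m n, Ip p (fun x => φ (ns n) x - g m x) ≤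
      A * (ENNReal.ofReal (δ m) ^ p * M + Ip p (fun x => T m (ns n) x - g m x)) := by
    intro m n
    have e : (fun x => φ (ns n) x - g m x) =
      fun x => (φ (ns n) x - T m (ns n) x) + (T m (ns n) x - g m x) := by funext x; ring
    rw [e]
    refine (Ip_add hp ((hφ _).continuous.sub (hTc _ _)).aestronglyMeasurable).trans ?_
    exact mul_le_mul_right (add_le_add_left (hcl _ _) _) _
  refine Ip_complete hp (fun n => (hφ _).continuous.aestronglyMeasurable)
    (fun n => ne_top_of_le_ne_top hM (h1 _)) fun ε hε => ?_
  have t1 : Tendsto (fun m => A * (A * (ENNReal.ofReal (δ m) ^ p * M + 0) +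
      A * (ENNReal.ofReal (δ m) ^ p * M + 0))) atTop (𝓝 0) := by
    have d1 : Tendsto δ atTop (𝓝 0) := tendsto_one_div_add_atTop_nhds_zero_nat
    have d2 := (ENNReal.tendsto_ofReal d1).ennrpow_const p
    rw [ENNReal.ofReal_zero, ENNReal.zero_rpow_of_pos hp0] at d2
    have d3 := ENNReal.Tendsto.mul_const (b := M) d2 (Or.inr hM)
    have d4 := ENNReal.Tendsto.const_mul (a := A) (d3.add_const 0) (Or.inr hAt)
    have d5 := ENNReal.Tendsto.const_mul (a := A) (d4.add d4) (Or.inr hAt)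
    simpa using d5
  obtain ⟨m, hm⟩ := (t1.eventually_lt_const hε).exists
  have t2 : Tendsto (fun n => A * (ENNReal.ofReal (δ m) ^ p * M +
      Ip p (fun x => T m (ns n) x - g m x))) atTop (𝓝 (A * (ENNReal.ofReal (δ m) ^ p * M + 0))) :=
    ENNReal.Tendsto.const_mul ((hgT m).const_add _) (Or.inr hAt)
  have t3 : Tendsto (fun jk : ℕ × ℕ => A * (A * (ENNReal.ofReal (δ m) ^ p * M +
      Ip p (fun x => T m (ns jk.1) x - g m x)) + A * (ENNReal.ofReal (δ m) ^ p * M +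
      Ip p (fun x => T m (ns jk.2) x - g m x)))) (atTop ×ˢ atTop)
      (𝓝 (A * (A * (ENNReal.ofReal (δ m) ^ p * M + 0) +
      A * (ENNReal.ofReal (δ m) ^ p * M + 0)))) :=
    ENNReal.Tendsto.const_mul ((t2.comp tendsto_fst).add (t2.comp tendsto_snd)) (Or.inr hAt)
  have t4 := t3.eventually_lt_const hm
  rw [prod_atTop_atTop_eq] at t4
  obtain ⟨⟨K1, K2⟩, hK⟩ := eventually_atTop.1 t4
  refine ⟨max K1 K2, fun j hj k hk => ?_⟩
  have := hK (j, k) ⟨(le_max_left _ _).trans hj, (le_max_right _ _).trans hk⟩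
  refine le_trans ?_ this.le
  have e : (fun x => φ (ns j) x - φ (ns k) x) =
      fun x => (φ (ns j) x - g m x) + (g m x - φ (ns k) x) := by funext x; ring
  rw [e]
  refine (Ip_add hp ((hφ _).continuous.measurable.sub (hgm m)).aestronglyMeasurable).trans ?_
  refine mul_le_mul_right (add_le_add (hone m j) ?_) _
  rw [Ip_sub_comm]; exact hone m k

/-- positivity of the Poincaré constant -/
theorem Ip_le_grad {p : ℝ} (hp : 1 < p) {R : ℝ} {e : E} (he : 2 * R ≤ ‖e‖)
    {u : E → ℝ} (hu : C1c (ball 0 R) u) :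
    Ip p u ≤ ‖e‖ₑ ^ p * Ip p (gradient u) := by
  refine le_trans ?_ (transl_univ hp hu.cd e)
  refine lintegral_mono_ae (Eventually.of_forall fun x => ?_) |>.trans (le_refl (∫⁻ x, ‖u (x + e) - u x‖ₑ ^ p))
  by_cases hx : u x = 0
  · simp [hx, show 0 < p by linarith]
  · have h1 := mem_ball_zero_iff.1 (hu.ts (subset_tsupport _ hx))
    have h2 : u (x + e) = 0 := by
      by_contra h
      have h2 := mem_ball_zero_iff.1 (hu.ts (subset_tsupport _ h))
      have h3 := norm_sub_le (x + e) x
      rw [add_sub_cancel_left] at h3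
      linarith
    rw [h2, zero_sub, enorm_neg]

theorem IsL.pos [Nontrivial E] {p : ℝ} (hp : 1 < p) {R : ℝ} {Ω : Set E} (hΩ : Ω ⊆ ball 0 R)
    {L : ℝ≥0∞} (hL : IsL p Ω L) : 0 < L := by
  obtain ⟨φ, h1, h2, h3⟩ := hL.seq
  obtain ⟨e, he⟩ := NormedSpace.exists_lt_norm ℝ E (2 * R)
  rw [pos_iff_ne_zero]
  rintro rfl
  have h4 := ENNReal.Tendsto.const_mul (a := ‖e‖ₑ ^ p) h3
    (Or.inr (ENNReal.rpow_ne_top_of_nonneg (by linarith) enorm_ne_top))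
  rw [mul_zero] at h4
  obtain ⟨k, hk⟩ := (h4.eventually_lt_const zero_lt_one).exists
  have h5 := Ip_le_grad hp he.le ⟨(h1 k).cd, (h1 k).cs, (h1 k).ts.trans hΩ, (h1 k).nn⟩
  rw [h2] at h5
  exact absurd h5 (not_le.2 hk)

end PartF

section PartG
variable {E : Type*} [NormedAddCommGroup E] [InnerProductSpace ℝ E] [FiniteDimensional ℝ E]
  [MeasurableSpace E] [BorelSpace E]

theorem strictConvex_norm_rpow {p : ℝ} (hp : 1 < p) :
    StrictConvexOn ℝ univ (fun x : E => ‖x‖ ^ p) := by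
  have hp0 : 0 < p := by linarith
  refine ⟨convex_univ, fun x _ y _ hxy a b ha hb hab => ?_⟩
  simp only [smul_eq_mul]
  by_cases hn : ‖x‖ = ‖y‖
  · have h1 : a • x + b • y ∈ ball (0:E) ‖x‖ :=
      combo_mem_ball_of_ne (by simp) (by simp [hn]) hxy ha hb hab
    rw [mem_ball_zero_iff] at h1
    calc _ < ‖x‖ ^ p := Real.rpow_lt_rpow (norm_nonneg _) h1 hp0
      _ = _ := by rw [← hn, ← add_mul, hab, one_mul]
  · have h1 : ‖a • x + b • y‖ ≤ a * ‖x‖ + b * ‖y‖ := by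
      refine (norm_add_le _ _).trans (le_of_eq ?_)
      rw [norm_smul, norm_smul, Real.norm_of_nonneg ha.le, Real.norm_of_nonneg hb.le]
    refine (Real.rpow_le_rpow (norm_nonneg _) h1 hp0.le).trans_lt ?_
    exact (strictConvexOn_rpow hp).2 (norm_nonneg x) (norm_nonneg y) hn ha hb hab

theorem clarkson_like {p : ℝ} (hp : 1 < p) {δ : ℝ} (hδ : 0 < δ) : ∃ C : ℝ, 0 ≤ C ∧ ∀ a b : E,
    ‖a - b‖ ^ p + C * (2 * ‖(1/2 : ℝ) • (a + b)‖ ^ p) ≤ (δ + C) * (‖a‖ ^ p + ‖b‖ ^ p) := by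
  have hp0 : 0 < p := by linarith
  have hcn : ∀ {f : E × E → E}, Continuous f → Continuous fun z => ‖f z‖ ^ p := fun hf =>
    hf.norm.rpow_const fun _ => Or.inr hp0.le
  let S : Set (E × E) := {z | ‖z.1‖ ^ p + ‖z.2‖ ^ p = 1 ∧ δ ≤ ‖z.1 - z.2‖ ^ p}
  have hle1 : ∀ x y : E, ‖x‖ ^ p + ‖y‖ ^ p = 1 → ‖x‖ ≤ 1 ∧ ‖y‖ ≤ 1 := by
    intro x y h
    have hx : 0 ≤ ‖x‖ ^ p := by positivity
    have hy : 0 ≤ ‖y‖ ^ p := by positivity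
    constructor
    · by_contra! h1
      linarith [Real.one_lt_rpow h1 hp0]
    · by_contra! h1
      linarith [Real.one_lt_rpow h1 hp0]
  have hS : IsCompact S := by
    refine Metric.isCompact_of_isClosed_isBounded ?_ ?_
    · exact (isClosed_eq ((hcn continuous_fst).add (hcn continuous_snd)) continuous_const).inter
        (isClosed_le continuous_const (hcn (continuous_fst.sub continuous_snd)))
    · refine (Metric.isBounded_closedBall (x := (0 : E × E)) (r := 1)).subset ?_
      rintro ⟨x, y⟩ ⟨h, -⟩
      have := hle1 x y h
      rw [mem_closedBall_zero_iff, Prod.norm_def]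
      exact max_le this.1 this.2
  let Gf : E × E → ℝ := fun z => ‖z.1‖ ^ p + ‖z.2‖ ^ p - 2 * ‖(1/2 : ℝ) • (z.1 + z.2)‖ ^ p
  have hG : Continuous Gf := by
    have h1 := hcn (f := fun z => (1/2 : ℝ) • (z.1 + z.2)) (by fun_prop)
    exact ((hcn continuous_fst).add (hcn continuous_snd)).sub (continuous_const.mul h1)
  have hG0 : ∀ z, 0 ≤ Gf z := by
    rintro ⟨x, y⟩
    have := (strictConvex_norm_rpow (E := E) hp).convexOn.2 (mem_univ x) (mem_univ y)
      (by norm_num : (0:ℝ) ≤ 1/2) (by norm_num : (0:ℝ) ≤ 1/2) (by norm_num)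
    simp only [smul_eq_mul, ← smul_add] at this
    simp only [Gf]; linarith
  have hGpos : ∀ z ∈ S, 0 < Gf z := by
    rintro ⟨x, y⟩ ⟨h1, h2⟩
    have hne : x ≠ y := by
      rintro rfl
      simp only [sub_self, norm_zero, Real.zero_rpow hp0.ne'] at h2; linarith
    have := (strictConvex_norm_rpow (E := E) hp).2 (mem_univ x) (mem_univ y) hne
      (by norm_num : (0:ℝ) < 1/2) (by norm_num : (0:ℝ) < 1/2) (by norm_num)
    simp only [smul_eq_mul, ← smul_add] at this
    simp only [Gf]; linarith
  obtain ⟨m, hm, hmS⟩ : ∃ m > 0, ∀ z ∈ S, m ≤ Gf z := by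
    rcases S.eq_empty_or_nonempty with h | h
    · exact ⟨1, one_pos, by simp [h]⟩
    · obtain ⟨z, hz, hz2⟩ := hS.exists_isMinOn h hG.continuousOn
      exact ⟨Gf z, hGpos z hz, fun w hw => hz2 hw⟩
  have h2p : (0:ℝ) < 2 ^ p := by positivity
  refine ⟨2 ^ p / m, by positivity, fun a b => ?_⟩
  -- unit case
  have unit : ∀ x y : E, ‖x‖ ^ p + ‖y‖ ^ p = 1 → ‖x - y‖ ^ p ≤ δ + 2 ^ p / m * Gf (x, y) := by
    intro x y h
    by_cases hd : δ ≤ ‖x - y‖ ^ p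
    · have h1 := hmS (x, y) ⟨h, hd⟩
      have h2 : ‖x - y‖ ^ p ≤ 2 ^ p := by
        have := hle1 x y h
        refine Real.rpow_le_rpow (norm_nonneg _) ?_ hp0.le
        linarith [norm_sub_le x y, this.1, this.2]
      have h3 : 2 ^ p ≤ 2 ^ p / m * Gf (x, y) := by
        calc (2:ℝ) ^ p = 2 ^ p / m * m := by field_simp
          _ ≤ _ := by gcongr
      linarith
    · have := hG0 (x, y)
      have : 0 ≤ 2 ^ p / m * Gf (x, y) := by positivity
      linarith
  have key : ‖a - b‖ ^ p ≤ δ * (‖a‖ ^ p + ‖b‖ ^ p) + 2 ^ p / m * Gf (a, b) := by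
    set s := ‖a‖ ^ p + ‖b‖ ^ p with hs
    have hs0 : 0 ≤ s := by positivity
    rcases hs0.eq_or_lt with h0 | h0
    · have ha : ‖a‖ ^ p = 0 := by
        have : 0 ≤ ‖a‖ ^ p := by positivity
        have : 0 ≤ ‖b‖ ^ p := by positivity
        linarith
      have hb : ‖b‖ ^ p = 0 := by linarith
      have ha' : a = 0 := by
        rw [Real.rpow_eq_zero (norm_nonneg _) hp0.ne'] at ha; simpa using ha
      have hb' : b = 0 := by
        rw [Real.rpow_eq_zero (norm_nonneg _) hp0.ne'] at hb; simpa using hb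
      have := hG0 (a, b)
      have : 0 ≤ 2 ^ p / m * Gf (a, b) := by positivity
      rw [ha', hb', sub_zero, norm_zero, Real.zero_rpow hp0.ne', ← h0, mul_zero, zero_add]
      rwa [ha', hb'] at this
    · set t : ℝ := s ^ (-(1/p)) with ht
      have ht0 : 0 < t := Real.rpow_pos_of_pos h0 _
      have htp : t ^ p = s⁻¹ := by
        rw [ht, ← Real.rpow_mul h0.le, neg_mul, one_div, inv_mul_cancel₀ hp0.ne',
          Real.rpow_neg_one]
      have hsc : ∀ x : E, ‖t • x‖ ^ p = s⁻¹ * ‖x‖ ^ p := by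
        intro x
        rw [norm_smul, Real.norm_of_nonneg ht0.le, Real.mul_rpow ht0.le (norm_nonneg _), htp]
      have h1 := unit (t • a) (t • b) (by
        rw [hsc, hsc, ← mul_add, ← hs, inv_mul_cancel₀ h0.ne'])
      have h2 : Gf (t • a, t • b) = s⁻¹ * Gf (a, b) := by
        simp only [Gf]
        rw [← smul_add, smul_comm, hsc, hsc, hsc]; ring
      rw [h2, ← smul_sub, hsc] at h1
      have h3 := mul_le_mul_of_nonneg_left h1 h0.le
      rw [← mul_assoc, mul_inv_cancel₀ h0.ne', one_mul] at h3
      calc _ ≤ _ := h3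
        _ = _ := by field_simp
  simp only [Gf] at key
  nlinarith [key]

theorem C1c.add {Ω : Set E} {u v : E → ℝ} (hu : C1c Ω u) (hv : C1c Ω v) :
    C1c Ω (fun x => u x + v x) where
  cd := hu.cd.add hv.cd
  cs := hu.cs.add hv.cs
  ts := by
    refine (closure_mono (Function.support_add u v)).trans ?_
    rw [closure_union]; exact union_subset hu.ts hv.ts
  nn := fun x => add_nonneg (hu.nn x) (hv.nn x)

theorem grad_add {u v : E → ℝ} (hu : ContDiff ℝ 1 u) (hv : ContDiff ℝ 1 v) (x : E) :
    gradient (fun x => u x + v x) x = gradient u x + gradient v x := by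
  unfold gradient
  rw [fderiv_fun_add (hu.differentiable (by norm_num) x) (hv.differentiable (by norm_num) x),
    map_add]

theorem Ip_tendsto {G : Type*} [NormedAddCommGroup G] {ι : Type*} {l : Filter ι} {p : ℝ}
    (hp : 1 < p) {f : ι → E → G}
    {u : E → G} (hf : ∀ i, AEStronglyMeasurable (f i) volume) (hu : AEStronglyMeasurable u volume)
    (hfin : Ip p u ≠ ⊤)
    (h : Tendsto (fun i => Ip p (fun x => f i x - u x)) l (𝓝 0)) :
    Tendsto (fun i => Ip p (f i)) l (𝓝 (Ip p u)) := by
  have hp0 : 0 < p := by linarith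
  have hq : 1 ≤ ENNReal.ofReal p := by simpa using hp.le
  have h1 := h.ennrpow_const (1/p)
  rw [ENNReal.zero_rpow_of_pos (by positivity)] at h1
  simp only [← Ip_eLp hp] at h1
  simp only [Ip_eLp' hp]
  refine Tendsto.ennrpow_const p ?_
  have hfin' : eLpNorm u (ENNReal.ofReal p) volume ≠ ⊤ := by
    rw [Ip_eLp hp]; exact ENNReal.rpow_ne_top_of_nonneg (by positivity) hfin
  have l1 := ENNReal.Tendsto.sub (tendsto_const_nhds (x := eLpNorm u (ENNReal.ofReal p) volume)
    (f := l)) h1 (Or.inl hfin')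
  have l2 := (tendsto_const_nhds (x := eLpNorm u (ENNReal.ofReal p) volume) (f := l)).add h1
  rw [tsub_zero] at l1
  rw [add_zero] at l2
  refine tendsto_of_tendsto_of_tendsto_of_le_of_le l1 l2 (fun i => ?_) (fun i => ?_)
  · rw [tsub_le_iff_right]
    have : u = f i - (fun x => f i x - u x) := by funext x; simp
    conv_lhs => rw [this]
    exact eLpNorm_sub_le (hf i) ((hf i).sub hu) hq
  · have : f i = u + (fun x => f i x - u x) := by funext x; simp
    conv_lhs => rw [this]
    exact eLpNorm_add_le hu ((hf i).sub hu) hq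

theorem Ip_ae_subseq {G : Type*} [NormedAddCommGroup G] {p : ℝ} (hp : 1 < p) {f : ℕ → E → G}
    {u : E → G} (hf : ∀ i, AEStronglyMeasurable (f i) volume) (hu : AEStronglyMeasurable u volume)
    (h : Tendsto (fun i => Ip p (fun x => f i x - u x)) atTop (𝓝 0)) :
    ∃ ns : ℕ → ℕ, StrictMono ns ∧ ∀ᵐ x, Tendsto (fun n => f (ns n) x) atTop (𝓝 (u x)) := by
  have h1 := h.ennrpow_const (1/p)
  rw [ENNReal.zero_rpow_of_pos (by positivity)] at h1
  simp only [← Ip_eLp hp] at h1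
  have := tendstoInMeasure_of_tendsto_eLpNorm (by simp; linarith) hf hu h1
  exact this.exists_seq_tendsto_ae

/-- limits of `C1c` functions together with their gradients. -/
structure LPair (p : ℝ) (Ω : Set E) (u : E → ℝ) (U : E → E) : Prop where
  mu : Measurable u
  mU : Measurable U
  fu : Ip p u ≠ ⊤
  fU : Ip p U ≠ ⊤
  nn : ∀ x, 0 ≤ u x
  z : ∀ x ∉ Ω, u x = 0
  ex : ∃ φ : ℕ → E → ℝ, (∀ k, C1c Ω (φ k)) ∧
    Tendsto (fun k => Ip p (fun x => φ k x - u x)) atTop (𝓝 0) ∧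
    Tendsto (fun k => Ip p (fun x => gradient (φ k) x - U x)) atTop (𝓝 0) ∧
    (∀ᵐ x, Tendsto (fun k => φ k x) atTop (𝓝 (u x))) ∧
    (∀ᵐ x, Tendsto (fun k => gradient (φ k) x) atTop (𝓝 (U x)))

/-- normalised minimisers. -/
structure IsMnz (p : ℝ) (Ω : Set E) (L : ℝ≥0∞) (u : E → ℝ) (U : E → E) : Prop extends
    LPair p Ω u U where
  one : Ip p u = 1
  en : Ip p U = L

theorem min_of_seq {p : ℝ} (hp : 1 < p) {Ω : Set E} {L : ℝ≥0∞} (hL : IsL p Ω L)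
    {φ : ℕ → E → ℝ} (hφ : ∀ k, C1c Ω (φ k)) {u : E → ℝ} (mu : Measurable u)
    (nn : ∀ x, 0 ≤ u x) (z : ∀ x ∉ Ω, u x = 0) (one : Ip p u = 1)
    (hu : Tendsto (fun k => Ip p (fun x => φ k x - u x)) atTop (𝓝 0))
    (hE : Tendsto (fun k => Ip p (gradient (φ k))) atTop (𝓝 L)) :
    ∃ U, IsMnz p Ω L u U := by
  have hp0 : 0 < p := by linarith
  have mphi : ∀ k, AEStronglyMeasurable (φ k) volume := fun k =>
    (hφ k).cd.continuous.aestronglyMeasurable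
  have mgr : ∀ k, AEStronglyMeasurable (gradient (φ k)) volume := fun k =>
    (grad_cont (hφ k).cd).aestronglyMeasurable
  have hEf : ∀ k, Ip p (gradient (φ k)) ≠ ⊤ := fun k =>
    Ip_ne_top hp (grad_cont (hφ k).cd) (grad_hasCS (hφ k).cs)
  let mid : ℕ × ℕ → E → ℝ := fun jk x => (1/2) * (φ jk.1 x + φ jk.2 x)
  have hmid : ∀ jk, C1c Ω (mid jk) := fun jk => ((hφ _).add (hφ _)).smul (by norm_num)
  have hmidg : ∀ jk, gradient (mid jk) =
      fun x => (1/2 : ℝ) • (gradient (φ jk.1) x + gradient (φ jk.2) x) := by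
    intro jk
    simp only [mid]
    rw [grad_smul ((hφ jk.1).add (hφ jk.2)).cd]
    funext x
    rw [grad_add (hφ _).cd (hφ _).cd]
  have hmf : ∀ jk, Ip p (mid jk) ≠ ⊤ := fun jk =>
    Ip_ne_top hp (hmid jk).cd.continuous (hmid jk).cs
  have hmt : Tendsto (fun jk => Ip p (mid jk)) (atTop ×ˢ atTop) (𝓝 1) := by
    rw [← one]
    refine Ip_tendsto hp (fun jk => (hmid jk).cd.continuous.aestronglyMeasurable)
      mu.aestronglyMeasurable (by simp [one]) ?_
    have b1 := (hu.comp (tendsto_fst (f := atTop (α := ℕ)) (g := atTop (α := ℕ)))).add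
      (hu.comp (tendsto_snd (f := atTop (α := ℕ)) (g := atTop (α := ℕ))))
    have b2 := ENNReal.Tendsto.const_mul (a := ‖(1/2 : ℝ)‖ₑ ^ p * 2 ^ (p - 1)) b1
      (Or.inr (ENNReal.mul_ne_top (ENNReal.rpow_ne_top_of_nonneg hp0.le enorm_ne_top) (by simp)))
    simp only [add_zero, mul_zero] at b2
    refine tendsto_of_tendsto_of_tendsto_of_le_of_le tendsto_const_nhds b2
      (fun _ => zero_le) fun jk => ?_
    have e : (fun x => mid jk x - u x) =
        fun x => (1/2 : ℝ) • ((φ jk.1 x - u x) + (φ jk.2 x - u x)) := by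
      funext x; simp only [mid, smul_eq_mul]; ring
    rw [e, Ip_smul hp, mul_assoc]
    refine mul_le_mul_right ?_ _
    exact Ip_add hp ((mphi _).sub mu.aestronglyMeasurable)
  -- the basic inequality
  have basic : ∀ δ : ℝ, 0 < δ → ∃ C : ℝ, 0 ≤ C ∧ ∀ j k,
      (Ip p (fun x => gradient (φ j) x - gradient (φ k) x)).toReal +
      C * (2 * (L.toReal * (Ip p (mid (j, k))).toReal)) ≤
      (δ + C) * ((Ip p (gradient (φ j))).toReal + (Ip p (gradient (φ k))).toReal) := by
    intro δ hδ
    obtain ⟨C, hC, hCl⟩ := clarkson_like (E := E) hp hδ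
    refine ⟨C, hC, fun j k => ?_⟩
    have hintgr : ∀ {F : E → E}, Continuous F → HasCompactSupport F →
        Integrable (fun x => ‖F x‖ ^ p) volume := by
      intro F hF hc
      refine Continuous.integrable_of_hasCompactSupport
        (hF.norm.rpow_const (fun _ => Or.inr hp0.le)) ?_
      exact hc.norm.comp_left (g := fun t : ℝ => t ^ p) (Real.zero_rpow hp0.ne')
    have hrl : ∀ {F : E → E}, Continuous F → HasCompactSupport F →
        (Ip p F).toReal = ∫ x, ‖F x‖ ^ p := by
      intro F hF hc
      rw [Ip_eq_ofReal hp hF hc, ENNReal.toReal_ofReal]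
      exact integral_nonneg fun x => by positivity
    have cj := grad_cont (hφ j).cd
    have ck := grad_cont (hφ k).cd
    have sj := grad_hasCS (hφ j).cs
    have sk := grad_hasCS (hφ k).cs
    have cm := grad_cont (hmid (j, k)).cd
    have sm := grad_hasCS (hmid (j, k)).cs
    have csub : Continuous (fun x => gradient (φ j) x - gradient (φ k) x) := cj.sub ck
    have hsub : HasCompactSupport (fun x => gradient (φ j) x - gradient (φ k) x) := sj.sub sk
    have h1 : L.toReal * (Ip p (mid (j, k))).toReal ≤ (Ip p (gradient (mid (j, k)))).toReal := by
      rw [← ENNReal.toReal_mul]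
      exact ENNReal.toReal_mono (Ip_ne_top hp cm sm) (hL.poinc _ (hmid (j, k)))
    have h2 : (Ip p (fun x => gradient (φ j) x - gradient (φ k) x)).toReal +
      C * (2 * (Ip p (gradient (mid (j, k)))).toReal) ≤
      (δ + C) * ((Ip p (gradient (φ j))).toReal + (Ip p (gradient (φ k))).toReal) := by
      rw [hrl csub hsub, hrl cm sm, hrl cj sj, hrl ck sk, ← integral_const_mul,
        ← integral_const_mul, ← integral_add (hintgr cj sj) (hintgr ck sk),
        ← integral_const_mul, ← integral_add (hintgr csub hsub)
          (((hintgr cm sm).const_mul _).const_mul _)]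
      refine integral_mono ((hintgr csub hsub).add (((hintgr cm sm).const_mul _).const_mul _))
        (((hintgr cj sj).add (hintgr ck sk)).const_mul _) fun x => ?_
      simp only [hmidg]
      exact hCl _ _
    refine le_trans ?_ h2
    gcongr
  have hcau : ∀ ε : ℝ≥0∞, 0 < ε → ∃ K, ∀ j ≥ K, ∀ k ≥ K,
      Ip p (fun x => gradient (φ j) x - gradient (φ k) x) ≤ ε := by
    intro ε hε
    obtain ⟨ε', hε', hε'2⟩ : ∃ r : ℝ, 0 < r ∧ ENNReal.ofReal r ≤ ε := by
      rcases eq_or_ne ε ⊤ with rfl | h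
      · exact ⟨1, one_pos, le_top⟩
      · exact ⟨ε.toReal, ENNReal.toReal_pos hε.ne' h, by rw [ENNReal.ofReal_toReal h]⟩
    set l := L.toReal with hl
    have hl0 : 0 ≤ l := ENNReal.toReal_nonneg
    obtain ⟨C, hC, hb⟩ := basic (ε' / (4 * (l + 1))) (by positivity)
    set δ := ε' / (4 * (l + 1)) with hδ
    have hER : Tendsto (fun k => (Ip p (gradient (φ k))).toReal) atTop (𝓝 l) :=
      (ENNReal.tendsto_toReal hL.ne_top).comp hE
    have hmR : Tendsto (fun jk => (Ip p (mid jk)).toReal) (atTop ×ˢ atTop) (𝓝 1) := by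
      have := (ENNReal.tendsto_toReal ENNReal.one_ne_top).comp hmt
      rw [ENNReal.toReal_one] at this; exact this
    have t1 : Tendsto (fun jk : ℕ × ℕ => (δ + C) * ((Ip p (gradient (φ jk.1))).toReal +
        (Ip p (gradient (φ jk.2))).toReal) - C * (2 * (l * (Ip p (mid jk)).toReal)))
        (atTop ×ˢ atTop) (𝓝 ((δ + C) * (l + l) - C * (2 * (l * 1)))) :=
      (((hER.comp tendsto_fst).add (hER.comp tendsto_snd)).const_mul _).sub
        (((hmR.const_mul _).const_mul _).const_mul _)
    have hlt : (δ + C) * (l + l) - C * (2 * (l * 1)) < ε' := by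
      have : δ * (l + 1) = ε' / 4 := by rw [hδ]; field_simp
      have hδ0 : 0 < δ := by positivity
      nlinarith
    have t2 := t1.eventually_lt_const hlt
    rw [prod_atTop_atTop_eq] at t2
    obtain ⟨⟨K1, K2⟩, hK⟩ := eventually_atTop.1 t2
    refine ⟨max K1 K2, fun j hj k hk => ?_⟩
    have h3 := hK (j, k) ⟨(le_max_left _ _).trans hj, (le_max_right _ _).trans hk⟩
    have h4 := hb j k
    have h5 : (Ip p (fun x => gradient (φ j) x - gradient (φ k) x)).toReal ≤ ε' := by
      simp only at h3; linarith
    have hft : Ip p (fun x => gradient (φ j) x - gradient (φ k) x) ≠ ⊤ :=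
      Ip_ne_top hp ((grad_cont (hφ j).cd).sub (grad_cont (hφ k).cd))
        ((grad_hasCS (hφ j).cs).sub (grad_hasCS (hφ k).cs))
    refine le_trans ?_ hε'2
    rw [← ENNReal.ofReal_toReal hft]
    exact ENNReal.ofReal_le_ofReal h5
  obtain ⟨U, mU, fU, hU⟩ := Ip_complete hp mgr hEf hcau
  obtain ⟨n1, hn1, ha1⟩ := Ip_ae_subseq hp mphi mu.aestronglyMeasurable hu
  have hU1 := hU.comp hn1.tendsto_atTop
  obtain ⟨n2, hn2, ha2⟩ := Ip_ae_subseq hp (fun i => mgr (n1 i)) mU.aestronglyMeasurable hU1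
  refine ⟨U, ⟨⟨mu, mU.measurable, by simp [one], fU, nn, z, ?_⟩, one, ?_⟩⟩
  · refine ⟨fun k => φ (n1 (n2 k)), fun k => hφ _, ?_, ?_, ?_, ha2⟩
    · exact hu.comp (hn1.tendsto_atTop.comp hn2.tendsto_atTop)
    · exact hU1.comp hn2.tendsto_atTop
    · filter_upwards [ha1] with x hx
      exact hx.comp hn2.tendsto_atTop
  · exact tendsto_nhds_unique (Ip_tendsto hp mgr mU.aestronglyMeasurable fU hU) hE

theorem exists_min {p : ℝ} (hp : 1 < p) {R : ℝ} {Ω : Set E} (hΩ : Ω ⊆ ball 0 R)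
    (hΩo : IsOpen Ω) {L : ℝ≥0∞} (hL : IsL p Ω L) : ∃ u U, IsMnz p Ω L u U := by
  obtain ⟨φ, h1, h2, h3⟩ := hL.seq
  -- bound the energies
  have hb : ∃ M : ℝ≥0∞, M ≠ ⊤ ∧ ∀ᶠ k in atTop, Ip p (φ k) ≤ M ∧ Ip p (gradient (φ k)) ≤ M := by
    refine ⟨L + 1, by simp [hL.ne_top], ?_⟩
    have := h3.eventually_lt_const (ENNReal.lt_add_right hL.ne_top one_ne_zero)
    filter_upwards [this] with k hk
    exact ⟨by rw [h2]; simp, hk.le⟩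
  obtain ⟨M, hM, hev⟩ := hb
  obtain ⟨K, hK⟩ := eventually_atTop.1 hev
  obtain ⟨ns, hns, u, mu, fu, hu⟩ := rellich hp (R := R) (φ := fun k => φ (k + K))
    (fun k => (h1 _).cd) (fun k => (h1 _).cs) (fun k => (h1 _).ts.trans hΩ) hM
    (fun k => (hK _ (by omega)).1) (fun k => (hK _ (by omega)).2)
  have mphi : ∀ k, AEStronglyMeasurable (φ k) volume := fun k =>
    (h1 k).cd.continuous.aestronglyMeasurable
  obtain ⟨n1, hn1, ha1⟩ := Ip_ae_subseq hp (fun i => mphi _) mu.aestronglyMeasurable hu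
  let u' : E → ℝ := Ω.indicator (fun x => max (u x) 0)
  have hae : ∀ᵐ x, u x = u' x := by
    filter_upwards [ha1] with x hx
    by_cases hxΩ : x ∈ Ω
    · simp only [u', indicator_of_mem hxΩ]
      rw [max_eq_left]
      exact ge_of_tendsto hx (Eventually.of_forall fun k => (h1 _).nn x)
    · simp only [u', indicator_of_notMem hxΩ]
      refine tendsto_nhds_unique hx ?_
      have : ∀ k, φ k x = 0 := fun k =>
        image_eq_zero_of_notMem_tsupport fun h => hxΩ ((h1 k).ts h)
      simp only [this]; exact tendsto_const_nhds
  have hu' : Tendsto (fun n => Ip p (fun x => φ (ns n + K) x - u' x)) atTop (𝓝 0) := by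
    refine hu.congr fun n => lintegral_congr_ae ?_
    filter_upwards [hae] with x hx
    rw [hx]
  have mu' : Measurable u' := (mu.measurable.max measurable_const).indicator hΩo.measurableSet
  have hcong : Ip p u = Ip p u' := lintegral_congr_ae (by filter_upwards [hae] with x hx; rw [hx])
  have one : Ip p u' = 1 := by
    have := Ip_tendsto hp (fun i => mphi _) mu'.aestronglyMeasurable (by rwa [← hcong]) hu'
    simp only [h2] at this
    exact tendsto_nhds_unique this tendsto_const_nhds
  refine ⟨u', min_of_seq hp hL (fun k => h1 (ns k + K)) mu' ?_ ?_ one hu' ?_⟩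
  · intro x; exact indicator_nonneg (fun _ _ => le_max_right _ _) x
  · intro x hx; exact indicator_of_notMem hx _
  · exact (h3.comp (tendsto_add_atTop_nat K)).comp hns.tendsto_atTop

end PartG

section PartH
variable {E : Type*} [NormedAddCommGroup E] [InnerProductSpace ℝ E] [FiniteDimensional ℝ E]
  [MeasurableSpace E] [BorelSpace E]

/-- regularised convexity defect -/
noncomputable def dfe (p e a b : ℝ) (A B : E) : ℝ :=
  ‖A‖ ^ p + ‖B‖ ^ p -
    ‖a ^ (p - 1) • A + b ^ (p - 1) • B‖ ^ p / (a ^ p + b ^ p + e) ^ (p - 1)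

theorem dfe_aux {p : ℝ} (hp : 1 < p) {a b : ℝ} (ha : 0 < a) (hb : 0 < b) (A B : E) :
    ‖a ^ (p - 1) • A + b ^ (p - 1) • B‖ ^ p / (a ^ p + b ^ p) ^ (p - 1) =
      (a ^ p + b ^ p) * ‖(a ^ p / (a ^ p + b ^ p)) • (a⁻¹ • A) +
        (b ^ p / (a ^ p + b ^ p)) • (b⁻¹ • B)‖ ^ p := by
  have hap : 0 < a ^ p := by positivity
  have hbp : 0 < b ^ p := by positivity
  have h1 : (a ^ p / (a ^ p + b ^ p)) • (a⁻¹ • A) + (b ^ p / (a ^ p + b ^ p)) • (b⁻¹ • B) =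
      (a ^ p + b ^ p)⁻¹ • (a ^ (p - 1) • A + b ^ (p - 1) • B) := by
    rw [Real.rpow_sub_one ha.ne', Real.rpow_sub_one hb.ne', smul_add, smul_smul, smul_smul,
      smul_smul, smul_smul]
    congr 2 <;> ring
  rw [h1, norm_smul, Real.mul_rpow (norm_nonneg _) (norm_nonneg _), norm_inv,
    Real.norm_of_nonneg (by positivity), Real.inv_rpow (by positivity),
    Real.rpow_sub_one (show a ^ p + b ^ p ≠ 0 by positivity)]
  have : 0 < (a ^ p + b ^ p) ^ p := by positivity
  field_simp

theorem dfe_nonneg0 {p : ℝ} (hp : 1 < p) {a b : ℝ} (ha : 0 ≤ a) (hb : 0 ≤ b)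
    (hab : 0 < a ^ p + b ^ p) (A B : E) : 0 ≤ dfe p 0 a b A B := by
  have hp0 : 0 < p := by linarith
  have hp1 : 0 < p - 1 := by linarith
  unfold dfe
  rw [add_zero, sub_nonneg]
  rcases ha.eq_or_lt with rfl | ha
  · rw [Real.zero_rpow hp0.ne', zero_add] at *
    rw [Real.zero_rpow hp1.ne', zero_smul, zero_add, norm_smul,
      Real.mul_rpow (norm_nonneg _) (norm_nonneg _), Real.norm_of_nonneg (by positivity),
      ← Real.rpow_mul hb, ← Real.rpow_mul hb, mul_comm (p - 1) p, mul_div_assoc]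
    rcases hb.eq_or_lt with rfl | hb
    · rw [Real.zero_rpow hp0.ne'] at hab; exact absurd hab (lt_irrefl _)
    have : 0 < b ^ (p * (p - 1)) := by positivity
    rw [mul_div_cancel₀ _ this.ne']
    have : 0 ≤ ‖A‖ ^ p := by positivity
    linarith
  rcases hb.eq_or_lt with rfl | hb
  · rw [Real.zero_rpow hp0.ne', add_zero] at *
    rw [Real.zero_rpow hp1.ne', zero_smul, add_zero, norm_smul,
      Real.mul_rpow (norm_nonneg _) (norm_nonneg _), Real.norm_of_nonneg (by positivity),
      ← Real.rpow_mul ha.le, ← Real.rpow_mul ha.le, mul_comm (p - 1) p, mul_div_assoc]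
    have : 0 < a ^ (p * (p - 1)) := by positivity
    rw [mul_div_cancel₀ _ this.ne']
    have : 0 ≤ ‖B‖ ^ p := by positivity
    linarith
  rw [dfe_aux hp ha hb]
  have hap : 0 < a ^ p := by positivity
  have hbp : 0 < b ^ p := by positivity
  have h := (strictConvex_norm_rpow (E := E) hp).convexOn.2 (mem_univ (a⁻¹ • A))
    (mem_univ (b⁻¹ • B)) (show 0 ≤ a ^ p / (a ^ p + b ^ p) by positivity)
    (show 0 ≤ b ^ p / (a ^ p + b ^ p) by positivity) (by field_simp)
  have h2 := mul_le_mul_of_nonneg_left h hab.le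
  refine h2.trans (le_of_eq ?_)
  simp only [smul_eq_mul, norm_smul, norm_inv, Real.norm_of_nonneg ha.le,
    Real.norm_of_nonneg hb.le]
  rw [Real.mul_rpow (by positivity) (norm_nonneg _), Real.mul_rpow (by positivity) (norm_nonneg _),
    Real.inv_rpow ha.le, Real.inv_rpow hb.le]
  field_simp

theorem dfe_strict {p : ℝ} (hp : 1 < p) {a b : ℝ} (ha : 0 < a) (hb : 0 < b) (A B : E)
    (h0 : dfe p 0 a b A B ≤ 0) : a⁻¹ • A = b⁻¹ • B := by
  by_contra hne
  have hap : 0 < a ^ p := by positivity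
  have hbp : 0 < b ^ p := by positivity
  have hab : 0 < a ^ p + b ^ p := by positivity
  unfold dfe at h0
  rw [add_zero, dfe_aux hp ha hb] at h0
  have h := (strictConvex_norm_rpow (E := E) hp).2 (mem_univ (a⁻¹ • A))
    (mem_univ (b⁻¹ • B)) hne (show 0 < a ^ p / (a ^ p + b ^ p) by positivity)
    (show 0 < b ^ p / (a ^ p + b ^ p) by positivity) (by field_simp)
  have h2 := mul_lt_mul_of_pos_left h hab
  refine absurd h0 (not_le.2 (sub_pos.2 (h2.trans_le (le_of_eq ?_))))
  simp only [smul_eq_mul, norm_smul, norm_inv, Real.norm_of_nonneg ha.le,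
    Real.norm_of_nonneg hb.le]
  rw [Real.mul_rpow (by positivity) (norm_nonneg _), Real.mul_rpow (by positivity) (norm_nonneg _),
    Real.inv_rpow ha.le, Real.inv_rpow hb.le]
  field_simp

theorem dfe_nonneg {p : ℝ} (hp : 1 < p) {e a b : ℝ} (ha : 0 ≤ a) (hb : 0 ≤ b)
    (he : 0 < e) (A B : E) : 0 ≤ dfe p e a b A B := by
  have hp0 : 0 < p := by linarith
  have hp1 : 0 < p - 1 := by linarith
  have hap : 0 ≤ a ^ p := by positivity
  have hbp : 0 ≤ b ^ p := by positivity
  rcases (add_nonneg hap hbp).eq_or_lt with h | h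
  · have ha0 : a = 0 := by
      have : a ^ p = 0 := by linarith
      rwa [Real.rpow_eq_zero ha hp0.ne'] at this
    have hb0 : b = 0 := by
      have : b ^ p = 0 := by linarith
      rwa [Real.rpow_eq_zero hb hp0.ne'] at this
    subst ha0 hb0
    simp only [dfe, Real.zero_rpow hp1.ne', zero_smul, add_zero, norm_zero,
      Real.zero_rpow hp0.ne', zero_div, sub_zero]
    positivity
  · refine (dfe_nonneg0 hp ha hb h A B).trans ?_
    unfold dfe
    rw [add_zero]
    have : (a ^ p + b ^ p) ^ (p - 1) ≤ (a ^ p + b ^ p + e) ^ (p - 1) :=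
      Real.rpow_le_rpow h.le (by linarith) hp1.le
    gcongr

theorem C1c_lp {p : ℝ} (hp : 1 < p) {Ω : Set E} {u v : E → ℝ} (hu : C1c Ω u) (hv : C1c Ω v)
    {e : ℝ} (he : 0 < e) :
    C1c Ω (fun x => (u x ^ p + v x ^ p + e) ^ (1/p) - e ^ (1/p)) ∧
    ∀ x, ‖gradient (fun x => (u x ^ p + v x ^ p + e) ^ (1/p) - e ^ (1/p)) x‖ ^ p =
      ‖gradient u x‖ ^ p + ‖gradient v x‖ ^ p -
        dfe p e (u x) (v x) (gradient u x) (gradient v x) := by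
  have hp0 : 0 < p := by linarith
  have hp1 : 0 < p - 1 := by linarith
  have hup : ∀ x, 0 ≤ u x ^ p := fun x => Real.rpow_nonneg (hu.nn x) _
  have hvp : ∀ x, 0 ≤ v x ^ p := fun x => Real.rpow_nonneg (hv.nn x) _
  have hQ : ∀ x, 0 < u x ^ p + v x ^ p + e := fun x => by
    linarith [hup x, hvp x]
  have cp : ContDiff ℝ 1 (fun t : ℝ => t ^ p) := Real.contDiff_rpow_const_of_le (n := 1)
    (by simpa using hp.le)
  have cQ : ContDiff ℝ 1 (fun x => u x ^ p + v x ^ p + e) :=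
    ((cp.comp hu.cd).add (cp.comp hv.cd)).add contDiff_const
  have cw : ContDiff ℝ 1 (fun x => (u x ^ p + v x ^ p + e) ^ (1/p) - e ^ (1/p)) :=
    (cQ.rpow_const_of_ne fun x => (hQ x).ne').sub contDiff_const
  have hsup : Function.support (fun x => (u x ^ p + v x ^ p + e) ^ (1/p) - e ^ (1/p)) ⊆
      Function.support u ∪ Function.support v := by
    intro x hx
    by_contra h
    simp only [mem_union, Function.mem_support, not_or, not_not] at h
    refine hx ?_
    simp only [h.1, h.2, Real.zero_rpow hp0.ne', zero_add, sub_self]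
  have hts : tsupport (fun x => (u x ^ p + v x ^ p + e) ^ (1/p) - e ^ (1/p)) ⊆
      tsupport u ∪ tsupport v := by
    refine (closure_mono hsup).trans ?_
    rw [closure_union]; rfl
  refine ⟨⟨cw, ?_, hts.trans (union_subset hu.ts hv.ts), ?_⟩, ?_⟩
  · exact IsCompact.of_isClosed_subset (hu.cs.isCompact.union hv.cs.isCompact)
      (isClosed_tsupport _) hts
  · intro x
    rw [sub_nonneg]
    refine Real.rpow_le_rpow he.le ?_ (by positivity)
    linarith [hup x, hvp x]
  · intro x
    have du := hu.cd.differentiable (by norm_num) x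
    have dv := hv.cd.differentiable (by norm_num) x
    have gu := du.hasGradientAt
    have gv := dv.hasGradientAt
    have g1 : gradient (fun x => (u x ^ p + v x ^ p + e) ^ (1/p) - e ^ (1/p)) x =
        (1/p * (u x ^ p + v x ^ p + e) ^ (1/p - 1)) •
          gradient (fun x => u x ^ p + v x ^ p + e) x :=
      grad_comp (φ := fun t => t ^ (1/p) - e ^ (1/p)) (u := fun x => u x ^ p + v x ^ p + e)
        ((Real.hasDerivAt_rpow_const (Or.inl (hQ x).ne')).sub_const _)
        (cQ.differentiable (by norm_num) x)
    have g2 : gradient (fun x => u x ^ p + v x ^ p + e) x =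
        (p * u x ^ (p - 1)) • gradient u x + (p * v x ^ (p - 1)) • gradient v x := by
      rw [← grad_comp (φ := fun t => t ^ p) (Real.hasDerivAt_rpow_const (Or.inr hp.le)) du,
        ← grad_comp (φ := fun t => t ^ p) (Real.hasDerivAt_rpow_const (Or.inr hp.le)) dv,
        ← grad_add (u := fun y => u y ^ p) (v := fun y => v y ^ p) (cp.comp hu.cd) (cp.comp hv.cd)]
      unfold gradient
      rw [fderiv_add_const]
    have g3 : gradient (fun x => (u x ^ p + v x ^ p + e) ^ (1/p) - e ^ (1/p)) x =
        ((u x ^ p + v x ^ p + e) ^ (1/p - 1)) •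
        (u x ^ (p - 1) • gradient u x + v x ^ (p - 1) • gradient v x) := by
      rw [g1, g2, smul_add, smul_add, smul_smul, smul_smul, smul_smul, smul_smul]
      congr 2 <;> field_simp
    rw [g3]
    unfold dfe
    rw [norm_smul, Real.mul_rpow (norm_nonneg _) (norm_nonneg _),
      Real.norm_of_nonneg (Real.rpow_nonneg (hQ x).le _), ← Real.rpow_mul (hQ x).le]
    have : (1/p - 1) * p = -(p - 1) := by field_simp; ring
    rw [this, Real.rpow_neg (hQ x).le]
    ring

theorem dfe_int {p : ℝ} (hp : 1 < p) {Ω : Set E} {L : ℝ≥0∞} (hL : IsL p Ω L)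
    {u v : E → ℝ} (hu : C1c Ω u) (hv : C1c Ω v) {e : ℝ} (he : 0 < e) :
    ∫⁻ x, (ENNReal.ofReal (dfe p e (u x) (v x) (gradient u x) (gradient v x)) +
      L * ‖(u x ^ p + v x ^ p + e) ^ (1/p) - e ^ (1/p)‖ₑ ^ p) ≤
      Ip p (gradient u) + Ip p (gradient v) := by
  have hp0 : 0 < p := by linarith
  obtain ⟨hw, hg⟩ := C1c_lp hp hu hv he
  set w := (fun x => (u x ^ p + v x ^ p + e) ^ (1/p) - e ^ (1/p)) with hwd
  have hen : ∀ y : E, ‖y‖ₑ ^ p = ENNReal.ofReal (‖y‖ ^ p) := fun y => by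
    rw [← ofReal_norm, ENNReal.ofReal_rpow_of_nonneg (norm_nonneg _) hp0.le]
  have mw : Measurable fun x => L * ‖w x‖ₑ ^ p :=
    (hw.cd.continuous.measurable.enorm.pow_const _).const_mul _
  rw [lintegral_add_right _ mw, lintegral_const_mul _ (hw.cd.continuous.measurable.enorm.pow_const _)]
  have h1 : L * ∫⁻ x, ‖w x‖ₑ ^ p ≤ Ip p (gradient w) := hL.poinc _ hw
  have mg : ∀ {f : E → ℝ}, C1c Ω f → Measurable fun x => ‖gradient f x‖ₑ ^ p := fun hf =>
    (grad_cont hf.cd).measurable.enorm.pow_const _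
  refine (add_le_add_right h1 _).trans ?_
  unfold Ip
  rw [← lintegral_add_right _ (mg hw), ← lintegral_add_right _ (mg hv)]
  refine lintegral_mono fun x => ?_
  simp only [hen, hg x]
  have hd := dfe_nonneg hp (hu.nn x) (hv.nn x) he (gradient u x) (gradient v x)
  rw [← ENNReal.ofReal_add hd, ← ENNReal.ofReal_add (by positivity) (by positivity)]
  · refine ENNReal.ofReal_le_ofReal ?_
    linarith
  · rw [← hg x]; positivity

/-- the defect, set to zero where both functions vanish -/
noncomputable def dfc (p a b : ℝ) (A B : E) : ℝ :=
  if a ^ p + b ^ p = 0 then 0 else dfe p 0 a b A B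

theorem dfc_int {p : ℝ} (hp : 1 < p) {Ω : Set E} {L : ℝ≥0∞} (hL : IsL p Ω L)
    {u v : E → ℝ} {U V : E → E} (hu : LPair p Ω u U) (hv : LPair p Ω v V) :
    ∫⁻ x, (ENNReal.ofReal (dfc p (u x) (v x) (U x) (V x)) +
      L * (‖u x‖ₑ ^ p + ‖v x‖ₑ ^ p)) ≤ Ip p U + Ip p V := by
  have hp0 : 0 < p := by linarith
  have hp1 : 0 < p - 1 := by linarith
  obtain ⟨φ, hφ, -, f2, f3, f4⟩ := hu.ex
  obtain ⟨ψ, hψ, -, g2, g3, g4⟩ := hv.ex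
  let e : ℕ → ℝ := fun k => 1 / ((k : ℝ) + 1)
  have he : ∀ k, 0 < e k := fun k => by positivity
  have het : Tendsto e atTop (𝓝 0) := tendsto_one_div_add_atTop_nhds_zero_nat
  let F : ℕ → E → ℝ≥0∞ := fun k x =>
    ENNReal.ofReal (dfe p (e k) (φ k x) (ψ k x) (gradient (φ k) x) (gradient (ψ k) x)) +
      L * ‖(φ k x ^ p + ψ k x ^ p + e k) ^ (1/p) - e k ^ (1/p)‖ₑ ^ p
  have mF : ∀ k, AEMeasurable (F k) volume := by
    intro k
    have c1 : Measurable (φ k) := (hφ k).cd.continuous.measurable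
    have c2 : Measurable (ψ k) := (hψ k).cd.continuous.measurable
    have c3 : Measurable (gradient (φ k)) := (grad_cont (hφ k).cd).measurable
    have c4 : Measurable (gradient (ψ k)) := (grad_cont (hψ k).cd).measurable
    have : Measurable (F k) := by
      simp only [F, dfe]
      fun_prop
    exact this.aemeasurable
  have h1 : ∫⁻ x, liminf (fun k => F k x) atTop ≤
      liminf (fun k => ∫⁻ x, F k x) atTop := lintegral_liminf_le' mF
  have h2 : liminf (fun k => ∫⁻ x, F k x) atTop ≤ Ip p U + Ip p V := by
    have t : Tendsto (fun k => Ip p (gradient (φ k)) + Ip p (gradient (ψ k))) atTop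
        (𝓝 (Ip p U + Ip p V)) :=
      (Ip_tendsto hp (fun k => (grad_cont (hφ k).cd).aestronglyMeasurable)
        hu.mU.aestronglyMeasurable hu.fU f2).add
      (Ip_tendsto hp (fun k => (grad_cont (hψ k).cd).aestronglyMeasurable)
        hv.mU.aestronglyMeasurable hv.fU g2)
    rw [← t.liminf_eq]
    exact liminf_le_liminf (Eventually.of_forall fun k => dfe_int hp hL (hφ k) (hψ k) (he k))
  refine le_trans ?_ (h1.trans h2)
  refine lintegral_mono_ae ?_
  filter_upwards [f3, f4, g3, g4] with x hx1 hx2 hx3 hx4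
  have tq : Tendsto (fun k => φ k x ^ p + ψ k x ^ p + e k) atTop (𝓝 (u x ^ p + v x ^ p + 0)) :=
    ((hx1.rpow_const (Or.inr hp0.le)).add (hx3.rpow_const (Or.inr hp0.le))).add het
  have tw : Tendsto (fun k => L * ‖(φ k x ^ p + ψ k x ^ p + e k) ^ (1/p) - e k ^ (1/p)‖ₑ ^ p)
      atTop (𝓝 (L * (‖u x‖ₑ ^ p + ‖v x‖ₑ ^ p))) := by
    have t1 := (tq.rpow_const (p := 1/p) (Or.inr (by positivity))).sub
      (het.rpow_const (p := 1/p) (Or.inr (by positivity)))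
    have t2 := (t1.enorm.ennrpow_const p)
    have t3 := ENNReal.Tendsto.const_mul (a := L) t2 (Or.inr hL.ne_top)
    convert t3 using 2
    have hup : 0 ≤ u x ^ p := Real.rpow_nonneg (hu.nn x) _
    have hvp : 0 ≤ v x ^ p := Real.rpow_nonneg (hv.nn x) _
    rw [Real.zero_rpow (by positivity), sub_zero, add_zero]
    rw [Real.enorm_of_nonneg (hu.nn x), Real.enorm_of_nonneg (hv.nn x),
      Real.enorm_of_nonneg (by positivity), ENNReal.ofReal_rpow_of_nonneg (hu.nn x) hp0.le,
      ENNReal.ofReal_rpow_of_nonneg (hv.nn x) hp0.le,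
      ENNReal.ofReal_rpow_of_nonneg (by positivity) hp0.le, ← ENNReal.ofReal_add hup hvp,
      ← Real.rpow_mul (by positivity), one_div, inv_mul_cancel₀ hp0.ne', Real.rpow_one]
  by_cases h0 : u x ^ p + v x ^ p = 0
  · simp only [dfc, h0, if_true, ENNReal.ofReal_zero, zero_add]
    rw [← tw.liminf_eq]
    exact liminf_le_liminf (Eventually.of_forall fun k => le_add_self)
  · simp only [dfc, h0, if_false]
    have hne : u x ^ p + v x ^ p + 0 ≠ 0 := by rwa [add_zero]
    have td : Tendsto (fun k => dfe p (e k) (φ k x) (ψ k x) (gradient (φ k) x)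
        (gradient (ψ k) x)) atTop (𝓝 (dfe p 0 (u x) (v x) (U x) (V x))) := by
      unfold dfe
      refine ((hx2.norm.rpow_const (Or.inr hp0.le)).add
        (hx4.norm.rpow_const (Or.inr hp0.le))).sub (Tendsto.div ?_ ?_ ?_)
      · exact ((((hx1.rpow_const (Or.inr hp1.le)).smul hx2).add
          ((hx3.rpow_const (Or.inr hp1.le)).smul hx4)).norm).rpow_const (Or.inr hp0.le)
      · exact tq.rpow_const (Or.inr hp1.le)
      · have hup : 0 ≤ u x ^ p := Real.rpow_nonneg (hu.nn x) _
        have hvp : 0 ≤ v x ^ p := Real.rpow_nonneg (hv.nn x) _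
        rw [Real.rpow_ne_zero (by linarith) hp1.ne']
        exact hne
    have := ((ENNReal.tendsto_ofReal td).add tw).liminf_eq
    rw [← this]

theorem dfc_min {p : ℝ} (hp : 1 < p) {Ω : Set E} {L : ℝ≥0∞} (hL : IsL p Ω L)
    {u v : E → ℝ} {U V : E → E} (hu : IsMnz p Ω L u U) (hv : LPair p Ω v V) :
    (∫⁻ x, ENNReal.ofReal (dfc p (u x) (v x) (U x) (V x))) + L * Ip p v ≤ Ip p V := by
  have h := dfc_int hp hL hu.toLPair hv
  have mu := hu.mu.enorm.pow_const p
  have mv := hv.mu.enorm.pow_const p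
  have muv : Measurable fun x => ‖u x‖ₑ ^ p + ‖v x‖ₑ ^ p := mu.add mv
  rw [lintegral_add_right _ (muv.const_mul _), lintegral_const_mul _ muv,
    lintegral_add_left mu] at h
  have h1 : ∫⁻ x, ‖u x‖ₑ ^ p = 1 := hu.one
  rw [h1, hu.en, mul_add, mul_one, add_left_comm] at h
  exact (ENNReal.add_le_add_iff_left hL.ne_top).1 h

theorem C1c.lpair {p : ℝ} (hp : 1 < p) {Ω : Set E} {v : E → ℝ} (hv : C1c Ω v) :
    LPair p Ω v (gradient v) where
  mu := hv.cd.continuous.measurable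
  mU := (grad_cont hv.cd).measurable
  fu := Ip_ne_top hp hv.cd.continuous hv.cs
  fU := Ip_ne_top hp (grad_cont hv.cd) (grad_hasCS hv.cs)
  nn := hv.nn
  z := fun x hx => image_eq_zero_of_notMem_tsupport fun h => hx (hv.ts h)
  ex := by
    have hp0 : 0 < p := by linarith
    refine ⟨fun _ => v, fun _ => hv, ?_, ?_, ?_, ?_⟩ <;>
      simp [Ip, ENNReal.zero_rpow_of_pos hp0]

end PartH

section PartI
variable {E : Type*} [NormedAddCommGroup E] [InnerProductSpace ℝ E] [FiniteDimensional ℝ E]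
  [MeasurableSpace E] [BorelSpace E]

theorem one_sub_rpow_ge {q s : ℝ} (hq : 0 < q) (hs0 : 0 ≤ s) (hs1 : s ≤ 1) :
    min 1 q * s ≤ 1 - (1 - s) ^ q := by
  rcases le_total 1 q with h | h
  · rw [min_eq_left h, one_mul]
    have : (1 - s) ^ q ≤ (1 - s) ^ (1:ℝ) :=
      Real.rpow_le_rpow_of_exponent_ge' (by linarith) (by linarith) zero_le_one h
    rw [Real.rpow_one] at this
    linarith
  · rw [min_eq_right h]
    have := rpow_one_add_le_one_add_mul_self (s := -s) (by linarith) hq.le h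
    have e : 1 + -s = 1 - s := by ring
    rw [e] at this
    linarith

theorem dfc_lower {p : ℝ} (hp : 1 < p) {a t : ℝ} (ha : 0 ≤ a) (ht : 0 < t) (A : E) :
    min 1 (p - 1) * t ^ p * ‖(a + t)⁻¹ • A‖ ^ p ≤ 2 * dfc p a t A 0 := by
  have hp0 : 0 < p := by linarith
  have hp1 : 0 < p - 1 := by linarith
  have hap : 0 ≤ a ^ p := by positivity
  have htp : 0 < t ^ p := by positivity
  have hQ : 0 < a ^ p + t ^ p := by linarith
  have hc : 0 < min 1 (p - 1) := lt_min one_pos hp1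
  have hd : dfc p a t A 0 = ‖A‖ ^ p * (1 - (1 - t ^ p / (a ^ p + t ^ p)) ^ (p - 1)) := by
    have e1 : 1 - t ^ p / (a ^ p + t ^ p) = a ^ p / (a ^ p + t ^ p) := by field_simp; ring
    rw [e1, Real.div_rpow hap hQ.le]
    simp only [dfc, hQ.ne', if_false, dfe, norm_zero, Real.zero_rpow hp0.ne', add_zero, smul_zero]
    rw [norm_smul, Real.mul_rpow (norm_nonneg _) (norm_nonneg _),
      Real.norm_of_nonneg (by positivity), ← Real.rpow_mul ha, ← Real.rpow_mul ha,
      mul_comm (p - 1) p]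
    ring
  have h1 := one_sub_rpow_ge hp1 (s := t ^ p / (a ^ p + t ^ p)) (by positivity)
    (by rw [div_le_one hQ]; linarith)
  rw [hd, norm_smul, Real.mul_rpow (norm_nonneg _) (norm_nonneg _), norm_inv,
    Real.norm_of_nonneg (by positivity), Real.inv_rpow (by positivity)]
  have h2 : ((a + t) ^ p)⁻¹ ≤ 2 * (a ^ p + t ^ p)⁻¹ := by
    have h3 : a ^ p ≤ (a + t) ^ p := Real.rpow_le_rpow ha (by linarith) hp0.le
    have h4 : t ^ p ≤ (a + t) ^ p := Real.rpow_le_rpow ht.le (by linarith) hp0.le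
    have h5 : 0 < (a + t) ^ p := by positivity
    rw [inv_le_iff_one_le_mul₀ h5]
    rw [mul_assoc, ← div_eq_inv_mul, ← mul_div_assoc, le_div_iff₀ hQ]
    linarith
  have hA : 0 ≤ ‖A‖ ^ p := by positivity
  calc min 1 (p - 1) * t ^ p * (((a + t) ^ p)⁻¹ * ‖A‖ ^ p)
      ≤ min 1 (p - 1) * t ^ p * ((2 * (a ^ p + t ^ p)⁻¹) * ‖A‖ ^ p) := by gcongr
    _ = 2 * (‖A‖ ^ p * (min 1 (p - 1) * (t ^ p / (a ^ p + t ^ p)))) := by ring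
    _ ≤ _ := by gcongr

theorem log_bound {p : ℝ} (hp : 1 < p) {Ω : Set E} {L : ℝ≥0∞} (hL : IsL p Ω L)
    {u : E → ℝ} {U : E → E} (hu : IsMnz p Ω L u U) {φ : E → ℝ} (hφ : C1c Ω φ) {T : Set E}
    (hT : IsOpen T) (h1 : ∀ x ∈ T, φ x = 1) :
    ∃ C : ℝ≥0∞, C ≠ ⊤ ∧ ∀ t : ℝ, 0 < t → ∫⁻ x in T, ‖(u x + t)⁻¹ • U x‖ₑ ^ p ≤ C := by
  have hp0 : 0 < p := by linarith
  have hp1 : 0 < p - 1 := by linarith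
  have hc : 0 < min 1 (p - 1) := lt_min one_pos hp1
  set c := ENNReal.ofReal (min 1 (p - 1)) with hcd
  have hc0 : c ≠ 0 := by simp [hcd, hc, hp]
  have hct : c ≠ ⊤ := ENNReal.ofReal_ne_top
  have hf := Ip_ne_top hp (grad_cont hφ.cd) (grad_hasCS hφ.cs)
  refine ⟨c⁻¹ * (2 * Ip p (gradient φ)), ?_, fun t ht => ?_⟩
  · exact ENNReal.mul_ne_top (ENNReal.inv_ne_top.2 hc0) (ENNReal.mul_ne_top (by simp) hf)
  have hen : ∀ y : E, ‖y‖ₑ ^ p = ENNReal.ofReal (‖y‖ ^ p) := fun y => by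
    rw [← ofReal_norm, ENNReal.ofReal_rpow_of_nonneg (norm_nonneg _) hp0.le]
  have h2 := dfc_min hp hL hu ((hφ.smul ht.le).lpair hp)
  have h3 : Ip p (gradient fun x => t * φ x) = ENNReal.ofReal (t ^ p) * Ip p (gradient φ) := by
    rw [grad_smul hφ.cd, Ip_smul hp, Real.enorm_of_nonneg ht.le,
      ENNReal.ofReal_rpow_of_nonneg ht.le hp0.le]
  have h4 : c * ENNReal.ofReal (t ^ p) * ∫⁻ x in T, ‖(u x + t)⁻¹ • U x‖ₑ ^ p ≤
      2 * (ENNReal.ofReal (t ^ p) * Ip p (gradient φ)) := by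
    rw [← h3]
    refine le_trans ?_ (mul_le_mul_right (le_self_add.trans h2) 2)
    rw [← lintegral_const_mul _ (by have := hu.mu; have := hu.mU; fun_prop),
      ← lintegral_const_mul' _ _ (by simp)]
    refine le_trans ?_ (setLIntegral_le_lintegral T _)
    refine setLIntegral_mono' hT.measurableSet fun x hx => ?_
    have e1 : gradient (fun x => t * φ x) x = 0 := by
      have : (fun x => t * φ x) =ᶠ[𝓝 x] fun _ => t := by
        filter_upwards [hT.mem_nhds hx] with y hy
        rw [h1 y hy, mul_one]
      unfold gradient
      rw [this.fderiv_eq]; simp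
    rw [e1, h1 x hx, mul_one, hen, hcd, ← ENNReal.ofReal_mul hc.le,
      ← ENNReal.ofReal_mul (by positivity)]
    have : (2:ℝ≥0∞) = ENNReal.ofReal 2 := by simp
    rw [this, ← ENNReal.ofReal_mul (by norm_num)]
    exact ENNReal.ofReal_le_ofReal (dfc_lower hp (hu.nn x) ht _)
  have ht0 : ENNReal.ofReal (t ^ p) ≠ 0 := by
    have : 0 < t ^ p := by positivity
    simp [this]
  rw [mul_left_comm 2, mul_comm c, mul_assoc] at h4
  have h5 := (ENNReal.mul_le_mul_iff_right ht0 ENNReal.ofReal_ne_top).1 h4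
  rw [mul_comm c⁻¹, ← div_eq_mul_inv, ENNReal.le_div_iff_mul_le (Or.inl hc0) (Or.inl hct), mul_comm]
  exact h5

theorem log_transl {p : ℝ} (hp : 1 < p) {Ω : Set E} {u v : E → ℝ} {U V : E → E}
    (hu : LPair p Ω u U) (hv : LPair p Ω v V) {t : ℝ} (ht : 0 < t) (h : E) {S T : Set E}
    (hS : MeasurableSet S) (hT : MeasurableSet T)
    (hST : ∀ x ∈ S, ∀ t ∈ Icc (0:ℝ) 1, x + t • h ∈ T) :
    ∫⁻ x in S, ‖(Real.log (u (x + h) + t) - Real.log (v (x + h) + t)) -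
      (Real.log (u x + t) - Real.log (v x + t))‖ₑ ^ p ≤
      ‖h‖ₑ ^ p * ∫⁻ x in T, ‖(u x + t)⁻¹ • U x - (v x + t)⁻¹ • V x‖ₑ ^ p := by
  have hp0 : 0 < p := by linarith
  obtain ⟨φ, hφ, -, f2, f3, f4⟩ := hu.ex
  obtain ⟨ψ, hψ, -, g2, g3, g4⟩ := hv.ex
  have one : ∀ {w : E → ℝ} {W : E → E}, LPair p Ω w W → ∀ {χ : ℕ → E → ℝ}, (∀ k, C1c Ω (χ k)) →
      Tendsto (fun k => Ip p (fun x => gradient (χ k) x - W x)) atTop (𝓝 0) →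
      (∀ᵐ x, Tendsto (fun k => χ k x) atTop (𝓝 (w x))) →
      Tendsto (fun k => Ip p (fun x => (χ k x + t)⁻¹ • gradient (χ k) x - (w x + t)⁻¹ • W x))
        atTop (𝓝 0) := by
    intro w W hw χ hχ a2 a3
    have cχ : ∀ k, Measurable (χ k) := fun k => (hχ k).cd.continuous.measurable
    have cg : ∀ k, Measurable (gradient (χ k)) := fun k => (grad_cont (hχ k).cd).measurable
    have mw := hw.mu
    have mW := hw.mU
    have b1 : Tendsto (fun k => Ip p (fun x => (χ k x + t)⁻¹ • (gradient (χ k) x - W x)))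
        atTop (𝓝 0) := by
      have := ENNReal.Tendsto.const_mul (a := ‖t⁻¹‖ₑ ^ p) a2
        (Or.inr (ENNReal.rpow_ne_top_of_nonneg hp0.le enorm_ne_top))
      rw [mul_zero] at this
      refine tendsto_of_tendsto_of_tendsto_of_le_of_le tendsto_const_nhds this
        (fun _ => zero_le) fun k => ?_
      dsimp only
      rw [← Ip_smul hp]
      refine lintegral_mono fun x => ?_
      refine ENNReal.rpow_le_rpow ?_ hp0.le
      rw [enorm_le_iff_norm_le, norm_smul, norm_smul]
      refine mul_le_mul_of_nonneg_right ?_ (norm_nonneg _)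
      have := (hχ k).nn x
      rw [norm_inv, norm_inv, Real.norm_of_nonneg ht.le, Real.norm_of_nonneg (by positivity)]
      gcongr
      linarith
    have b2 : Tendsto (fun k => Ip p (fun x => ((χ k x + t)⁻¹ - (w x + t)⁻¹) • W x))
        atTop (𝓝 0) := by
      have hz : Tendsto (fun k => ∫⁻ x, ‖((χ k x + t)⁻¹ - (w x + t)⁻¹) • W x‖ₑ ^ p) atTop
          (𝓝 (∫⁻ x : E, 0)) := by
        refine tendsto_lintegral_of_dominated_convergence (fun x => ‖t⁻¹ • W x‖ₑ ^ p)
          (fun k => by have := cχ k; fun_prop) (fun k => ?_) ?_ ?_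
        · refine Eventually.of_forall fun x => ?_
          refine ENNReal.rpow_le_rpow ?_ hp0.le
          rw [enorm_le_iff_norm_le, norm_smul, norm_smul]
          refine mul_le_mul_of_nonneg_right ?_ (norm_nonneg _)
          have h1 := (hχ k).nn x
          have h2 := hw.nn x
          have i1 : (χ k x + t)⁻¹ ≤ t⁻¹ := by gcongr; linarith
          have i2 : (w x + t)⁻¹ ≤ t⁻¹ := by gcongr; linarith
          have i3 : 0 ≤ (χ k x + t)⁻¹ := by positivity
          have i4 : 0 ≤ (w x + t)⁻¹ := by positivity
          rw [Real.norm_eq_abs, Real.norm_eq_abs, abs_of_pos (inv_pos.2 ht), abs_le]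
          constructor <;> linarith
        · have := Ip_smul hp W t⁻¹
          unfold Ip at this
          rw [this]
          exact ENNReal.mul_ne_top (ENNReal.rpow_ne_top_of_nonneg hp0.le enorm_ne_top) hw.fU
        · filter_upwards [a3] with x hx
          have h2 := hw.nn x
          have t1 : Tendsto (fun k => ((χ k x + t)⁻¹ - (w x + t)⁻¹) • W x) atTop
              (𝓝 (((w x + t)⁻¹ - (w x + t)⁻¹) • W x)) :=
            (((hx.add_const t).inv₀ (by positivity)).sub_const _).smul_const _
          have := t1.enorm.ennrpow_const p
          rwa [sub_self, zero_smul, enorm_zero, ENNReal.zero_rpow_of_pos hp0] at this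
      simpa [Ip] using hz
    have b3 := ENNReal.Tendsto.const_mul (a := 2 ^ (p - 1)) (b1.add b2) (Or.inr (by simp))
    rw [add_zero, mul_zero] at b3
    refine tendsto_of_tendsto_of_tendsto_of_le_of_le tendsto_const_nhds b3
      (fun _ => zero_le) fun k => ?_
    have e : (fun x => (χ k x + t)⁻¹ • gradient (χ k) x - (w x + t)⁻¹ • W x) = fun x =>
      (χ k x + t)⁻¹ • (gradient (χ k) x - W x) + ((χ k x + t)⁻¹ - (w x + t)⁻¹) • W x := by
      funext x; rw [smul_sub, sub_smul]; abel
    dsimp only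
    rw [e]
    refine Ip_add hp ?_
    have := cχ k; have := cg k
    exact Measurable.aestronglyMeasurable (by fun_prop)
  have oneu := one hu hφ f2 f3
  have onev := one hv hψ g2 g3
  have mgr : ∀ {w : E → ℝ} {W : E → E}, Measurable w → Measurable W →
      AEStronglyMeasurable (fun x => (w x + t)⁻¹ • W x) volume := by
    intro w W h1 h2
    exact Measurable.aestronglyMeasurable (by fun_prop)
  have mφ : ∀ k, Measurable (φ k) := fun k => (hφ k).cd.continuous.measurable
  have mψ : ∀ k, Measurable (ψ k) := fun k => (hψ k).cd.continuous.measurable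
  have mgφ : ∀ k, Measurable (gradient (φ k)) := fun k => (grad_cont (hφ k).cd).measurable
  have mgψ : ∀ k, Measurable (gradient (ψ k)) := fun k => (grad_cont (hψ k).cd).measurable
  let F : E → E := fun x => (u x + t)⁻¹ • U x - (v x + t)⁻¹ • V x
  let Fk : ℕ → E → E := fun k x => (φ k x + t)⁻¹ • gradient (φ k) x -
    (ψ k x + t)⁻¹ • gradient (ψ k) x
  have hFk : Tendsto (fun k => Ip p (fun x => Fk k x - F x)) atTop (𝓝 0) := by
    have b3 := ENNReal.Tendsto.const_mul (a := 2 ^ (p - 1)) (oneu.add onev) (Or.inr (by simp))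
    rw [add_zero, mul_zero] at b3
    refine tendsto_of_tendsto_of_tendsto_of_le_of_le tendsto_const_nhds b3
      (fun _ => zero_le) fun k => ?_
    have e : (fun x => Fk k x - F x) = fun x =>
      ((φ k x + t)⁻¹ • gradient (φ k) x - (u x + t)⁻¹ • U x) +
      -((ψ k x + t)⁻¹ • gradient (ψ k) x - (v x + t)⁻¹ • V x) := by
      funext x; simp only [Fk, F]; abel
    dsimp only
    rw [e]
    refine (Ip_add hp ((mgr (mφ k) (mgφ k)).sub (mgr hu.mu hu.mU))).trans ?_
    simp only [Ip, enorm_neg]; exact le_rfl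
  have mF : AEStronglyMeasurable F volume := (mgr hu.mu hu.mU).sub (mgr hv.mu hv.mU)
  have mFk : ∀ k, AEStronglyMeasurable (Fk k) volume := fun k =>
    (mgr (mφ k) (mgφ k)).sub (mgr (mψ k) (mgψ k))
  have fF : Ip p F ≠ ⊤ := by
    have hb : ∀ {w : E → ℝ} {W : E → E}, LPair p Ω w W →
        Ip p (fun x => (w x + t)⁻¹ • W x) ≠ ⊤ := by
      intro w W hw
      refine ne_top_of_le_ne_top (b := Ip p (fun x => t⁻¹ • W x)) ?_ ?_
      · rw [Ip_smul hp]
        exact ENNReal.mul_ne_top (ENNReal.rpow_ne_top_of_nonneg hp0.le enorm_ne_top) hw.fU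
      · refine lintegral_mono fun x => ENNReal.rpow_le_rpow ?_ hp0.le
        rw [enorm_le_iff_norm_le, norm_smul, norm_smul]
        refine mul_le_mul_of_nonneg_right ?_ (norm_nonneg _)
        have := hw.nn x
        rw [norm_inv, norm_inv, Real.norm_of_nonneg ht.le, Real.norm_of_nonneg (by positivity)]
        gcongr
        linarith
    have e : F = fun x => (u x + t)⁻¹ • U x + -((v x + t)⁻¹ • V x) := by
      funext x; simp only [F]; abel
    rw [e]
    refine ne_top_of_le_ne_top ?_ (Ip_add hp (mgr hu.mu hu.mU))
    refine ENNReal.mul_ne_top (by simp) (ENNReal.add_ne_top.2 ⟨hb hu, ?_⟩)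
    have := hb hv
    simpa only [Ip, enorm_neg] using this
  have hind : ∀ G : E → E, Ip p (T.indicator G) = ∫⁻ x in T, ‖G x‖ₑ ^ p := by
    intro G
    unfold Ip
    rw [← lintegral_indicator hT]
    refine lintegral_congr fun x => ?_
    by_cases hx : x ∈ T
    · simp [hx]
    · simp [hx, hp0]
  have tF : Tendsto (fun k => ∫⁻ x in T, ‖Fk k x‖ₑ ^ p) atTop (𝓝 (∫⁻ x in T, ‖F x‖ₑ ^ p)) := by
    simp only [← hind]
    refine Ip_tendsto hp (fun k => (mFk k).indicator hT) (mF.indicator hT) ?_ ?_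
    · rw [hind]; exact ne_top_of_le_ne_top fF (setLIntegral_le_lintegral _ _)
    · refine tendsto_of_tendsto_of_tendsto_of_le_of_le tendsto_const_nhds hFk
        (fun _ => zero_le) fun k => ?_
      refine lintegral_mono fun x => ENNReal.rpow_le_rpow ?_ hp0.le
      by_cases hx : x ∈ T
      · simp [hx]
      · simp [hx]
  let fk : ℕ → E → ℝ := fun k x => Real.log (φ k x + t) - Real.log (ψ k x + t)
  have posφ : ∀ k x, 0 < φ k x + t := fun k x => by linarith [(hφ k).nn x]
  have posψ : ∀ k x, 0 < ψ k x + t := fun k x => by linarith [(hψ k).nn x]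
  have cl : ∀ {χ : E → ℝ}, C1c Ω χ → ContDiff ℝ 1 (fun x => Real.log (χ x + t)) := by
    intro χ hχ
    exact (hχ.cd.add contDiff_const).log fun x => by linarith [hχ.nn x]
  have gl : ∀ {χ : E → ℝ}, C1c Ω χ → ∀ x, gradient (fun x => Real.log (χ x + t)) x =
      (χ x + t)⁻¹ • gradient χ x := by
    intro χ hχ x
    refine grad_comp (φ := fun s => Real.log (s + t)) ?_ (hχ.cd.differentiable (by norm_num) x)
    have := ((hasDerivAt_id (χ x)).add_const t).log (by have := hχ.nn x; simp; linarith)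
    simpa using this
  have cfk : ∀ k, ContDiff ℝ 1 (fk k) := fun k => (cl (hφ k)).sub (cl (hψ k))
  have gfk : ∀ k x, gradient (fk k) x = Fk k x := by
    intro k x
    simp only [Fk]
    rw [← gl (hφ k), ← gl (hψ k)]
    unfold gradient
    simp only [fk]
    rw [fderiv_fun_sub ((cl (hφ k)).differentiable (by norm_num) x)
      ((cl (hψ k)).differentiable (by norm_num) x), map_sub]
  have htr : ∀ k, ∫⁻ x in S, ‖fk k (x + h) - fk k x‖ₑ ^ p ≤
      ‖h‖ₑ ^ p * ∫⁻ x in T, ‖Fk k x‖ₑ ^ p := by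
    intro k
    have := transl hp (cfk k) h hS hT hST
    simpa only [gfk] using this
  have tR := ENNReal.Tendsto.const_mul (a := ‖h‖ₑ ^ p) tF
    (Or.inr (ENNReal.rpow_ne_top_of_nonneg hp0.le enorm_ne_top))
  have hfk : ∀ᵐ x, Tendsto (fun k => fk k x) atTop
      (𝓝 (Real.log (u x + t) - Real.log (v x + t))) := by
    filter_upwards [f3, g3] with x h1 h2
    have := hu.nn x
    have := hv.nn x
    exact ((h1.add_const t).log (by positivity)).sub ((h2.add_const t).log (by positivity))
  have hfk' := (measurePreserving_add_right (volume : Measure E) h).quasiMeasurePreserving.ae hfk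
  calc _ ≤ ∫⁻ x in S, liminf (fun k => ‖fk k (x + h) - fk k x‖ₑ ^ p) atTop := by
        refine lintegral_mono_ae (ae_restrict_of_ae ?_)
        filter_upwards [hfk, hfk'] with x h1 h2
        exact ((h2.sub h1).enorm.ennrpow_const p).liminf_eq.ge
    _ ≤ liminf (fun k => ∫⁻ x in S, ‖fk k (x + h) - fk k x‖ₑ ^ p) atTop := by
        refine lintegral_liminf_le fun k => ?_
        have := (cfk k).continuous.measurable
        fun_prop
    _ ≤ liminf (fun k => ‖h‖ₑ ^ p * ∫⁻ x in T, ‖Fk k x‖ₑ ^ p) atTop :=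
        liminf_le_liminf (Eventually.of_forall htr)
    _ = _ := tR.liminf_eq

end PartI

section PartJ
variable {E : Type*} [NormedAddCommGroup E] [InnerProductSpace ℝ E] [FiniteDimensional ℝ E]
  [MeasurableSpace E] [BorelSpace E]

theorem exists_of_ae_ball {P : E → Prop} {x : E} {r : ℝ} (hr : 0 < r)
    (h : ∀ᵐ y, y ∈ ball x r → P y) : ∃ y ∈ ball x r, P y := by
  by_contra! hc
  have : ∀ᵐ y, y ∉ ball x r := by
    filter_upwards [h] with y hy hyb
    exact hc y hyb (hy hyb)
  rw [ae_iff] at this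
  simp only [not_not, ofPred_mem_eq] at this
  exact (measure_ball_pos volume x hr).ne' this

theorem exists_of_ae_open {P : E → Prop} {V : Set E} (hV : IsOpen V) (hne : V.Nonempty)
    (h : ∀ᵐ y, y ∈ V → P y) : ∃ y ∈ V, P y := by
  obtain ⟨x, hx⟩ := hne
  obtain ⟨r, hr, hb⟩ := Metric.isOpen_iff.1 hV x hx
  obtain ⟨y, hy, hP⟩ := exists_of_ae_ball (P := P) (x := x) hr
    (by filter_upwards [h] with y hy hyb using hy (hb hyb))
  exact ⟨y, hb hy, hP⟩

theorem const_local {g : E → ℝ} (mg : Measurable g) {x0 : E} {η : ℝ} (hη : 0 < η)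
    (h : ∀ k : E, ‖k‖ < η → ∀ᵐ x, x ∈ ball x0 η → g (x + k) = g x) :
    ∃ c, ∀ᵐ x, x ∈ ball x0 (η/2) → g x = c := by
  have h1 : ∀ᵐ k : E, ∀ᵐ x : E, ‖k‖ < η → x ∈ ball x0 η → g (x + k) = g x := by
    refine Eventually.of_forall fun k => ?_
    by_cases hk : ‖k‖ < η
    · filter_upwards [h k hk] with x hx _ using hx
    · exact Eventually.of_forall fun x h' => absurd h' hk
  have hm : MeasurableSet {z : E × E | ‖z.1‖ < η → z.2 ∈ ball x0 η → g (z.2 + z.1) = g z.2} := by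
    have a1 : MeasurableSet {z : E × E | ‖z.1‖ < η} :=
      measurableSet_lt (by fun_prop) measurable_const
    have a2 : MeasurableSet {z : E × E | z.2 ∈ ball x0 η} := measurable_snd measurableSet_ball
    have a3 : MeasurableSet {z : E × E | g (z.2 + z.1) = g z.2} :=
      measurableSet_eq_fun (by fun_prop) (by fun_prop)
    simp only [imp_iff_not_or, ofPred_or]
    exact a1.compl.union (a2.compl.union a3)
  have h2 := (Measure.ae_ae_comm (μ := (volume : Measure E)) (ν := (volume : Measure E))
    (p := fun k x => ‖k‖ < η → x ∈ ball x0 η → g (x + k) = g x) hm).1 h1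
  obtain ⟨x, hx, hP⟩ := exists_of_ae_ball (x := x0) (r := η/2) (by positivity)
    (by filter_upwards [h2] with y hy _ using hy)
  refine ⟨g x, ?_⟩
  have h3 := (measurePreserving_sub_right (volume : Measure E) x).quasiMeasurePreserving.ae hP
  filter_upwards [h3] with y hy hyb
  rw [mem_ball] at hx hyb
  have := hy ?_ ?_
  · simpa using this
  · rw [← dist_eq_norm]
    calc dist y x ≤ dist y x0 + dist x x0 := dist_triangle_right _ _ _
      _ < η := by linarith
  · rw [mem_ball]; linarith

theorem const_global {g : E → ℝ} {Ω : Set E} (hΩ : IsOpen Ω)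
    (hc : IsPreconnected Ω) (h : ∀ x ∈ Ω, ∃ η > 0, ∃ c, ∀ᵐ y, y ∈ ball x η → g y = c) :
    ∃ c, ∀ᵐ x, x ∈ Ω → g x = c := by
  rcases Ω.eq_empty_or_nonempty with rfl | ⟨x0, hx0⟩
  · exact ⟨0, by simp⟩
  obtain ⟨η0, hη0, c0, hc0⟩ := h x0 hx0
  refine ⟨c0, ?_⟩
  have hopen : ∀ P : ℝ → Prop, IsOpen {x : E | ∃ η > 0, ∃ c, P c ∧ ∀ᵐ y, y ∈ ball x η → g y = c} := by
    intro P
    rw [Metric.isOpen_iff]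
    rintro x ⟨η, hη, c, hP, hcc⟩
    refine ⟨η/2, by positivity, fun z hz => ⟨η/2, by positivity, c, hP, ?_⟩⟩
    filter_upwards [hcc] with y hy hyb
    refine hy ?_
    rw [mem_ball] at *
    calc dist y x ≤ dist y z + dist z x := dist_triangle _ _ _
      _ < η := by linarith
  have key : ∀ x ∈ Ω, ∃ η > 0, ∀ᵐ y, y ∈ ball x η → g y = c0 := by
    by_contra hcon
    rw [not_forall] at hcon
    obtain ⟨x1, hcon⟩ := hcon
    rw [Classical.not_imp] at hcon
    obtain ⟨hx1, hx1'⟩ := hcon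
    have hcov : Ω ⊆ {x : E | ∃ η > 0, ∃ c, c = c0 ∧ ∀ᵐ y, y ∈ ball x η → g y = c} ∪
        {x : E | ∃ η > 0, ∃ c, c ≠ c0 ∧ ∀ᵐ y, y ∈ ball x η → g y = c} := by
      intro x hx
      obtain ⟨η, hη, c, hcc⟩ := h x hx
      by_cases hcc0 : c = c0
      · exact Or.inl ⟨η, hη, c, hcc0, hcc⟩
      · exact Or.inr ⟨η, hη, c, hcc0, hcc⟩
    have hn2 : (Ω ∩ {x : E | ∃ η > 0, ∃ c, c ≠ c0 ∧ ∀ᵐ y, y ∈ ball x η → g y = c}).Nonempty := by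
      obtain ⟨η, hη, c, hcc⟩ := h x1 hx1
      refine ⟨x1, hx1, η, hη, c, ?_, hcc⟩
      rintro rfl
      exact hx1' ⟨η, hη, hcc⟩
    obtain ⟨z, hz, ⟨η1, hη1, c1, hp1, hcc1⟩, ⟨η2, hη2, c2, hp2, hcc2⟩⟩ :=
      hc _ _ (hopen (fun c => c = c0)) (hopen (fun c => c ≠ c0)) hcov
        ⟨x0, hx0, η0, hη0, c0, rfl, hc0⟩ hn2
    obtain ⟨y, hy, h1, h2⟩ := exists_of_ae_ball (x := z) (r := min η1 η2)
      (P := fun y => g y = c1 ∧ g y = c2) (lt_min hη1 hη2)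
      (by
        filter_upwards [hcc1, hcc2] with y h1 h2 hy
        exact ⟨h1 (ball_subset_ball (min_le_left _ _) hy),
          h2 (ball_subset_ball (min_le_right _ _) hy)⟩)
    exact hp2 (by rw [← h2, h1, hp1])
  rw [ae_iff]
  refine measure_null_of_locally_null _ fun x hx => ?_
  simp only [Classical.not_imp, mem_ofPred_eq] at hx
  obtain ⟨η, hη, hcc⟩ := key x hx.1
  refine ⟨ball x η ∩ {y | ¬ (y ∈ Ω → g y = c0)}, ?_, ?_⟩
  · exact inter_mem (mem_nhdsWithin_of_mem_nhds (ball_mem_nhds x hη)) self_mem_nhdsWithin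
  · rw [ae_iff] at hcc
    refine measure_mono_null ?_ hcc
    rintro y ⟨hy1, hy2⟩
    simp only [Classical.not_imp, mem_ofPred_eq] at hy2 ⊢
    exact ⟨hy1, hy2.2⟩

/-- a bump function in `C1c`. -/
theorem exists_bump {Ω : Set E} (hΩ : IsOpen Ω) {x0 : E} (hx : x0 ∈ Ω) :
    ∃ η > 0, ball x0 (2 * η) ⊆ Ω ∧ ∃ φ : E → ℝ, C1c Ω φ ∧ (∀ x ∈ ball x0 (2 * η), φ x = 1) ∧
      ∀ x, φ x ≤ 1 := by
  obtain ⟨r, hr, hb⟩ := Metric.isOpen_iff.1 hΩ x0 hx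
  let f : ContDiffBump x0 := ⟨r/2, 3*r/4, by positivity, by linarith⟩
  refine ⟨r/4, by positivity, (ball_subset_ball (by linarith)).trans hb, f, ⟨f.contDiff, f.hasCompactSupport, ?_, fun x => f.nonneg⟩, ?_, fun x => f.le_one⟩
  · rw [f.tsupport_eq]
    refine (closedBall_subset_ball ?_).trans hb
    show 3*r/4 < r
    linarith
  · intro x hx
    refine f.one_of_mem_closedBall ?_
    show x ∈ closedBall x0 (r/2)
    rw [mem_ball] at hx; rw [mem_closedBall]; linarith

theorem seg_in {x0 h x : E} {η t : ℝ} (hh : ‖h‖ < η) (hx : x ∈ ball x0 η) (ht : t ∈ Icc (0:ℝ) 1) :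
    x + t • h ∈ ball x0 (2 * η) := by
  rw [mem_ball, dist_eq_norm] at *
  have : ‖t • h‖ ≤ ‖h‖ := by
    rw [norm_smul, Real.norm_of_nonneg ht.1]
    exact mul_le_of_le_one_left (norm_nonneg _) ht.2
  calc ‖x + t • h - x0‖ = ‖(x - x0) + t • h‖ := by congr 1; abel
    _ ≤ ‖x - x0‖ + ‖t • h‖ := norm_add_le _ _
    _ < _ := by linarith

theorem C1c_zero (Ω : Set E) : C1c Ω (fun _ => (0:ℝ)) where
  cd := contDiff_const
  cs := HasCompactSupport.zero
  ts := by
    have : Function.support (fun _ : E => (0:ℝ)) = ∅ := Function.support_zero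
    simp [tsupport, this]
  nn := fun _ => le_rfl

theorem ae_zero_of_unbdd {f : ℕ → E → ℝ≥0∞} {S P : Set E} (hf : ∀ k, Measurable (f k))
    (hP : MeasurableSet P)
    {M : ℝ≥0∞} (hM : M ≠ ⊤) (hb : ∀ k, ∫⁻ x in S, f k x ≤ M)
    (hS : MeasurableSet S)
    (hlim : ∀ x ∈ P, Tendsto (fun k => f k x) atTop (𝓝 ⊤)) : ∀ᵐ x, x ∈ S → x ∉ P := by
  have h1 : ∫⁻ x in S, liminf (fun k => f k x) atTop ≤ M :=
    (lintegral_liminf_le hf).trans (by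
      refine (liminf_le_liminf (Eventually.of_forall hb)).trans ?_
      simp)
  have h2 : ∀ᵐ x ∂(volume.restrict S), liminf (fun k => f k x) atTop < ⊤ :=
    ae_lt_top (Measurable.liminf hf) (ne_top_of_le_ne_top hM h1)
  rw [ae_restrict_iff' hS] at h2
  filter_upwards [h2] with x hx hxS hxP
  have := hx hxS
  rw [(hlim x hxP).liminf_eq] at this
  exact lt_irrefl _ this

theorem IsMnz.pos_ae {p : ℝ} (hp : 1 < p) {Ω : Set E} (hΩ : IsOpen Ω) (hcon : IsPreconnected Ω)
    {L : ℝ≥0∞} (hL : IsL p Ω L) {u : E → ℝ} {U : E → E} (hu : IsMnz p Ω L u U) :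
    ∀ᵐ x, x ∈ Ω → 0 < u x := by
  have hp0 : 0 < p := by linarith
  let g : E → ℝ := {x | u x = 0}.indicator (fun _ => 1)
  have mg : Measurable g := measurable_const.indicator (hu.mu (measurableSet_singleton 0))
  have hv := (C1c_zero Ω).lpair hp
  have gz : ∀ x : E, gradient (fun _ : E => (0:ℝ)) x = 0 := by
    intro x; unfold gradient; simp
  have key : ∀ x0 ∈ Ω, ∃ η > 0, ∃ c, ∀ᵐ y, y ∈ ball x0 η → g y = c := by
    intro x0 hx0
    obtain ⟨η, hη, hηΩ, φ, hφ, hφ1, -⟩ := exists_bump hΩ hx0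
    obtain ⟨C, hC, hb⟩ := log_bound hp hL hu hφ isOpen_ball hφ1
    refine ⟨η/2, by positivity, const_local mg hη fun h hh => ?_⟩
    let t : ℕ → ℝ := fun k => 1 / ((k : ℝ) + 1)
    have ht : ∀ k, 0 < t k := fun k => by positivity
    have htt : Tendsto t atTop (𝓝 0) := tendsto_one_div_add_atTop_nhds_zero_nat
    let f : ℕ → E → ℝ≥0∞ := fun k x =>
      ‖Real.log (u (x + h) + t k) - Real.log (u x + t k)‖ₑ ^ p
    have mu := hu.mu
    have mf : ∀ k, Measurable (f k) := fun k => by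
      simp only [f]; fun_prop
    have hfb : ∀ k, ∫⁻ x in ball x0 η, f k x ≤ ‖h‖ₑ ^ p * C := by
      intro k
      have := log_transl hp hu.toLPair hv (ht k) h measurableSet_ball measurableSet_ball
        (fun x hx s hs => seg_in (x0 := x0) hh hx hs)
      simp only [gz, smul_zero, sub_zero, zero_add, sub_sub_sub_cancel_right] at this
      exact this.trans (mul_le_mul_right (hb (t k) (ht k)) _)
    have lim0 : ∀ {a : ℝ}, 0 < a → Tendsto (fun k => ‖Real.log (a + t k) - Real.log (0 + t k)‖ₑ ^ p)
        atTop (𝓝 ⊤) := by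
      intro a ha
      have t1 : Tendsto (fun k => Real.log (a + t k)) atTop (𝓝 (Real.log (a + 0))) :=
        (htt.const_add a).log (by positivity)
      have t2 : Tendsto (fun k => Real.log (0 + t k)) atTop atBot := by
        simp only [zero_add]
        refine Real.tendsto_log_nhdsGT_zero.comp ?_
        exact tendsto_nhdsWithin_iff.2 ⟨htt, Eventually.of_forall ht⟩
      have t3 : Tendsto (fun k => Real.log (a + t k) - Real.log (0 + t k)) atTop atTop := by
        simp only [sub_eq_add_neg]
        exact t1.add_atTop (tendsto_neg_atBot_atTop.comp t2)
      have t4 : Tendsto (fun k => ENNReal.ofReal (Real.log (a + t k) - Real.log (0 + t k))) atTop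
          (𝓝 ⊤) := ENNReal.tendsto_ofReal_atTop.comp t3
      have t5 := t4.ennrpow_const p
      rw [ENNReal.top_rpow_of_pos hp0] at t5
      refine tendsto_nhds_top_mono t5 (Eventually.of_forall fun k => ?_)
      refine ENNReal.rpow_le_rpow ?_ hp0.le
      rw [← ofReal_norm]
      exact ENNReal.ofReal_le_ofReal (Real.le_norm_self _)
    have hfin : ‖h‖ₑ ^ p * C ≠ ⊤ :=
      ENNReal.mul_ne_top (ENNReal.rpow_ne_top_of_nonneg hp0.le enorm_ne_top) hC
    have m0 : MeasurableSet {x | u x = 0} := mu (measurableSet_singleton 0)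
    have mh : Measurable fun x => u (x + h) := by fun_prop
    have m1 : MeasurableSet {x | u (x + h) = 0} := mh (measurableSet_singleton 0)
    have c1 := ae_zero_of_unbdd mf (P := {x | u x = 0} ∩ {x | u (x + h) = 0}ᶜ)
      (m0.inter m1.compl) hfin hfb measurableSet_ball (by
        rintro x ⟨h1, h2⟩
        simp only [mem_ofPred_eq, mem_compl_iff] at h1 h2
        simp only [f, h1]
        exact lim0 ((hu.nn _).lt_of_ne' h2))
    have c2 := ae_zero_of_unbdd mf (P := {x | u (x + h) = 0} ∩ {x | u x = 0}ᶜ)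
      (m1.inter m0.compl) hfin hfb measurableSet_ball (by
        rintro x ⟨h1, h2⟩
        simp only [mem_ofPred_eq, mem_compl_iff] at h1 h2
        simp only [f, h1]
        have := lim0 ((hu.nn _).lt_of_ne' h2)
        refine this.congr fun k => ?_
        rw [← enorm_neg, neg_sub])
    filter_upwards [c1, c2] with x h1 h2 hx
    have h1 := h1 hx
    have h2 := h2 hx
    simp only [mem_inter_iff, mem_ofPred_eq, mem_compl_iff, not_and, not_not] at h1 h2
    simp only [g, indicator_apply, mem_ofPred_eq]
    by_cases h3 : u x = 0
    · simp [h3, h1 h3]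
    · have : ¬ u (x + h) = 0 := fun h4 => h3 (h2 h4)
      simp [h3, this]
  obtain ⟨c, hc⟩ := const_global hΩ hcon key
  by_cases hc1 : c = 1
  · exfalso
    have : ∀ᵐ x, u x = 0 := by
      filter_upwards [hc] with x hx
      by_cases hxΩ : x ∈ Ω
      · have := hx hxΩ
        by_contra h0
        simp [g, h0, hc1] at this
      · exact hu.z x hxΩ
    have h0 : Ip p u = 0 := by
      unfold Ip
      rw [lintegral_eq_zero_iff (hu.mu.enorm.pow_const p)]
      filter_upwards [this] with x hx
      simp [hx, hp0]
    rw [hu.one] at h0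
    exact one_ne_zero h0
  · filter_upwards [hc] with x hx hxΩ
    refine (hu.nn x).lt_of_ne' fun h0 => hc1 ?_
    rw [← hx hxΩ]; simp [g, h0]

theorem IsMnz.unique {p : ℝ} (hp : 1 < p) {Ω : Set E} (hΩ : IsOpen Ω) (hcon : IsPreconnected Ω)
    {L : ℝ≥0∞} (hL : IsL p Ω L) {u v : E → ℝ} {U V : E → E} (hu : IsMnz p Ω L u U)
    (hv : IsMnz p Ω L v V) : ∀ᵐ x, u x = v x := by
  have hp0 : 0 < p := by linarith
  have mu := hu.mu
  have mv := hv.mu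
  have mU := hu.mU
  have mV := hv.mU
  have pu := hu.pos_ae hp hΩ hcon hL
  have pv := hv.pos_ae hp hΩ hcon hL
  have hd : ∀ᵐ x, x ∈ Ω → (u x)⁻¹ • U x = (v x)⁻¹ • V x := by
    have h := dfc_min hp hL hu hv.toLPair
    rw [hv.one, hv.en, mul_one] at h
    have h0 : ∫⁻ x, ENNReal.ofReal (dfc p (u x) (v x) (U x) (V x)) = 0 := by
      by_contra hne
      exact absurd h (not_le.2 (by
        rw [add_comm]; exact ENNReal.lt_add_right hL.ne_top hne))
    have md : Measurable fun x => ENNReal.ofReal (dfc p (u x) (v x) (U x) (V x)) := by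
      refine Measurable.ennreal_ofReal ?_
      simp only [dfc, dfe]
      refine Measurable.ite ?_ measurable_const (by fun_prop)
      exact measurableSet_eq_fun (by fun_prop) measurable_const
    rw [lintegral_eq_zero_iff md] at h0
    filter_upwards [h0, pu, pv] with x h1 h2 h3 hx
    have h2 := h2 hx
    have h3 := h3 hx
    have : 0 < u x ^ p + v x ^ p := by positivity
    simp only [Pi.zero_apply, ENNReal.ofReal_eq_zero, dfc, this.ne', if_false] at h1
    exact dfe_strict hp h2 h3 _ _ h1
  let g : E → ℝ := fun x => Real.log (u x) - Real.log (v x)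
  have mg : Measurable g := by simp only [g]; fun_prop
  have key : ∀ x0 ∈ Ω, ∃ η > 0, ∃ c, ∀ᵐ y, y ∈ ball x0 η → g y = c := by
    intro x0 hx0
    obtain ⟨η, hη, hηΩ, φ, hφ, hφ1, -⟩ := exists_bump hΩ hx0
    obtain ⟨C, hC, hb⟩ := log_bound hp hL hu hφ isOpen_ball hφ1
    let t : ℕ → ℝ := fun k => 1 / ((k : ℝ) + 1)
    have ht : ∀ k, 0 < t k := fun k => by positivity
    have htt : Tendsto t atTop (𝓝 0) := tendsto_one_div_add_atTop_nhds_zero_nat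
    have hinv : ∀ {a : ℝ}, 0 < a → Tendsto (fun k => (a + t k)⁻¹) atTop (𝓝 a⁻¹) := by
      intro a ha
      have := (htt.const_add a).inv₀ (by positivity)
      rwa [add_zero] at this
    have hX : ∫⁻ x in ball x0 (2 * η), ‖(u x)⁻¹ • U x‖ₑ ^ p ≤ C := by
      calc _ ≤ ∫⁻ x in ball x0 (2 * η), liminf (fun k => ‖(u x + t k)⁻¹ • U x‖ₑ ^ p) atTop := by
            refine lintegral_mono_ae ?_
            rw [ae_restrict_iff' measurableSet_ball]
            filter_upwards [pu] with x hx hxb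
            exact (((hinv (hx (hηΩ hxb))).smul_const _).enorm.ennrpow_const p).liminf_eq.ge
        _ ≤ liminf (fun k => ∫⁻ x in ball x0 (2 * η), ‖(u x + t k)⁻¹ • U x‖ₑ ^ p) atTop :=
            lintegral_liminf_le fun k => by fun_prop
        _ ≤ liminf (fun _ : ℕ => C) atTop :=
            liminf_le_liminf (Eventually.of_forall fun k => hb _ (ht k))
        _ = C := by simp
    refine ⟨η/2, by positivity, const_local mg hη fun h hh => ?_⟩
    have tR : Tendsto (fun k => ∫⁻ x in ball x0 (2 * η),
        ‖(u x + t k)⁻¹ • U x - (v x + t k)⁻¹ • V x‖ₑ ^ p) atTop (𝓝 0) := by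
      have hz : Tendsto (fun k => ∫⁻ x in ball x0 (2 * η),
        ‖(u x + t k)⁻¹ • U x - (v x + t k)⁻¹ • V x‖ₑ ^ p) atTop
          (𝓝 (∫⁻ x in ball x0 (2 * η), 0)) := by
        refine tendsto_lintegral_of_dominated_convergence (fun x => ‖(u x)⁻¹ • U x‖ₑ ^ p)
          (fun k => by fun_prop) (fun k => ?_) (ne_top_of_le_ne_top hC hX) ?_
        · refine (ae_restrict_iff' measurableSet_ball).2 ?_
          filter_upwards [pu, pv, hd] with x h1 h2 h3 hxb
          have hxΩ := hηΩ hxb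
          have h1 := h1 hxΩ
          have h2 := h2 hxΩ
          have h3 := h3 hxΩ
          have e1 : U x = u x • ((u x)⁻¹ • U x) := by rw [smul_inv_smul₀ h1.ne']
          have e2 : V x = v x • ((u x)⁻¹ • U x) := by rw [h3, smul_inv_smul₀ h2.ne']
          refine ENNReal.rpow_le_rpow ?_ hp0.le
          generalize (u x)⁻¹ • U x = X at e1 e2 ⊢
          rw [e1, e2, smul_smul, smul_smul, ← sub_smul, enorm_le_iff_norm_le, norm_smul]
          refine mul_le_of_le_one_left (norm_nonneg _) ?_
          have tk := ht k
          have i1 : 0 ≤ (u x + t k)⁻¹ * u x := by positivity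
          have i2 : 0 ≤ (v x + t k)⁻¹ * v x := by positivity
          have i3 : (u x + t k)⁻¹ * u x ≤ 1 := by
            rw [inv_mul_le_iff₀ (by positivity)]; linarith
          have i4 : (v x + t k)⁻¹ * v x ≤ 1 := by
            rw [inv_mul_le_iff₀ (by positivity)]; linarith
          rw [Real.norm_eq_abs, abs_le]
          constructor <;> linarith
        · refine (ae_restrict_iff' measurableSet_ball).2 ?_
          filter_upwards [pu, pv, hd] with x h1 h2 h3 hxb
          have hxΩ := hηΩ hxb
          have t1 := ((((hinv (h1 hxΩ)).smul_const (U x)).sub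
            ((hinv (h2 hxΩ)).smul_const (V x))).enorm.ennrpow_const p)
          rwa [h3 hxΩ, sub_self, enorm_zero, ENNReal.zero_rpow_of_pos hp0] at t1
      simpa using hz
    have tR2 := ENNReal.Tendsto.const_mul (a := ‖h‖ₑ ^ p) tR
      (Or.inr (ENNReal.rpow_ne_top_of_nonneg hp0.le enorm_ne_top))
    rw [mul_zero] at tR2
    have pu' := (measurePreserving_add_right (volume : Measure E) h).quasiMeasurePreserving.ae pu
    have pv' := (measurePreserving_add_right (volume : Measure E) h).quasiMeasurePreserving.ae pv
    have hlog : ∀ {a : ℝ}, 0 < a → Tendsto (fun k => Real.log (a + t k)) atTop (𝓝 (Real.log a)) := by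
      intro a ha
      have := (htt.const_add a).log (by positivity)
      rwa [add_zero] at this
    have h0 : ∫⁻ x in ball x0 η, ‖g (x + h) - g x‖ₑ ^ p = 0 := by
      refine le_antisymm ?_ zero_le
      calc _ ≤ ∫⁻ x in ball x0 η, liminf (fun k =>
            ‖(Real.log (u (x + h) + t k) - Real.log (v (x + h) + t k)) -
            (Real.log (u x + t k) - Real.log (v x + t k))‖ₑ ^ p) atTop := by
            refine lintegral_mono_ae ?_
            rw [ae_restrict_iff' measurableSet_ball]
            filter_upwards [pu, pv, pu', pv'] with x h1 h2 h3 h4 hxb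
            have i1 : x + h ∈ Ω := by
              have := seg_in (t := 1) hh hxb (by simp)
              rw [one_smul] at this
              exact hηΩ this
            have i2 : x ∈ Ω := by
              have := seg_in (t := 0) hh hxb (by simp)
              rw [zero_smul, add_zero] at this
              exact hηΩ this
            exact (((((hlog (h3 i1)).sub (hlog (h4 i1))).sub
              ((hlog (h1 i2)).sub (hlog (h2 i2)))).enorm).ennrpow_const p).liminf_eq.ge
        _ ≤ liminf (fun k => ∫⁻ x in ball x0 η,
            ‖(Real.log (u (x + h) + t k) - Real.log (v (x + h) + t k)) -
            (Real.log (u x + t k) - Real.log (v x + t k))‖ₑ ^ p) atTop :=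
            lintegral_liminf_le fun k => by fun_prop
        _ ≤ _ := liminf_le_liminf (Eventually.of_forall fun k =>
            log_transl hp hu.toLPair hv.toLPair (ht k) h measurableSet_ball measurableSet_ball
              (fun x hx s hs => seg_in (x0 := x0) hh hx hs))
        _ = 0 := tR2.liminf_eq
    rw [lintegral_eq_zero_iff (by fun_prop), EventuallyEq, ae_restrict_iff' measurableSet_ball] at h0
    filter_upwards [h0] with x hx hxb
    have := hx hxb
    simp only [Pi.zero_apply] at this
    rw [ENNReal.rpow_eq_zero_iff_of_pos hp0, enorm_eq_zero, sub_eq_zero] at this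
    exact this
  obtain ⟨c, hc⟩ := const_global hΩ hcon key
  have huv : ∀ᵐ x, u x = Real.exp c * v x := by
    filter_upwards [hc, pu, pv] with x h1 h2 h3
    by_cases hx : x ∈ Ω
    · have h1 := h1 hx
      have h2 := h2 hx
      have h3 := h3 hx
      simp only [g] at h1
      rw [← h1, Real.exp_sub, Real.exp_log h2, Real.exp_log h3]
      field_simp
    · rw [hu.z x hx, hv.z x hx, mul_zero]
  have e1 : Ip p u = Ip p (fun x => Real.exp c • v x) :=
    lintegral_congr_ae (by filter_upwards [huv] with x hx; simp [hx])
  rw [Ip_smul hp, hu.one, hv.one, mul_one, Real.enorm_of_nonneg (Real.exp_pos c).le] at e1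
  have e2 : ENNReal.ofReal (Real.exp c) = 1 := by
    have := congrArg (fun z => z ^ (p⁻¹)) e1.symm
    simpa [← ENNReal.rpow_mul, mul_inv_cancel₀ hp0.ne'] using this
  rw [ENNReal.ofReal_eq_one] at e2
  filter_upwards [huv] with x hx
  rw [hx, e2, one_mul]

end PartJ

section PartK
variable {E : Type*} [NormedAddCommGroup E] [InnerProductSpace ℝ E] [FiniteDimensional ℝ E]
  [MeasurableSpace E] [BorelSpace E]

/-- C¹ truncation which is flat at `κ`. -/
noncomputable def hK (ε κ s : ℝ) : ℝ := hF ε (s - κ) + hF ε κ - hF ε (κ - s)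
/-- derivative of `hK`. -/
noncomputable def hKd (ε κ s : ℝ) : ℝ := thF ε (s - κ) + thF ε (κ - s)

theorem hF_mono (ε : ℝ) : Monotone (hF ε) :=
  monotone_of_deriv_nonneg (fun s => (hF_deriv ε s).differentiableAt)
    fun s => by rw [(hF_deriv ε s).deriv]; exact thF_nonneg _ _

theorem hK_deriv (ε κ s : ℝ) : HasDerivAt (hK ε κ) (hKd ε κ s) s := by
  have h1 : HasDerivAt (fun t : ℝ => t - κ) 1 s := (hasDerivAt_id s).sub_const κ
  have h2 : HasDerivAt (fun t : ℝ => κ - t) (-1) s := (hasDerivAt_id s).const_sub κ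
  have := (((hF_deriv ε (s - κ)).comp s h1).add_const (hF ε κ)).sub ((hF_deriv ε (κ - s)).comp s h2)
  convert! this using 1
  unfold hKd; ring

theorem hKd_cont (ε κ : ℝ) : Continuous (hKd ε κ) := by
  unfold hKd
  exact ((thF_cont ε).comp (by fun_prop)).add ((thF_cont ε).comp (by fun_prop))

theorem hK_cd (ε κ : ℝ) : ContDiff ℝ 1 (hK ε κ) := by
  rw [contDiff_one_iff_deriv]
  refine ⟨fun s => (hK_deriv ε κ s).differentiableAt, ?_⟩
  have : deriv (hK ε κ) = hKd ε κ := funext fun s => (hK_deriv ε κ s).deriv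
  rw [this]; exact hKd_cont ε κ

theorem hKd_abs {ε : ℝ} (hε : 0 < ε) (κ s : ℝ) : |hKd ε κ s| ≤ 1 := by
  unfold hKd
  rw [abs_of_nonneg (add_nonneg (thF_nonneg _ _) (thF_nonneg _ _))]
  rcases le_total s κ with h | h
  · rw [thF_zero hε (sub_nonpos.2 h), zero_add]; exact thF_le _ _
  · rw [thF_zero (t := κ - s) hε (sub_nonpos.2 h), add_zero]; exact thF_le _ _

theorem hKd_kappa {ε : ℝ} (hε : 0 < ε) (κ : ℝ) : hKd ε κ κ = 0 := by
  unfold hKd; rw [sub_self, thF_zero hε le_rfl, add_zero]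

theorem hK_zero {ε κ : ℝ} (hε : 0 < ε) (hκ : 0 < κ) : hK ε κ 0 = 0 := by
  unfold hK; rw [hF_zero hε (by linarith), sub_zero]; ring

theorem hK_nonneg {ε κ s : ℝ} (hε : 0 < ε) (hκ : 0 < κ) (hs : 0 ≤ s) : 0 ≤ hK ε κ s := by
  unfold hK
  have h1 := hF_mono ε (show κ - s ≤ κ by linarith)
  have h2 := hF_nonneg hε (s - κ)
  linarith

theorem hK_near {ε κ s : ℝ} (hε : 0 < ε) (hκ : 0 < κ) : |hK ε κ s - s| ≤ 2 * ε := by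
  unfold hK
  have a1 := hF_le hε κ
  have a2 := hF_ge hε κ
  rw [max_eq_left hκ.le] at a1
  rw [abs_le]
  rcases le_total s κ with h | h
  · rw [hF_zero (s := s - κ) hε (sub_nonpos.2 h)]
    have a3 := hF_le hε (κ - s)
    have a4 := hF_ge hε (κ - s)
    rw [max_eq_left (by linarith)] at a3
    constructor <;> linarith
  · rw [hF_zero (s := κ - s) hε (sub_nonpos.2 h)]
    have a3 := hF_le hε (s - κ)
    have a4 := hF_ge hε (s - κ)
    rw [max_eq_left (by linarith)] at a3
    constructor <;> linarith

theorem C1c_hK {Ω : Set E} {u : E → ℝ} (hu : C1c Ω u) {ε κ : ℝ} (hε : 0 < ε) (hκ : 0 < κ) :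
    C1c Ω (fun x => hK ε κ (u x)) := by
  have hg0 := hK_zero hε hκ
  refine ⟨(hK_cd ε κ).comp hu.cd, hu.cs.comp_left hg0, ?_, fun x => hK_nonneg hε hκ (hu.nn x)⟩
  refine (closure_mono fun x hx => ?_).trans hu.ts
  simp only [Function.mem_support] at hx ⊢
  exact fun h => hx (by rw [h, hg0])

theorem trunc_tendsto {p : ℝ} (hp : 1 < p) {θ : ℝ → ℝ} (hθ : Continuous θ) (hθ1 : ∀ s, |θ s| ≤ 1)
    {w : E → ℝ} {W : E → E} (mw : Measurable w) (mW : Measurable W) (fW : Ip p W ≠ ⊤)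
    {χ : ℕ → E → ℝ} {G : ℕ → E → E} (cχ : ∀ k, Measurable (χ k)) (cg : ∀ k, Measurable (G k))
    (a2 : Tendsto (fun k => Ip p (fun x => G k x - W x)) atTop (𝓝 0))
    (a3 : ∀ᵐ x, Tendsto (fun k => χ k x) atTop (𝓝 (w x))) :
    Tendsto (fun k => Ip p (fun x => θ (χ k x) • G k x)) atTop (𝓝 (Ip p fun x => θ (w x) • W x)) := by
  have hp0 : 0 < p := by linarith
  have mθ := hθ.measurable
  have hle : ∀ (s : ℝ) (v : E), ‖θ s • v‖ ≤ ‖v‖ := fun s v => by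
    rw [norm_smul]; exact mul_le_of_le_one_left (norm_nonneg _) (hθ1 s)
  refine Ip_tendsto hp (fun k => ?_) ?_ ?_ ?_
  · have := cχ k; have := cg k
    exact Measurable.aestronglyMeasurable (by fun_prop)
  · exact Measurable.aestronglyMeasurable (by fun_prop)
  · refine ne_top_of_le_ne_top fW (lintegral_mono fun x => ENNReal.rpow_le_rpow ?_ hp0.le)
    rw [enorm_le_iff_norm_le]; exact hle _ _
  have b1 : Tendsto (fun k => Ip p (fun x => θ (χ k x) • (G k x - W x))) atTop (𝓝 0) := by
    refine tendsto_of_tendsto_of_tendsto_of_le_of_le tendsto_const_nhds a2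
      (fun _ => zero_le) fun k => ?_
    refine lintegral_mono fun x => ENNReal.rpow_le_rpow ?_ hp0.le
    rw [enorm_le_iff_norm_le]; exact hle _ _
  have b2 : Tendsto (fun k => Ip p (fun x => (θ (χ k x) - θ (w x)) • W x)) atTop (𝓝 0) := by
    have hz : Tendsto (fun k => ∫⁻ x, ‖(θ (χ k x) - θ (w x)) • W x‖ₑ ^ p) atTop
        (𝓝 (∫⁻ x : E, 0)) := by
      refine tendsto_lintegral_of_dominated_convergence (fun x => ‖(2:ℝ) • W x‖ₑ ^ p)
        (fun k => by have := cχ k; fun_prop) (fun k => ?_) ?_ ?_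
      · refine Eventually.of_forall fun x => ?_
        refine ENNReal.rpow_le_rpow ?_ hp0.le
        rw [enorm_le_iff_norm_le, norm_smul, norm_smul]
        refine mul_le_mul_of_nonneg_right ?_ (norm_nonneg _)
        have i1 := abs_le.1 (hθ1 (χ k x))
        have i2 := abs_le.1 (hθ1 (w x))
        rw [Real.norm_eq_abs, Real.norm_eq_abs, abs_of_pos (by norm_num : (0:ℝ) < 2), abs_le]
        constructor <;> linarith
      · have := Ip_smul hp W (2:ℝ)
        unfold Ip at this
        rw [this]
        exact ENNReal.mul_ne_top (ENNReal.rpow_ne_top_of_nonneg hp0.le enorm_ne_top) fW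
      · filter_upwards [a3] with x hx
        have t1 : Tendsto (fun k => (θ (χ k x) - θ (w x)) • W x) atTop
            (𝓝 ((θ (w x) - θ (w x)) • W x)) :=
          (((hθ.tendsto _).comp hx).sub_const _).smul_const _
        have := t1.enorm.ennrpow_const p
        rwa [sub_self, zero_smul, enorm_zero, ENNReal.zero_rpow_of_pos hp0] at this
    simpa [Ip] using hz
  have b3 := ENNReal.Tendsto.const_mul (a := 2 ^ (p - 1)) (b1.add b2) (Or.inr (by simp))
  rw [add_zero, mul_zero] at b3
  refine tendsto_of_tendsto_of_tendsto_of_le_of_le tendsto_const_nhds b3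
    (fun _ => zero_le) fun k => ?_
  have e : (fun x => θ (χ k x) • G k x - θ (w x) • W x) = fun x =>
    θ (χ k x) • (G k x - W x) + (θ (χ k x) - θ (w x)) • W x := by
    funext x; rw [smul_sub, sub_smul]; abel
  dsimp only
  rw [e]
  refine Ip_add hp ?_
  have := cχ k; have := cg k
  exact Measurable.aestronglyMeasurable (by fun_prop)

theorem IsMnz.grad_level {p : ℝ} (hp : 1 < p) {Ω : Set E} {L : ℝ≥0∞} (hL : IsL p Ω L)
    {u : E → ℝ} {U : E → E} (hu : IsMnz p Ω L u U) {κ : ℝ} (hκ : 0 < κ) :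
    ∀ᵐ x, u x = κ → U x = 0 := by
  have hp0 : 0 < p := by linarith
  have mu := hu.mu
  have mU := hu.mU
  obtain ⟨φ, hφ, f1, f2, f3, f4⟩ := hu.ex
  have mS : MeasurableSet {x | u x = κ} := mu (measurableSet_singleton κ)
  have mφ : ∀ k, Measurable (φ k) := fun k => (hφ k).cd.continuous.measurable
  have mhK : ∀ ε, Measurable (hK ε κ) := fun ε => (hK_cd ε κ).continuous.measurable
  have step : ∀ ε > 0, L * Ip p (fun x => hK ε κ (u x)) ≤ ∫⁻ x in {x | u x = κ}ᶜ, ‖U x‖ₑ ^ p := by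
    intro ε hε
    have t1 := trunc_tendsto hp (hKd_cont ε κ) (hKd_abs hε κ) mu mU hu.fU mφ
      (fun k => (grad_cont (hφ k).cd).measurable) f2 f3
    have e1 : ∀ k, Ip p (gradient fun x => hK ε κ (φ k x)) =
        Ip p (fun x => hKd ε κ (φ k x) • gradient (φ k) x) := by
      intro k
      congr 1
      funext x
      exact grad_comp (hK_deriv ε κ _) ((hφ k).cd.differentiable (by norm_num) x)
    have h1 : Ip p (fun x => hK ε κ (u x)) ≤ liminf (fun k => Ip p fun x => hK ε κ (φ k x)) atTop := by
      calc _ ≤ ∫⁻ x, liminf (fun k => ‖hK ε κ (φ k x)‖ₑ ^ p) atTop := by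
            refine lintegral_mono_ae ?_
            filter_upwards [f3] with x hx
            exact ((((hK_cd ε κ).continuous.tendsto _).comp hx).enorm.ennrpow_const p).liminf_eq.ge
        _ ≤ _ := lintegral_liminf_le fun k => ((mhK ε).comp (mφ k)).enorm.pow_const p
    have h2 : L * Ip p (fun x => hK ε κ (u x)) ≤ Ip p fun x => hKd ε κ (u x) • U x := by
      rw [← t1.liminf_eq]
      have h3 : L * Ip p (fun x => hK ε κ (u x)) ≤
          liminf (fun k => L * Ip p fun x => hK ε κ (φ k x)) atTop := by
        refine (mul_le_mul_right h1 _).trans ?_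
        rw [ENNReal.liminf_const_mul_of_ne_top hL.ne_top]
      refine h3.trans (liminf_le_liminf (Eventually.of_forall fun k => ?_))
      rw [← e1]
      exact hL.poinc _ (C1c_hK (hφ k) hε hκ)
    refine h2.trans ?_
    rw [← lintegral_indicator mS.compl]
    refine lintegral_mono fun x => ?_
    dsimp only
    by_cases hx : u x = κ
    · rw [hx, hKd_kappa hε, zero_smul, enorm_zero, ENNReal.zero_rpow_of_pos hp0]; exact zero_le
    · rw [indicator_of_mem (by simpa using hx)]
      refine ENNReal.rpow_le_rpow ?_ hp0.le
      rw [enorm_le_iff_norm_le, norm_smul]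
      exact mul_le_of_le_one_left (norm_nonneg _) (hKd_abs hε _ _)
  let t : ℕ → ℝ := fun k => 1 / ((k : ℝ) + 1)
  have ht : ∀ k, 0 < t k := fun k => by positivity
  have htt : Tendsto t atTop (𝓝 0) := tendsto_one_div_add_atTop_nhds_zero_nat
  have lim : ∀ s, Tendsto (fun k => hK (t k) κ s) atTop (𝓝 s) := by
    intro s
    rw [tendsto_iff_norm_sub_tendsto_zero]
    have := htt.const_mul 2
    rw [mul_zero] at this
    exact squeeze_zero (fun _ => norm_nonneg _) (fun k => hK_near (ht k) hκ) this
  have main : L ≤ ∫⁻ x in {x | u x = κ}ᶜ, ‖U x‖ₑ ^ p := by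
    have h1 : Ip p u ≤ liminf (fun k => Ip p fun x => hK (t k) κ (u x)) atTop := by
      calc _ ≤ ∫⁻ x, liminf (fun k => ‖hK (t k) κ (u x)‖ₑ ^ p) atTop := by
            refine lintegral_mono fun x => ?_
            exact ((lim (u x)).enorm.ennrpow_const p).liminf_eq.ge
        _ ≤ _ := lintegral_liminf_le fun k => ((mhK _).comp mu).enorm.pow_const p
    calc L = L * Ip p u := by rw [hu.one, mul_one]
      _ ≤ L * liminf (fun k => Ip p fun x => hK (t k) κ (u x)) atTop := mul_le_mul_right h1 _
      _ = liminf (fun k => L * Ip p fun x => hK (t k) κ (u x)) atTop := by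
          rw [ENNReal.liminf_const_mul_of_ne_top hL.ne_top]
      _ ≤ liminf (fun _ : ℕ => ∫⁻ x in {x | u x = κ}ᶜ, ‖U x‖ₑ ^ p) atTop :=
          liminf_le_liminf (Eventually.of_forall fun k => step _ (ht k))
      _ = _ := by simp
  have spl := lintegral_add_compl (μ := (volume : Measure E)) (fun x => ‖U x‖ₑ ^ p) mS
  have en := hu.en
  unfold Ip at en
  rw [en] at spl
  have z : ∫⁻ x in {x | u x = κ}, ‖U x‖ₑ ^ p = 0 := by
    by_contra hne
    have h1 : L < L + ∫⁻ x in {x | u x = κ}, ‖U x‖ₑ ^ p := ENNReal.lt_add_right hL.ne_top hne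
    have h2 : L + ∫⁻ x in {x | u x = κ}, ‖U x‖ₑ ^ p ≤ L := by
      rw [add_comm]
      calc _ ≤ _ := add_le_add_right main _
        _ = L := spl
    exact absurd h2 (not_le.2 h1)
  rw [lintegral_eq_zero_iff (by fun_prop), EventuallyEq, ae_restrict_iff' mS] at z
  filter_upwards [z] with x hx hxk
  have := hx hxk
  simp only [Pi.zero_apply] at this
  rwa [ENNReal.rpow_eq_zero_iff_of_pos hp0, enorm_eq_zero] at this

theorem dfc_plateau {p : ℝ} (hp : 1 < p) {κ b t : ℝ} (hκ : 0 < κ) (hb : 0 ≤ b) (hbt : b ≤ t) (B : E) :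
    (1 - (t ^ p / κ ^ p) ^ (p - 1)) * ‖B‖ ^ p ≤ dfc p κ b 0 B := by
  have hp0 : 0 < p := by linarith
  have hp1 : 0 < p - 1 := by linarith
  have ht : 0 ≤ t := hb.trans hbt
  have hk : 0 < κ ^ p := by positivity
  have hbp : 0 ≤ b ^ p := by positivity
  have hne : κ ^ p + b ^ p ≠ 0 := by positivity
  unfold dfc
  rw [if_neg hne]
  unfold dfe
  rw [smul_zero, zero_add, norm_zero, Real.zero_rpow hp0.ne', zero_add, add_zero, norm_smul,
    Real.mul_rpow (norm_nonneg _) (norm_nonneg _), Real.norm_of_nonneg (by positivity),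
    ← Real.rpow_mul hb, mul_comm (p - 1) p, Real.rpow_mul hb, sub_mul, one_mul, mul_div_right_comm,
    ← Real.div_rpow hbp (by positivity)]
  refine sub_le_sub_left (mul_le_mul_of_nonneg_right ?_ (by positivity)) _
  refine Real.rpow_le_rpow (by positivity) ?_ hp1.le
  gcongr
  linarith

theorem IsMnz.no_plateau {p : ℝ} (hp : 1 < p) {Ω : Set E} {L : ℝ≥0∞} (hL : IsL p Ω L)
    (hLpos : 0 < L)
    {u : E → ℝ} {U : E → E} (hu : IsMnz p Ω L u U) {κ : ℝ} (hκ : 0 < κ) {V : Set E} (hV : IsOpen V)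
    (hVΩ : V ⊆ Ω) (hne : V.Nonempty) (h : ∀ᵐ x, x ∈ V → u x = κ) : False := by
  have hp0 : 0 < p := by linarith
  have hp1 : 0 < p - 1 := by linarith
  obtain ⟨x0, hx0⟩ := hne
  obtain ⟨η, hη, hηV, φ, hφ, hφ1, hφle⟩ := exists_bump hV hx0
  have hφΩ : C1c Ω φ := ⟨hφ.cd, hφ.cs, hφ.ts.trans hVΩ, hφ.nn⟩
  have hg := hu.grad_level hp hL hκ
  let t : ℕ → ℝ := fun k => κ * (1 / ((k : ℝ) + 1))
  have ht : ∀ k, 0 < t k := fun k => by positivity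
  have htκ : ∀ k, t k ≤ κ := fun k => by
    refine mul_le_of_le_one_right hκ.le ?_
    rw [div_le_one (by positivity)]
    have : (0:ℝ) ≤ k := by positivity
    linarith
  have htt : Tendsto t atTop (𝓝 0) := by
    have := (tendsto_one_div_add_atTop_nhds_zero_nat (𝕜 := ℝ)).const_mul κ
    rwa [mul_zero] at this
  let q : ℕ → ℝ := fun k => (t k ^ p / κ ^ p) ^ (p - 1)
  have hq0 : ∀ k, 0 ≤ q k := fun k => by have := ht k; positivity
  have hq1 : ∀ k, q k ≤ 1 := fun k => by
    have := ht k
    refine Real.rpow_le_one (by positivity) ?_ hp1.le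
    rw [div_le_one (by positivity)]
    exact Real.rpow_le_rpow this.le (htκ k) hp0.le
  have hqt : Tendsto q atTop (𝓝 0) := by
    have h1 : Tendsto (fun k => (t k ^ p / κ ^ p) ^ (p - 1)) atTop
        (𝓝 (((0:ℝ) ^ p / κ ^ p) ^ (p - 1))) :=
      ((htt.rpow_const (Or.inr hp0.le)).div_const _).rpow_const (Or.inr hp1.le)
    rwa [Real.zero_rpow hp0.ne', zero_div, Real.zero_rpow hp1.ne'] at h1
  have fin : Ip p (gradient φ) ≠ ⊤ := Ip_ne_top hp (grad_cont hφ.cd) (grad_hasCS hφ.cs)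
  have key : ∀ k, L * Ip p φ ≤ ENNReal.ofReal (q k) * Ip p (gradient φ) := by
    intro k
    have hv := hφΩ.smul (ht k).le
    have hm := dfc_min hp hL hu (hv.lpair hp)
    have eg : gradient (fun x => t k * φ x) = fun x => t k • gradient φ x := grad_smul hφ.cd (t k)
    have ft : Ip p (fun x => t k • gradient φ x) ≠ ⊤ := by
      rw [Ip_smul hp]
      exact ENNReal.mul_ne_top (ENNReal.rpow_ne_top_of_nonneg hp0.le enorm_ne_top) fin
    have lower : ENNReal.ofReal (1 - q k) * Ip p (fun x => t k • gradient φ x) ≤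
        ∫⁻ x, ENNReal.ofReal (dfc p (u x) (t k * φ x) (U x) (gradient (fun x => t k * φ x) x)) := by
      unfold Ip
      rw [← lintegral_const_mul' _ _ ENNReal.ofReal_ne_top]
      refine lintegral_mono_ae ?_
      filter_upwards [h, hg] with x h1 h2
      rw [eg]
      by_cases hx : x ∈ V
      · have h1 := h1 hx
        rw [h2 h1, h1, ← ofReal_norm, ENNReal.ofReal_rpow_of_nonneg (norm_nonneg _) hp0.le,
          ← ENNReal.ofReal_mul (by linarith [hq1 k])]
        refine ENNReal.ofReal_le_ofReal (dfc_plateau hp hκ (mul_nonneg (ht k).le (hφ.nn x)) ?_ _)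
        exact mul_le_of_le_one_right (ht k).le (hφle x)
      · have : x ∉ tsupport φ := fun h' => hx (hφ.ts h')
        simp only
        rw [grad_zero_of_notMem this, smul_zero, enorm_zero, ENNReal.zero_rpow_of_pos hp0, mul_zero]
        exact zero_le
    rw [eg] at hm lower
    have h3 := (add_le_add_left lower _).trans hm
    have e3 : Ip p (fun x => t k • gradient φ x) =
        ENNReal.ofReal (1 - q k) * Ip p (fun x => t k • gradient φ x) +
        ENNReal.ofReal (q k) * Ip p (fun x => t k • gradient φ x) := by
      rw [← add_mul, ← ENNReal.ofReal_add (by linarith [hq1 k]) (hq0 k)]; simp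
    nth_rewrite 2 [e3] at h3
    have h4 := (ENNReal.add_le_add_iff_left (ENNReal.mul_ne_top ENNReal.ofReal_ne_top ft)).1 h3
    have e4 : Ip p (fun x => t k * φ x) = ‖t k‖ₑ ^ p * Ip p φ := Ip_smul hp φ (t k)
    rw [e4, Ip_smul hp, mul_left_comm, mul_left_comm (ENNReal.ofReal (q k))] at h4
    refine (ENNReal.mul_le_mul_iff_right ?_ ?_).1 h4
    · have := (ht k).ne'
      simp [ENNReal.rpow_eq_zero_iff, this]
    · exact ENNReal.rpow_ne_top_of_nonneg hp0.le enorm_ne_top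
  have lim : Tendsto (fun k => ENNReal.ofReal (q k) * Ip p (gradient φ)) atTop (𝓝 0) := by
    have := ENNReal.Tendsto.mul_const (b := Ip p (gradient φ)) (ENNReal.tendsto_ofReal hqt)
      (Or.inr fin)
    simpa using this
  have h0 : L * Ip p φ = 0 := le_antisymm (ge_of_tendsto' lim key) zero_le
  rcases mul_eq_zero.1 h0 with h0 | h0
  · exact hLpos.ne' h0
  · rw [Ip_zero_iff hp hφ.cd.continuous] at h0
    have := hφ1 x0 (mem_ball_self (by positivity))
    rw [h0] at this
    simp at this

theorem annulus_preconnected (hr : 1 < Module.rank ℝ E) {z : E} {R₀ R₁ : ℝ} (h0 : 0 < R₀)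
    (hz : ‖z‖ + R₀ < R₁) : IsPreconnected (ball (0:E) R₁ \ closedBall z R₀) := by
  obtain ⟨ρ, hρ0, hρ1⟩ : ∃ ρ, R₀ < ρ ∧ ρ + ‖z‖ < R₁ :=
    ⟨(R₀ + (R₁ - ‖z‖)) / 2, by linarith, by linarith⟩
  have hρ : 0 < ρ := h0.trans hρ0
  have hS := isPreconnected_sphere hr z ρ
  have hSsub : sphere z ρ ⊆ ball (0:E) R₁ \ closedBall z R₀ := by
    intro x hx
    rw [mem_sphere, dist_eq_norm] at hx
    refine ⟨?_, ?_⟩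
    · rw [mem_ball_zero_iff]
      calc ‖x‖ = ‖(x - z) + z‖ := by rw [sub_add_cancel]
        _ ≤ ‖x - z‖ + ‖z‖ := norm_add_le _ _
        _ < R₁ := by linarith
    · rw [mem_closedBall, dist_eq_norm]; linarith
  have hproj : ∀ x ∈ ball (0:E) R₁ \ closedBall z R₀,
      ∃ y ∈ sphere z ρ, segment ℝ x y ⊆ ball (0:E) R₁ \ closedBall z R₀ := by
    rintro x ⟨hx1, hx2⟩
    rw [mem_closedBall, dist_eq_norm, not_le] at hx2
    have hn : 0 < ‖x - z‖ := h0.trans hx2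
    let y : E := z + (ρ / ‖x - z‖) • (x - z)
    have hy : y ∈ sphere z ρ := by
      rw [mem_sphere, dist_eq_norm]
      simp only [y, add_sub_cancel_left, norm_smul, norm_div, norm_norm, Real.norm_of_nonneg hρ.le]
      field_simp
    refine ⟨y, hy, fun w hw => ⟨(convex_ball 0 R₁).segment_subset hx1 (hSsub hy).1 hw, ?_⟩⟩
    obtain ⟨a, b, ha, hb, hab, rfl⟩ := hw
    rw [mem_closedBall, dist_eq_norm, not_le]
    have e : a • x + b • y - z = (a + b * (ρ / ‖x - z‖)) • (x - z) := by
      have hb' : b = 1 - a := by linarith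
      subst hb'
      simp only [y]
      module
    rw [e, norm_smul, Real.norm_of_nonneg (by positivity), add_mul, mul_assoc, div_mul_cancel₀ _ hn.ne']
    rcases eq_or_lt_of_le ha with h | h
    · rw [← h, zero_add] at hab; rw [← h, hab]; linarith
    · have : a * R₀ < a * ‖x - z‖ := mul_lt_mul_of_pos_left hx2 h
      have : b * R₀ ≤ b * ρ := mul_le_mul_of_nonneg_left hρ0.le hb
      nlinarith
  rcases (sphere z ρ).eq_empty_or_nonempty with he | ⟨x0, hx0⟩
  · intro A B _ _ _ hA
    obtain ⟨x, hx, -⟩ := hA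
    obtain ⟨y, hy, -⟩ := hproj x hx
    rw [he] at hy; exact absurd hy (by simp)
  · refine isPreconnected_of_forall x0 fun x hx => ?_
    obtain ⟨y, hy, hseg⟩ := hproj x hx
    refine ⟨sphere z ρ ∪ segment ℝ x y, union_subset hSsub hseg, Or.inl hx0,
      Or.inr (left_mem_segment ℝ x y), ?_⟩
    exact IsPreconnected.union y hy (right_mem_segment ℝ x y) hS (convex_segment x y).isPreconnected

end PartK

section PartL
variable {E : Type*} [NormedAddCommGroup E] [InnerProductSpace ℝ E] [FiniteDimensional ℝ E]
  [MeasurableSpace E] [BorelSpace E]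

/-- reflection exchanging `y` and `z`. -/
noncomputable def rfx (y z : E) (x : E) : E :=
  (ℝ ∙ (z - y))ᗮ.reflection x + ((‖z‖ ^ 2 - ‖y‖ ^ 2) / ‖z - y‖ ^ 2) • (z - y)

theorem rfx_apply (y z x : E) :
    rfx y z x = x - ((‖x - y‖ ^ 2 - ‖x - z‖ ^ 2) / ‖z - y‖ ^ 2) • (z - y) := by
  unfold rfx
  rw [Submodule.reflection_orthogonal_apply, Submodule.reflection_singleton_apply]
  have : ‖x - y‖ ^ 2 - ‖x - z‖ ^ 2 = 2 * ⟪z - y, x⟫ - (‖z‖ ^ 2 - ‖y‖ ^ 2) := by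
    rw [norm_sub_sq_real, norm_sub_sq_real, inner_sub_left, real_inner_comm y x, real_inner_comm z x]
    ring
  rw [this]
  simp only [RCLike.ofReal_real_eq_id, id]
  module

theorem rfx_sub_y {y z : E} (hne : y ≠ z) (x : E) : ‖rfx y z x - y‖ = ‖x - z‖ := by
  have hn : ‖z - y‖ ^ 2 ≠ 0 := by
    have := sub_ne_zero.2 hne.symm
    positivity
  have h : ‖rfx y z x - y‖ ^ 2 = ‖x - z‖ ^ 2 := by
    have e1 : rfx y z x - y = (x - y) - ((‖x - y‖ ^ 2 - ‖x - z‖ ^ 2) / ‖z - y‖ ^ 2) • (z - y) := by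
      rw [rfx_apply]; abel
    have e2 : ‖x - z‖ ^ 2 = ‖x - y‖ ^ 2 - 2 * ⟪x - y, z - y⟫ + ‖z - y‖ ^ 2 := by
      rw [← norm_sub_sq_real]; congr 2; abel
    rw [e1, norm_sub_sq_real, inner_smul_right, norm_smul, mul_pow, Real.norm_eq_abs, sq_abs, e2]
    have hn0 : ‖z - y‖ ≠ 0 := fun h => hn (by rw [h]; norm_num)
    field_simp
    ring
  exact (sq_eq_sq₀ (norm_nonneg _) (norm_nonneg _)).1 h

theorem rfx_symm (y z x : E) : rfx y z x = rfx z y x := by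
  rw [rfx_apply, rfx_apply, norm_sub_rev z y]
  module

theorem rfx_sub_z {y z : E} (hne : y ≠ z) (x : E) : ‖rfx y z x - z‖ = ‖x - y‖ := by
  rw [rfx_symm]; exact rfx_sub_y hne.symm x

theorem rfx_rfx {y z : E} (hne : y ≠ z) (x : E) : rfx y z (rfx y z x) = x := by
  rw [rfx_apply y z (rfx y z x), rfx_sub_y hne, rfx_sub_z hne, rfx_apply]
  module

theorem rfx_norm {y z : E} (hne : y ≠ z) (x : E) :
    ‖rfx y z x‖ ^ 2 = ‖x‖ ^ 2 + (‖x - z‖ ^ 2 - ‖x - y‖ ^ 2) * (‖z‖ ^ 2 - ‖y‖ ^ 2) / ‖z - y‖ ^ 2 := by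
  have hn : ‖z - y‖ ^ 2 ≠ 0 := by
    have := sub_ne_zero.2 hne.symm
    positivity
  rw [rfx_apply, norm_sub_sq_real, inner_smul_right, norm_smul, mul_pow, Real.norm_eq_abs, sq_abs]
  have : ‖x - y‖ ^ 2 - ‖x - z‖ ^ 2 = 2 * ⟪x, z - y⟫ - (‖z‖ ^ 2 - ‖y‖ ^ 2) := by
    rw [norm_sub_sq_real, norm_sub_sq_real, inner_sub_right]
    ring
  rw [this, show ‖x - z‖ ^ 2 - ‖x - y‖ ^ 2 = -(2 * ⟪x, z - y⟫ - (‖z‖ ^ 2 - ‖y‖ ^ 2)) by rw [← this]; ring]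
  field_simp
  ring

theorem rfx_mp (y z : E) : MeasurePreserving (rfx y z) volume volume := by
  have h1 := ((ℝ ∙ (z - y))ᗮ.reflection).measurePreserving
  have h2 := measurePreserving_add_right (volume : Measure E)
    (((‖z‖ ^ 2 - ‖y‖ ^ 2) / ‖z - y‖ ^ 2) • (z - y))
  exact h2.comp h1

theorem rfx_cd (y z : E) : ContDiff ℝ 1 (rfx y z) := by
  unfold rfx
  exact (LinearIsometryEquiv.contDiff _).add contDiff_const

theorem rfx_fix {y z x : E} (h : ‖x - y‖ = ‖x - z‖) : rfx y z x = x := by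
  rw [rfx_apply, h]; simp

theorem rfx_grad {u : E → ℝ} (hu : ContDiff ℝ 1 u) (y z x : E) :
    HasGradientAt (fun x => u (rfx y z x))
      ((ℝ ∙ (z - y))ᗮ.reflection (gradient u (rfx y z x))) x := by
  have h1 : HasFDerivAt (rfx y z)
      ((ℝ ∙ (z - y))ᗮ.reflection.toContinuousLinearEquiv : E →L[ℝ] E) x := by
    have := ((ℝ ∙ (z - y))ᗮ.reflection.toContinuousLinearEquiv.hasFDerivAt (x := x)).add_const
      (((‖z‖ ^ 2 - ‖y‖ ^ 2) / ‖z - y‖ ^ 2) • (z - y))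
    exact this
  have h2 := ((hu.differentiable (by norm_num) (rfx y z x)).hasGradientAt.hasFDerivAt).comp x h1
  rw [hasGradientAt_iff_hasFDerivAt]
  convert! h2 using 1
  ext v
  simp only [InnerProductSpace.toDual_apply_apply, ContinuousLinearMap.comp_apply,
    ContinuousLinearEquiv.coe_coe, LinearIsometryEquiv.coe_toContinuousLinearEquiv]
  nth_rewrite 1 [← Submodule.reflection_reflection (ℝ ∙ (z - y))ᗮ v]
  exact LinearIsometryEquiv.inner_map_map _ _ _

/-- sign of the half space. -/
noncomputable def sgx (y z x : E) : ℝ := ((SignType.sign (‖x - z‖ - ‖x - y‖) : SignType) : ℝ)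

/-- smoothed polarization. -/
noncomputable def plF (ε : ℝ) (y z : E) (u : E → ℝ) (x : E) : ℝ :=
  (u x + u (rfx y z x)) / 2 + sgx y z x * gF ε ((u x - u (rfx y z x)) / 2)

theorem sgx_pos {y z x : E} (h : ‖x - y‖ < ‖x - z‖) : sgx y z x = 1 := by
  unfold sgx; rw [sign_pos (by linarith)]; simp
theorem sgx_neg {y z x : E} (h : ‖x - z‖ < ‖x - y‖) : sgx y z x = -1 := by
  unfold sgx; rw [sign_neg (by linarith)]; simp
theorem sgx_zero {y z x : E} (h : ‖x - y‖ = ‖x - z‖) : sgx y z x = 0 := by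
  unfold sgx; rw [h, sub_self, sign_zero]; simp
theorem sgx_abs (y z x : E) : |sgx y z x| ≤ 1 := by
  rcases lt_trichotomy ‖x - y‖ ‖x - z‖ with h | h | h
  · rw [sgx_pos h]; simp
  · rw [sgx_zero h]; simp
  · rw [sgx_neg h]; simp
theorem sgx_rfx {y z : E} (hne : y ≠ z) (x : E) : sgx y z (rfx y z x) = - sgx y z x := by
  unfold sgx
  rw [rfx_sub_y hne, rfx_sub_z hne, ← neg_sub, Left.sign_neg]; simp

theorem plF_local {u : E → ℝ} (hu : Continuous u) {ε : ℝ} (hε : 0 < ε) (y z x : E) :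
    plF ε y z u =ᶠ[𝓝 x] fun x' => (u x' + u (rfx y z x')) / 2 +
      sgx y z x * gF ε ((u x' - u (rfx y z x')) / 2) := by
  have cr := (rfx_cd y z).continuous
  rcases lt_trichotomy ‖x - y‖ ‖x - z‖ with h | h | h
  · have : ∀ᶠ x' in 𝓝 x, ‖x' - y‖ < ‖x' - z‖ :=
      (isOpen_lt (by fun_prop) (by fun_prop)).mem_nhds h
    filter_upwards [this] with x' hx'
    unfold plF; rw [sgx_pos h, sgx_pos hx']
  · have : ∀ᶠ x' in 𝓝 x, |(u x' - u (rfx y z x')) / 2| < ε := by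
      refine (isOpen_lt (by fun_prop) continuous_const).mem_nhds ?_
      simp [rfx_fix h, hε]
    filter_upwards [this] with x' hx'
    unfold plF; rw [gF_zero hε hx'.le, mul_zero, mul_zero]
  · have : ∀ᶠ x' in 𝓝 x, ‖x' - z‖ < ‖x' - y‖ :=
      (isOpen_lt (by fun_prop) (by fun_prop)).mem_nhds h
    filter_upwards [this] with x' hx'
    unfold plF; rw [sgx_neg h, sgx_neg hx']

theorem plF_cd {u : E → ℝ} (hu : ContDiff ℝ 1 u) {ε : ℝ} (hε : 0 < ε) (y z : E) :
    ContDiff ℝ 1 (plF ε y z u) := by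
  rw [contDiff_iff_contDiffAt]
  intro x
  refine ContDiffAt.congr_of_eventuallyEq ?_ (plF_local hu.continuous hε y z x)
  have h1 : ContDiff ℝ 1 (fun x => u (rfx y z x)) := hu.comp (rfx_cd y z)
  have h2 : ContDiff ℝ 1 (fun x => gF ε ((u x - u (rfx y z x)) / 2)) :=
    (gF_cd ε).comp ((hu.sub h1).div_const 2)
  exact (((hu.add h1).div_const 2).add (contDiff_const.mul h2)).contDiffAt

theorem plF_grad {u : E → ℝ} (hu : ContDiff ℝ 1 u) {ε : ℝ} (hε : 0 < ε) (y z x : E) :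
    gradient (plF ε y z u) x =
      ((1 + sgx y z x * gD ε ((u x - u (rfx y z x)) / 2)) / 2) • gradient u x +
      ((1 - sgx y z x * gD ε ((u x - u (rfx y z x)) / 2)) / 2) •
        ((ℝ ∙ (z - y))ᗮ.reflection (gradient u (rfx y z x))) := by
  have h1 := (rfx_grad hu y z x).hasFDerivAt
  have h2 := (hu.differentiable (by norm_num) x).hasGradientAt.hasFDerivAt
  have h3 : HasFDerivAt (fun x' => (u x' - u (rfx y z x')) / 2) _ x :=
    (h2.sub h1).mul_const (2:ℝ)⁻¹
  have h4 := (gF_deriv ε ((u x - u (rfx y z x)) / 2)).comp_hasFDerivAt x h3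
  have h5 : HasFDerivAt (fun x' => (u x' + u (rfx y z x')) / 2) _ x :=
    (h2.add h1).mul_const (2:ℝ)⁻¹
  have h6 := (h5.add (h4.const_mul (sgx y z x))).congr_of_eventuallyEq
    (plF_local hu.continuous hε y z x)
  have h7 : HasGradientAt (plF ε y z u) _ x := h6.hasGradientAt
  rw [h7.gradient]
  simp only [map_add, map_smul, map_sub, LinearIsometryEquiv.symm_apply_apply]
  module

theorem pair_ineq {p : ℝ} (hp : 1 < p) (a b : E) {θ : ℝ} (hθ : |θ| ≤ 1) :
    ‖((1 + θ) / 2) • a + ((1 - θ) / 2) • b‖ ^ p + ‖((1 - θ) / 2) • a + ((1 + θ) / 2) • b‖ ^ p ≤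
      ‖a‖ ^ p + ‖b‖ ^ p := by
  have hc := (strictConvex_norm_rpow (E := E) hp).convexOn
  have h := abs_le.1 hθ
  have h1 := hc.2 (mem_univ a) (mem_univ b) (show 0 ≤ (1 + θ) / 2 by linarith)
    (show 0 ≤ (1 - θ) / 2 by linarith) (by ring)
  have h2 := hc.2 (mem_univ a) (mem_univ b) (show 0 ≤ (1 - θ) / 2 by linarith)
    (show 0 ≤ (1 + θ) / 2 by linarith) (by ring)
  simp only [smul_eq_mul] at h1 h2
  linarith

theorem plF_energy {p : ℝ} (hp : 1 < p) {u : E → ℝ} (hu : ContDiff ℝ 1 u) {ε : ℝ} (hε : 0 < ε)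
    {y z : E} (hne : y ≠ z) : Ip p (gradient (plF ε y z u)) ≤ Ip p (gradient u) := by
  have hp0 : 0 < p := by linarith
  have hσ := rfx_mp y z
  have m1 : ∀ {v : E → ℝ}, ContDiff ℝ 1 v → Measurable fun x => ‖gradient v x‖ₑ ^ p := fun hv =>
    (grad_cont hv).measurable.enorm.pow_const p
  have dbl : ∀ {v : E → ℝ}, ContDiff ℝ 1 v →
      ∫⁻ x, (‖gradient v x‖ₑ ^ p + ‖gradient v (rfx y z x)‖ₑ ^ p) = 2 * Ip p (gradient v) := by
    intro v hv
    rw [lintegral_add_left (m1 hv), hσ.lintegral_comp (m1 hv), two_mul]; rfl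
  have pt : ∀ x, ‖gradient (plF ε y z u) x‖ₑ ^ p + ‖gradient (plF ε y z u) (rfx y z x)‖ₑ ^ p ≤
      ‖gradient u x‖ₑ ^ p + ‖gradient u (rfx y z x)‖ₑ ^ p := by
    intro x
    have e : ∀ v : E, ‖v‖ₑ ^ p = ENNReal.ofReal (‖v‖ ^ p) := fun v => by
      rw [← ofReal_norm, ENNReal.ofReal_rpow_of_nonneg (norm_nonneg _) hp0.le]
    rw [e, e, e, e, ← ENNReal.ofReal_add (by positivity) (by positivity),
      ← ENNReal.ofReal_add (by positivity) (by positivity)]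
    refine ENNReal.ofReal_le_ofReal ?_
    rw [plF_grad hu hε y z x, plF_grad hu hε y z (rfx y z x), rfx_rfx hne, sgx_rfx hne]
    set T := (ℝ ∙ (z - y))ᗮ.reflection with hT
    have hTT : ∀ v, T (T v) = v := fun v => Submodule.reflection_reflection _ v
    have e2 : (u (rfx y z x) - u x) / 2 = -((u x - u (rfx y z x)) / 2) := by ring
    rw [e2, gD_odd, neg_mul_neg]
    set θ := sgx y z x * gD ε ((u x - u (rfx y z x)) / 2) with hθ
    have hθ1 : |θ| ≤ 1 := by
      rw [hθ, abs_mul]; exact mul_le_one₀ (sgx_abs y z x) (abs_nonneg _) (gD_abs hε _)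
    have e3 : ‖((1 + θ) / 2) • gradient u (rfx y z x) + ((1 - θ) / 2) • T (gradient u x)‖ =
        ‖((1 - θ) / 2) • gradient u x + ((1 + θ) / 2) • T (gradient u (rfx y z x))‖ := by
      rw [← T.norm_map, map_add, map_smul, map_smul, hTT, add_comm]
    rw [e3, ← T.norm_map (gradient u (rfx y z x))]
    exact pair_ineq hp _ _ hθ1
  have h := lintegral_mono (μ := (volume : Measure E)) pt
  rw [dbl (plF_cd hu hε y z), dbl hu] at h
  exact (ENNReal.mul_le_mul_iff_right (by simp) (by simp)).1 h

/-- polarization. -/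
noncomputable def pol (y z : E) (u : E → ℝ) (x : E) : ℝ :=
  if ‖x - y‖ < ‖x - z‖ then max (u x) (u (rfx y z x)) else min (u x) (u (rfx y z x))

theorem pol_meas {u : E → ℝ} (hu : Measurable u) (y z : E) : Measurable (pol y z u) := by
  have := (rfx_cd y z).continuous.measurable
  unfold pol
  refine Measurable.ite ?_ (by fun_prop) (by fun_prop)
  exact measurableSet_lt (by fun_prop) (by fun_prop)

theorem pol_nonneg {u : E → ℝ} (hu : ∀ x, 0 ≤ u x) (y z x : E) : 0 ≤ pol y z u x := by
  unfold pol
  have h1 := hu x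
  have h2 := hu (rfx y z x)
  split_ifs
  · exact le_max_of_le_left h1
  · exact le_min h1 h2

theorem max_eq_half (a b : ℝ) : max a b = (a + b) / 2 + |(a - b) / 2| := by
  rcases le_total a b with h | h
  · rw [max_eq_right h, abs_of_nonpos (by linarith)]; ring
  · rw [max_eq_left h, abs_of_nonneg (by linarith)]; ring
theorem min_eq_half (a b : ℝ) : min a b = (a + b) / 2 - |(a - b) / 2| := by
  rcases le_total a b with h | h
  · rw [min_eq_left h, abs_of_nonpos (by linarith)]; ring
  · rw [min_eq_right h, abs_of_nonneg (by linarith)]; ring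

theorem plF_near {u : E → ℝ} {ε : ℝ} (hε : 0 < ε) (y z x : E) :
    |plF ε y z u x - pol y z u x| ≤ 2 * ε := by
  have a1 := gF_le hε ((u x - u (rfx y z x)) / 2)
  have a2 := gF_ge hε ((u x - u (rfx y z x)) / 2)
  unfold plF pol
  rcases lt_trichotomy ‖x - y‖ ‖x - z‖ with h | h | h
  · rw [sgx_pos h, if_pos h, max_eq_half, abs_le]
    constructor <;> linarith
  · rw [sgx_zero h, if_neg (by linarith), rfx_fix h, min_self, abs_le]
    constructor <;> linarith
  · rw [sgx_neg h, if_neg (by linarith), min_eq_half, abs_le]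
    constructor <;> linarith

end PartL

section PartM
variable {E : Type*} [NormedAddCommGroup E] [InnerProductSpace ℝ E] [FiniteDimensional ℝ E]
  [MeasurableSpace E] [BorelSpace E]

/-- eccentric annulus. -/
def An (R₀ R₁ : ℝ) (z : E) : Set E := ball (0:E) R₁ \ closedBall z R₀

theorem mem_An {R₀ R₁ : ℝ} {z x : E} : x ∈ An R₀ R₁ z ↔ ‖x‖ < R₁ ∧ R₀ < ‖x - z‖ := by
  unfold An
  rw [Set.mem_sdiff, mem_ball_zero_iff, mem_closedBall, dist_eq_norm, not_le]

theorem An_open (R₀ R₁ : ℝ) (z : E) : IsOpen (An R₀ R₁ z) :=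
  isOpen_ball.sdiff isClosed_closedBall

theorem rfx_norm_le {y z x : E} (hne : y ≠ z) (hyz : ‖y‖ ≤ ‖z‖) (h : ‖x - y‖ ≤ ‖x - z‖) :
    ‖x‖ ≤ ‖rfx y z x‖ := by
  have h1 := rfx_norm hne x
  have h2 : 0 ≤ (‖x - z‖ ^ 2 - ‖x - y‖ ^ 2) * (‖z‖ ^ 2 - ‖y‖ ^ 2) / ‖z - y‖ ^ 2 := by
    have a1 : 0 ≤ ‖x - z‖ ^ 2 - ‖x - y‖ ^ 2 := sub_nonneg.2 (by gcongr)
    have a2 : 0 ≤ ‖z‖ ^ 2 - ‖y‖ ^ 2 := sub_nonneg.2 (by gcongr)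
    positivity
  exact (sq_le_sq₀ (norm_nonneg _) (norm_nonneg _)).1 (by linarith)

theorem pol_supp {R₀ R₁ : ℝ} {y z : E} (hne : y ≠ z) (hyz : ‖y‖ ≤ ‖z‖) {u : E → ℝ}
    (nn : ∀ x, 0 ≤ u x) (hz : ∀ x ∉ An R₀ R₁ y, u x = 0) {x : E} (hx : 0 < pol y z u x) :
    x ∈ An R₀ R₁ z := by
  have hpos : ∀ {w : E}, 0 < u w → ‖w‖ < R₁ ∧ R₀ < ‖w - y‖ := fun {w} hw => by
    rw [← mem_An]; by_contra h; rw [hz w h] at hw; exact lt_irrefl _ hw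
  unfold pol at hx
  rw [mem_An]
  split_ifs at hx with h
  · rcases lt_max_iff.1 hx with h1 | h1
    · obtain ⟨a, b⟩ := hpos h1
      exact ⟨a, b.trans h⟩
    · obtain ⟨a, b⟩ := hpos h1
      rw [rfx_sub_y hne] at b
      exact ⟨(rfx_norm_le hne hyz h.le).trans_lt a, b⟩
  · obtain ⟨h1, h2⟩ := lt_min_iff.1 hx
    obtain ⟨a, -⟩ := hpos h1
    obtain ⟨-, b⟩ := hpos h2
    rw [rfx_sub_y hne] at b
    exact ⟨a, b⟩

theorem pol_Ip {p : ℝ} (hp : 1 < p) {u : E → ℝ} (hu : Measurable u) {y z : E} (hne : y ≠ z) :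
    Ip p (pol y z u) = Ip p u := by
  have hσ := rfx_mp y z
  have m1 : ∀ {v : E → ℝ}, Measurable v → Measurable fun x => ‖v x‖ₑ ^ p := fun hv =>
    hv.enorm.pow_const p
  have dbl : ∀ {v : E → ℝ}, Measurable v →
      ∫⁻ x, (‖v x‖ₑ ^ p + ‖v (rfx y z x)‖ₑ ^ p) = 2 * Ip p v := by
    intro v hv
    rw [lintegral_add_left (m1 hv), hσ.lintegral_comp (m1 hv), two_mul]; rfl
  have h : ∀ x, ‖pol y z u x‖ₑ ^ p + ‖pol y z u (rfx y z x)‖ₑ ^ p =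
      ‖u x‖ₑ ^ p + ‖u (rfx y z x)‖ₑ ^ p := by
    intro x
    unfold pol
    rw [rfx_sub_y hne, rfx_sub_z hne, rfx_rfx hne]
    rcases lt_trichotomy ‖x - y‖ ‖x - z‖ with h | h | h
    · rw [if_pos h, if_neg (by linarith)]
      rcases le_total (u x) (u (rfx y z x)) with h' | h'
      · rw [max_eq_right h', min_eq_right h', add_comm]
      · rw [max_eq_left h', min_eq_left h']
    · rw [rfx_fix h, if_neg (by linarith), if_neg (by linarith), min_self]
    · rw [if_neg (by linarith), if_pos h]
      rcases le_total (u x) (u (rfx y z x)) with h' | h'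
      · rw [min_eq_left h', max_eq_left h']
      · rw [min_eq_right h', max_eq_right h', add_comm]
  have h2 := lintegral_congr (μ := (volume : Measure E)) h
  rw [dbl (pol_meas hu y z), dbl hu] at h2
  exact (ENNReal.mul_right_inj (by simp) (by simp)).1 h2

theorem pol_dist {p : ℝ} (hp : 1 < p) {u v : E → ℝ} (hu : Measurable u) (hv : Measurable v) {y z : E}
    (hne : y ≠ z) :
    Ip p (fun x => pol y z u x - pol y z v x) ≤ 2 * Ip p (fun x => u x - v x) := by
  have hp0 : 0 < p := by linarith
  have hσ := rfx_mp y z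
  have m1 : Measurable fun x => ‖u x - v x‖ₑ ^ p := by fun_prop
  have : ∫⁻ x, (‖u x - v x‖ₑ ^ p + ‖u (rfx y z x) - v (rfx y z x)‖ₑ ^ p) =
      2 * Ip p (fun x => u x - v x) := by
    rw [lintegral_add_left m1, hσ.lintegral_comp m1, two_mul]; rfl
  rw [← this]
  refine lintegral_mono fun x => ?_
  dsimp only
  have h : ‖pol y z u x - pol y z v x‖ ≤
      max ‖u x - v x‖ ‖u (rfx y z x) - v (rfx y z x)‖ := by
    unfold pol
    split_ifs
    · exact abs_max_sub_max_le_max _ _ _ _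
    · exact abs_min_sub_min_le_max _ _ _ _
  rcases le_max_iff.1 h with h | h
  · exact (ENNReal.rpow_le_rpow (enorm_le_iff_norm_le.2 h) hp0.le).trans le_self_add
  · exact (ENNReal.rpow_le_rpow (enorm_le_iff_norm_le.2 h) hp0.le).trans le_add_self

/-- smooth compactly supported approximation of the polarization. -/
noncomputable def plG (ε : ℝ) (y z : E) (u : E → ℝ) (x : E) : ℝ := hF ε (plF ε y z u x - 3 * ε)

theorem plF_nonneg {u : E → ℝ} (hu : ∀ x, 0 ≤ u x) {ε : ℝ} (hε : 0 < ε) (y z x : E) :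
    0 ≤ plF ε y z u x := by
  unfold plF
  have a1 := gF_le hε ((u x - u (rfx y z x)) / 2)
  have a0 := gF_nonneg hε ((u x - u (rfx y z x)) / 2)
  have a2 : |(u x - u (rfx y z x)) / 2| ≤ (u x + u (rfx y z x)) / 2 := by
    have := hu x
    have := hu (rfx y z x)
    rw [abs_le]; constructor <;> linarith
  have a3 := abs_le.1 (sgx_abs y z x)
  nlinarith

theorem plG_near {u : E → ℝ} (hu : ∀ x, 0 ≤ u x) {ε : ℝ} (hε : 0 < ε) (y z x : E) :
    |plG ε y z u x - pol y z u x| ≤ 6 * ε := by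
  unfold plG
  have h1 := abs_le.1 (plF_near (u := u) hε y z x)
  have h2 := plF_nonneg hu hε y z x
  have h3 := hF_ge hε (plF ε y z u x - 3 * ε)
  have h4 := hF_le hε (plF ε y z u x - 3 * ε)
  have h5 : max (plF ε y z u x - 3 * ε) 0 ≤ plF ε y z u x := max_le (by linarith) h2
  rw [abs_le]
  constructor <;> linarith

theorem plG_C1c {R₀ R₁ : ℝ} {y z : E} (hne : y ≠ z) (hyz : ‖y‖ ≤ ‖z‖) {u : E → ℝ}
    (hu : C1c (An R₀ R₁ y) u) {ε : ℝ} (hε : 0 < ε) : C1c (An R₀ R₁ z) (plG ε y z u) := by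
  have hc := plF_cd hu.cd hε y z
  have ts : tsupport (plG ε y z u) ⊆ An R₀ R₁ z := by
    have h1 : tsupport (plG ε y z u) ⊆ {x | 3 * ε ≤ plF ε y z u x} := by
      refine closure_minimal (fun x hx => ?_) (isClosed_le continuous_const hc.continuous)
      rw [mem_ofPred_eq]
      by_contra h
      refine hx ?_
      exact hF_zero hε (by linarith)
    refine h1.trans fun x hx => ?_
    refine pol_supp hne hyz hu.nn
      (fun w hw => image_eq_zero_of_notMem_tsupport fun h => hw (hu.ts h)) ?_
    have := abs_le.1 (plF_near (u := u) hε y z x)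
    rw [mem_ofPred_eq] at hx
    linarith
  refine ⟨(hF_cd ε).comp (hc.sub contDiff_const), ?_, ts, fun x => hF_nonneg hε _⟩
  refine HasCompactSupport.of_support_subset_isCompact (isCompact_closedBall (0:E) R₁) ?_
  intro x hx
  have := (mem_An.1 (ts (subset_tsupport _ hx))).1
  rw [mem_closedBall_zero_iff]; exact this.le

theorem plG_energy {p : ℝ} (hp : 1 < p) {u : E → ℝ} (hu : ContDiff ℝ 1 u) {ε : ℝ} (hε : 0 < ε)
    {y z : E} (hne : y ≠ z) : Ip p (gradient (plG ε y z u)) ≤ Ip p (gradient u) := by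
  refine le_trans ?_ (plF_energy hp hu hε hne)
  have hc := plF_cd hu hε y z
  refine lintegral_mono fun x => ENNReal.rpow_le_rpow ?_ (by linarith)
  have hd : HasDerivAt (fun s => hF ε (s - 3 * ε)) (thF ε (plF ε y z u x - 3 * ε)) (plF ε y z u x) := by
    have h1 : HasDerivAt (fun s : ℝ => s - 3 * ε) 1 (plF ε y z u x) :=
      (hasDerivAt_id _).sub_const _
    have := (hF_deriv ε (plF ε y z u x - 3 * ε)).comp (plF ε y z u x) h1
    rw [mul_one] at this
    exact this
  have e := grad_comp hd (hc.differentiable (by norm_num) x)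
  have e' : gradient (plG ε y z u) x = thF ε (plF ε y z u x - 3 * ε) • gradient (plF ε y z u) x := e
  rw [e', enorm_smul]
  refine mul_le_of_le_one_left zero_le ?_
  rw [← ofReal_norm, Real.norm_eq_abs, abs_of_nonneg (thF_nonneg _ _)]
  exact ENNReal.ofReal_le_one.2 (thF_le _ _)

theorem pol_min {p : ℝ} (hp : 1 < p) {R₀ R₁ : ℝ} {y z : E} (hne : y ≠ z) (hyz : ‖y‖ ≤ ‖z‖)
    {Ly Lz : ℝ≥0∞} (hLy : IsL p (An R₀ R₁ y) Ly) (hLz : IsL p (An R₀ R₁ z) Lz)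
    {u : E → ℝ} {U : E → E} (hu : IsMnz p (An R₀ R₁ y) Ly u U) :
    Lz ≤ Ly ∧ (Lz = Ly → ∃ W, IsMnz p (An R₀ R₁ z) Lz (pol y z u) W) := by
  have hp0 : 0 < p := by linarith
  obtain ⟨φ, hφ, f1, f2, -, -⟩ := hu.ex
  have mu := hu.mu
  have mφ : ∀ k, Measurable (φ k) := fun k => (hφ k).cd.continuous.measurable
  let t : ℕ → ℝ := fun k => 1 / ((k : ℝ) + 1)
  have ht : ∀ k, 0 < t k := fun k => by positivity
  have htt : Tendsto t atTop (𝓝 0) := tendsto_one_div_add_atTop_nhds_zero_nat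
  let ψ : ℕ → E → ℝ := fun k => plG (t k) y z (φ k)
  have hψ : ∀ k, C1c (An R₀ R₁ z) (ψ k) := fun k => plG_C1c hne hyz (hφ k) (ht k)
  have mψ : ∀ k, Measurable (ψ k) := fun k => (hψ k).cd.continuous.measurable
  have mpol := pol_meas mu y z
  have mpolφ : ∀ k, Measurable (pol y z (φ k)) := fun k => pol_meas (mφ k) y z
  have tE : Tendsto (fun k => Ip p (gradient (φ k))) atTop (𝓝 Ly) := by
    rw [← hu.en]
    exact Ip_tendsto hp (fun k => (grad_cont (hφ k).cd).aestronglyMeasurable)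
      hu.mU.aestronglyMeasurable hu.fU f2
  have hvol : volume (closedBall (0:E) R₁) ≠ ⊤ := (isCompact_closedBall _ _).measure_ne_top
  have b1 : ∀ k, Ip p (fun x => ψ k x - pol y z (φ k) x) ≤
      ENNReal.ofReal (6 * t k) ^ p * volume (closedBall (0:E) R₁) := by
    intro k
    calc Ip p (fun x => ψ k x - pol y z (φ k) x) ≤
        ∫⁻ x, (closedBall (0:E) R₁).indicator (fun _ => ENNReal.ofReal (6 * t k) ^ p) x := by
          refine lintegral_mono fun x => ?_
          by_cases hx : x ∈ closedBall (0:E) R₁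
          · rw [indicator_of_mem hx]
            refine ENNReal.rpow_le_rpow ?_ hp0.le
            dsimp only
            rw [← ofReal_norm]
            exact ENNReal.ofReal_le_ofReal (plG_near (hφ k).nn (ht k) y z x)
          · have hxA : x ∉ An R₀ R₁ z := fun h => hx (by
              rw [mem_closedBall_zero_iff]; exact (mem_An.1 h).1.le)
            have e1 : ψ k x = 0 := image_eq_zero_of_notMem_tsupport fun h => hxA ((hψ k).ts h)
            have e2 : pol y z (φ k) x = 0 := by
              refine le_antisymm (not_lt.1 fun h => hxA ?_) (pol_nonneg (hφ k).nn y z x)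
              exact pol_supp hne hyz (hφ k).nn
                (fun w hw => image_eq_zero_of_notMem_tsupport fun h => hw ((hφ k).ts h)) h
            dsimp only
            rw [e1, e2, sub_zero, enorm_zero, ENNReal.zero_rpow_of_pos hp0]
            exact zero_le
      _ = _ := by rw [lintegral_indicator_const isClosed_closedBall.measurableSet]
  have b2 : Tendsto (fun k => ENNReal.ofReal (6 * t k) ^ p * volume (closedBall (0:E) R₁)) atTop
      (𝓝 0) := by
    have h1 := (ENNReal.tendsto_ofReal (htt.const_mul 6)).ennrpow_const p
    have h2 := ENNReal.Tendsto.mul_const h1 (Or.inr hvol)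
    simpa [hp0] using h2
  have b3 : Tendsto (fun k => Ip p (fun x => ψ k x - pol y z u x)) atTop (𝓝 0) := by
    have h1 := ENNReal.Tendsto.const_mul (a := 2) f1 (Or.inr (by simp))
    rw [mul_zero] at h1
    have h2 := ENNReal.Tendsto.const_mul (a := 2 ^ (p - 1)) (b2.add h1) (Or.inr (by simp))
    rw [add_zero, mul_zero] at h2
    refine tendsto_of_tendsto_of_tendsto_of_le_of_le tendsto_const_nhds h2
      (fun _ => zero_le) fun k => ?_
    have e : (fun x => ψ k x - pol y z u x) = fun x =>
        (ψ k x - pol y z (φ k) x) + (pol y z (φ k) x - pol y z u x) := by funext x; ring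
    dsimp only
    rw [e]
    refine (Ip_add hp ?_).trans ?_
    · exact ((mψ k).sub (mpolφ k)).aestronglyMeasurable
    · refine mul_le_mul_right (add_le_add (b1 k) ?_) _
      exact pol_dist hp (mφ k) mu hne
  have one : Ip p (pol y z u) = 1 := by rw [pol_Ip hp mu hne, hu.one]
  have tI : Tendsto (fun k => Ip p (ψ k)) atTop (𝓝 1) := by
    rw [← one]
    exact Ip_tendsto hp (fun k => (mψ k).aestronglyMeasurable) mpol.aestronglyMeasurable
      (by rw [one]; simp) b3
  have tL : Tendsto (fun k => Lz * Ip p (ψ k)) atTop (𝓝 Lz) := by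
    have := ENNReal.Tendsto.const_mul tI (Or.inr hLz.ne_top)
    rwa [mul_one] at this
  have i1 : ∀ k, Lz * Ip p (ψ k) ≤ Ip p (gradient (ψ k)) := fun k => hLz.poinc _ (hψ k)
  have i2 : ∀ k, Ip p (gradient (ψ k)) ≤ Ip p (gradient (φ k)) := fun k =>
    plG_energy hp (hφ k).cd (ht k) hne
  refine ⟨le_of_tendsto_of_tendsto' tL tE fun k => (i1 k).trans (i2 k), fun hEq => ?_⟩
  refine min_of_seq hp hLz hψ mpol (pol_nonneg hu.nn y z) ?_ one b3 ?_
  · intro x hx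
    refine le_antisymm (not_lt.1 fun h => hx ?_) (pol_nonneg hu.nn y z x)
    exact pol_supp hne hyz hu.nn hu.z h
  · rw [← hEq] at tE
    exact tendsto_of_tendsto_of_tendsto_of_le_of_le tL tE i1 i2

end PartM

section PartN
variable {E : Type*} [NormedAddCommGroup E] [InnerProductSpace ℝ E] [FiniteDimensional ℝ E]
  [MeasurableSpace E] [BorelSpace E]

/-- Properties of the family of minimisers used in the final argument. -/
structure Fam (R₀ R₁ s₁ s₂ : ℝ) (u : E → E → ℝ) : Prop where
  mu : ∀ y, s₁ ≤ ‖y‖ → ‖y‖ ≤ s₂ → Measurable (u y)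
  pos : ∀ y, s₁ ≤ ‖y‖ → ‖y‖ ≤ s₂ → ∀ᵐ x, x ∈ An R₀ R₁ y → 0 < u y x
  zero : ∀ y, s₁ ≤ ‖y‖ → ‖y‖ ≤ s₂ → ∀ x, x ∉ An R₀ R₁ y → u y x = 0
  pair : ∀ y, s₁ ≤ ‖y‖ → ‖y‖ ≤ s₂ → ∀ z, s₁ ≤ ‖z‖ → ‖z‖ ≤ s₂ → y ≠ z → ∀ᵐ x,
    (u z x = u y x ∧ u z (rfx y z x) = u y (rfx y z x)) ∨
    (u z x = u y (rfx y z x) ∧ u z (rfx y z x) = u y x)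
  np : ∀ y, s₁ ≤ ‖y‖ → ‖y‖ ≤ s₂ → ∀ κ > 0, ∀ V : Set E, IsOpen V → V ⊆ An R₀ R₁ y → V.Nonempty →
    (∀ᵐ x, x ∈ V → u y x = κ) → False

theorem rfx_inv {x x' y : E} (hx : x' ≠ x) (hy : rfx x x' y ≠ y) : rfx y (rfx x x' y) x = x' := by
  set z := rfx x x' y with hz
  set β := (‖y - x‖ ^ 2 - ‖y - x'‖ ^ 2) / ‖x' - x‖ ^ 2 with hβ
  have e1 : z = y - β • (x' - x) := by rw [hz, rfx_apply]
  have hn : ‖x' - x‖ ≠ 0 := norm_ne_zero_iff.2 (sub_ne_zero.2 hx)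
  have hβ0 : β ≠ 0 := by
    intro h; rw [h, zero_smul, sub_zero] at e1; exact hy e1
  have e2 : ‖x - z‖ = ‖y - x'‖ := by rw [norm_sub_rev]; exact rfx_sub_y hx.symm y
  have e3 : z - y = -(β • (x' - x)) := by rw [e1]; abel
  rw [rfx_apply, e2, e3, norm_neg, norm_smul, mul_pow, Real.norm_eq_abs, sq_abs, norm_sub_rev x y]
  have e4 : ‖y - x‖ ^ 2 - ‖y - x'‖ ^ 2 = β * ‖x' - x‖ ^ 2 := by rw [hβ]; field_simp
  rw [e4]
  have e5 : β * ‖x' - x‖ ^ 2 / (β ^ 2 * ‖x' - x‖ ^ 2) = β⁻¹ := by field_simp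
  rw [e5, smul_neg, smul_smul, inv_mul_cancel₀ hβ0, one_smul]
  abel

theorem rfx_joint (y : E) : Measurable fun q : E × E => rfx y q.1 q.2 := by
  simp only [rfx_apply]
  fun_prop

theorem rfx_cont_in (x y : E) : ContinuousOn (fun x' => rfx x x' y) {x}ᶜ := by
  simp only [rfx_apply]
  refine ContinuousOn.sub continuousOn_const (ContinuousOn.smul ?_ (by fun_prop))
  refine ContinuousOn.div (by fun_prop) (by fun_prop) fun x' hx' => ?_
  have : x' - x ≠ 0 := sub_ne_zero.2 hx'
  positivity

theorem rfx_diff_in (x y : E) : DifferentiableOn ℝ (fun z => rfx y z x) {y}ᶜ := by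
  have nd : ∀ a : E, Differentiable ℝ (fun z : E => ‖a - z‖ ^ 2) := fun a =>
    Differentiable.norm_sq ℝ (by fun_prop)
  have nd' : Differentiable ℝ (fun z : E => ‖z - y‖ ^ 2) :=
    Differentiable.norm_sq ℝ (by fun_prop)
  simp only [rfx_apply]
  refine DifferentiableOn.sub (by fun_prop) (DifferentiableOn.smul ?_ (by fun_prop))
  simp only [div_eq_mul_inv]
  refine DifferentiableOn.mul ((differentiable_const _).sub (nd x)).differentiableOn
    (DifferentiableOn.fun_inv nd'.differentiableOn fun z hz => ?_)
  have : z - y ≠ 0 := sub_ne_zero.2 hz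
  positivity

theorem Fam.step1 [Nontrivial E] {R₀ R₁ s₁ s₂ : ℝ} {u : E → E → ℝ} (F : Fam R₀ R₁ s₁ s₂ u)
    (hs : 0 ≤ s₁) (hs12 : s₁ < s₂)
    {w : E} (hw : ‖w‖ = s₁) {r : ℝ} (hr : R₀ ≤ r)
    (K : ∀ y, s₁ ≤ ‖y‖ → ‖y‖ ≤ s₂ → ∀ᵐ x, r < ‖x - y‖ → u y x = u w x) :
    ∀ y, s₁ ≤ ‖y‖ → ‖y‖ ≤ s₂ → ∀ᵐ x, r - s₂ < ‖x‖ → u y x = u w x := by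
  intro y hy1 hy2
  have hw1 : s₁ ≤ ‖w‖ := hw.ge
  have hw2 : ‖w‖ ≤ s₂ := hw.le.trans hs12.le
  have hAll : ∀ᵐ z : E, ∀ᵐ x : E, s₁ < ‖z‖ → ‖z‖ < s₂ → z ≠ y → ‖x‖ < R₁ → r < ‖x - z‖ →
      (u y x = u w x ∨ (u w (rfx y z x) = u w x ∧ 0 < u w x)) := by
    refine Eventually.of_forall fun z => ?_
    by_cases hz : s₁ < ‖z‖ ∧ ‖z‖ < s₂ ∧ z ≠ y
    · obtain ⟨hz1, hz2, hzy⟩ := hz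
      have k1 := (rfx_mp y z).quasiMeasurePreserving.ae (K y hy1 hy2)
      filter_upwards [F.pair y hy1 hy2 z hz1.le hz2.le hzy.symm, k1, K z hz1.le hz2.le,
        F.pos z hz1.le hz2.le] with x h1 h2 h3 h4 _ _ _ hx hxr
      rw [rfx_sub_y hzy.symm] at h2
      have h2 := h2 hxr
      have h3 := h3 hxr
      have h4 := h4 (mem_An.2 ⟨hx, hr.trans_lt hxr⟩)
      rcases h1 with h1 | h1
      · left; rw [← h1.1, h3]
      · right
        exact ⟨by rw [← h2, ← h1.1, h3], by rw [← h3]; exact h4⟩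
    · refine Eventually.of_forall fun x a b c => absurd ⟨a, b, c⟩ hz
  have mw := F.mu w hw1 hw2
  have my := F.mu y hy1 hy2
  have mr := rfx_joint y
  have hm : MeasurableSet {q : E × E | s₁ < ‖q.1‖ → ‖q.1‖ < s₂ → q.1 ≠ y → ‖q.2‖ < R₁ →
      r < ‖q.2 - q.1‖ → (u y q.2 = u w q.2 ∨ (u w (rfx y q.1 q.2) = u w q.2 ∧ 0 < u w q.2))} := by
    have a1 : MeasurableSet {q : E × E | s₁ < ‖q.1‖} := measurableSet_lt measurable_const (by fun_prop)
    have a2 : MeasurableSet {q : E × E | ‖q.1‖ < s₂} := measurableSet_lt (by fun_prop) measurable_const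
    have a3 : MeasurableSet {q : E × E | q.1 ≠ y} :=
      measurable_fst (measurableSet_singleton y).compl
    have a4 : MeasurableSet {q : E × E | ‖q.2‖ < R₁} := measurableSet_lt (by fun_prop) measurable_const
    have a5 : MeasurableSet {q : E × E | r < ‖q.2 - q.1‖} :=
      measurableSet_lt measurable_const (by fun_prop)
    have a6 : MeasurableSet {q : E × E | u y q.2 = u w q.2} :=
      measurableSet_eq_fun (by fun_prop) (by fun_prop)
    have a7 : MeasurableSet {q : E × E | u w (rfx y q.1 q.2) = u w q.2} :=
      measurableSet_eq_fun (by fun_prop) (by fun_prop)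
    have a8 : MeasurableSet {q : E × E | 0 < u w q.2} :=
      measurableSet_lt measurable_const (by fun_prop)
    have e : {q : E × E | s₁ < ‖q.1‖ → ‖q.1‖ < s₂ → q.1 ≠ y → ‖q.2‖ < R₁ →
      r < ‖q.2 - q.1‖ → (u y q.2 = u w q.2 ∨ (u w (rfx y q.1 q.2) = u w q.2 ∧ 0 < u w q.2))} =
      {q : E × E | s₁ < ‖q.1‖}ᶜ ∪ ({q : E × E | ‖q.1‖ < s₂}ᶜ ∪ ({q : E × E | q.1 ≠ y}ᶜ ∪
      ({q : E × E | ‖q.2‖ < R₁}ᶜ ∪ ({q : E × E | r < ‖q.2 - q.1‖}ᶜ ∪ ({q : E × E | u y q.2 = u w q.2} ∪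
      ({q : E × E | u w (rfx y q.1 q.2) = u w q.2} ∩ {q : E × E | 0 < u w q.2})))))) := by
      ext q
      simp only [mem_union, mem_compl_iff, mem_inter_iff, mem_ofPred_eq, imp_iff_not_or]
    rw [e]
    exact a1.compl.union (a2.compl.union (a3.compl.union (a4.compl.union (a5.compl.union
      (a6.union (a7.inter a8))))))
  have hAll2 := (Measure.ae_ae_comm (μ := (volume : Measure E)) (ν := (volume : Measure E))
    (p := fun z x => s₁ < ‖z‖ → ‖z‖ < s₂ → z ≠ y → ‖x‖ < R₁ → r < ‖x - z‖ →
      (u y x = u w x ∨ (u w (rfx y z x) = u w x ∧ 0 < u w x))) hm).1 hAll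
  have hne0 : ∀ᵐ x : E, x ≠ 0 := by
    rw [ae_iff]; simp
  filter_upwards [hAll2, hne0, K y hy1 hy2] with x hx hx0 hxK hxρ
  by_contra hbad
  have hxy : ‖x - y‖ ≤ r := not_lt.1 fun h => hbad (hxK h)
  have hxR : ‖x‖ < R₁ := by
    by_contra h
    refine hbad ?_
    rw [F.zero y hy1 hy2 x fun h' => h (mem_An.1 h').1, F.zero w hw1 hw2 x fun h' => h (mem_An.1 h').1]
  let O : Set E := {z | s₁ < ‖z‖ ∧ ‖z‖ < s₂ ∧ r < ‖x - z‖}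
  have hO : IsOpen O := by
    have a1 : IsOpen {z : E | s₁ < ‖z‖} := isOpen_lt continuous_const (by fun_prop)
    have a2 : IsOpen {z : E | ‖z‖ < s₂} := isOpen_lt (by fun_prop) continuous_const
    have a3 : IsOpen {z : E | r < ‖x - z‖} := isOpen_lt continuous_const (by fun_prop)
    exact a1.inter (a2.inter a3)
  have hOne : O.Nonempty := by
    obtain ⟨c, hc1, hc2⟩ := exists_between (max_lt hs12 (show r - ‖x‖ < s₂ by linarith))
    have hc1' := (le_max_left _ _).trans_lt hc1
    have hc1'' := (le_max_right _ _).trans_lt hc1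
    have hc0 : 0 < c := hs.trans_lt hc1'
    have hn : 0 < ‖x‖ := norm_pos_iff.2 hx0
    refine ⟨-((c / ‖x‖) • x), ?_, ?_, ?_⟩
    · rw [norm_neg, norm_smul, norm_div, norm_norm, Real.norm_of_nonneg hc0.le,
        div_mul_cancel₀ _ hn.ne']; exact hc1'
    · rw [norm_neg, norm_smul, norm_div, norm_norm, Real.norm_of_nonneg hc0.le,
        div_mul_cancel₀ _ hn.ne']; exact hc2
    · have e : x - -((c / ‖x‖) • x) = (1 + c / ‖x‖) • x := by module
      rw [e, norm_smul, Real.norm_of_nonneg (by positivity), add_mul, one_mul,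
        div_mul_cancel₀ _ hn.ne']
      linarith
  have hOy : ∀ z ∈ O, z ≠ y := by
    rintro z ⟨-, -, h⟩ rfl
    linarith
  have hz : ∀ᵐ z, z ∈ O → u w (rfx y z x) = u w x ∧ 0 < u w x := by
    filter_upwards [hx] with z hz hzO
    exact (hz hzO.1 hzO.2.1 (hOy z hzO) hxR hzO.2.2).resolve_left hbad
  obtain ⟨z0, hz0O, hz0, hκ⟩ := exists_of_ae_open hO hOne hz
  have hfix : ∀ z ∈ O, rfx y z x ≠ x := by
    intro z hzO h
    have := rfx_sub_y (hOy z hzO).symm x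
    rw [h] at this
    have := hzO.2.2
    linarith
  let V : Set E := ({x}ᶜ ∩ (fun x' => rfx x x' y) ⁻¹' O) ∩ ball 0 R₁
  have hV : IsOpen V :=
    ((rfx_cont_in x y).isOpen_inter_preimage isOpen_compl_singleton hO).inter isOpen_ball
  have hVA : ∀ x' ∈ V, r < ‖x' - y‖ := by
    rintro x' ⟨⟨h1, h2⟩, -⟩
    have h3 := rfx_sub_y (Ne.symm h1 : x ≠ x') y
    have h4 := h2.2.2
    rw [norm_sub_rev x' y, ← h3, norm_sub_rev]
    exact h4
  have hVne : V.Nonempty := by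
    refine ⟨rfx y z0 x, ⟨hfix z0 hz0O, ?_⟩, ?_⟩
    · show rfx x (rfx y z0 x) y ∈ O
      rw [rfx_inv (hOy z0 hz0O) (hfix z0 hz0O)]
      exact hz0O
    · rw [mem_ball_zero_iff]
      by_contra h
      have := F.zero w hw1 hw2 (rfx y z0 x) fun h' => h (mem_An.1 h').1
      rw [hz0] at this
      exact hκ.ne' this
  have hVw : ∀ᵐ x', x' ∈ V → u w x' = u w x := by
    rw [ae_iff]
    have hnull : volume ({z | ¬ (z ∈ O → u w (rfx y z x) = u w x ∧ 0 < u w x)}) = 0 := hz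
    have hdo : DifferentiableOn ℝ (fun z => rfx y z x)
        {z | ¬ (z ∈ O → u w (rfx y z x) = u w x ∧ 0 < u w x)} :=
      (rfx_diff_in x y).mono fun z hz' => by
        simp only [Classical.not_imp, mem_ofPred_eq] at hz'
        exact hOy z hz'.1
    refine measure_mono_null ?_
      (addHaar_image_eq_zero_of_differentiableOn_of_addHaar_eq_zero volume hdo hnull)
    intro x' hx'
    simp only [Classical.not_imp, mem_ofPred_eq] at hx'
    obtain ⟨⟨⟨h1, h2⟩, h3⟩, h4⟩ := hx'
    have h5 : rfx y (rfx x x' y) x = x' := rfx_inv h1 (hOy _ h2)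
    refine ⟨rfx x x' y, ?_, h5⟩
    simp only [Classical.not_imp, mem_ofPred_eq]
    refine ⟨h2, fun h6 => h4 ?_⟩
    rw [← h6.1, h5]
  refine F.np y hy1 hy2 (u w x) hκ V hV ?_ hVne ?_
  · intro x' hx'
    exact mem_An.2 ⟨mem_ball_zero_iff.1 hx'.2, hr.trans_lt (hVA x' hx')⟩
  · filter_upwards [hVw, K y hy1 hy2] with x' h1 h2 h3
    rw [h2 (hVA x' h3), h1 h3]

theorem Fam.step2 {R₀ R₁ s₁ s₂ : ℝ} {u : E → E → ℝ} (F : Fam R₀ R₁ s₁ s₂ u)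
    (hs : 0 ≤ s₁) (hs12 : s₁ < s₂) (hR₁ : 0 < R₁)
    {w : E} (hw : ‖w‖ = s₁) {r δ : ℝ} (hr1 : r ≤ R₁ + s₂) (hδ : 0 < δ) (hδm : δ ≤ (s₂ - s₁) / 2)
    (hδR : 2 * R₁ * δ * (4 * s₂ ^ 2) < ((s₂ - s₁) / 2) ^ 4)
    (D : ∀ y, s₁ ≤ ‖y‖ → ‖y‖ ≤ s₂ → ∀ᵐ x, r - s₂ < ‖x‖ → u y x = u w x) :
    ∀ y, s₁ ≤ ‖y‖ → ‖y‖ ≤ s₂ → ∀ᵐ x, r - δ < ‖x - y‖ → u y x = u w x := by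
  intro y hy1 hy2
  have hw1 : s₁ ≤ ‖w‖ := hw.ge
  have hw2 : ‖w‖ ≤ s₂ := hw.le.trans hs12.le
  by_cases hwy : w = y
  · subst hwy; exact Eventually.of_forall fun x _ => rfl
  have d2 := (rfx_mp w y).quasiMeasurePreserving.ae (D y hy1 hy2)
  filter_upwards [D y hy1 hy2, d2, F.pair w hw1 hw2 y hy1 hy2 hwy] with x h1 h2 h3 hx
  by_cases hρ : r - s₂ < ‖x‖
  · exact h1 hρ
  rw [not_lt] at hρ
  have hxy : ‖x - y‖ ≤ ‖x‖ + ‖y‖ := norm_sub_le _ _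
  have hxw : ‖x - w‖ ≤ ‖x‖ + ‖w‖ := norm_sub_le _ _
  have hyw : ‖y - w‖ ≤ ‖y‖ + ‖w‖ := norm_sub_le _ _
  have hx0 := norm_nonneg x
  set m := (s₂ - s₁) / 2 with hm
  have hm0 : 0 < m := by linarith
  have hkey : r - s₂ < ‖rfx w y x‖ := by
    have e := rfx_norm hwy x
    have hn : 0 < ‖y - w‖ := norm_pos_iff.2 (sub_ne_zero.2 (Ne.symm hwy))
    have i1 : m ^ 2 ≤ ‖x - y‖ ^ 2 - ‖x - w‖ ^ 2 := by
      have j1 : m ≤ ‖x - y‖ - ‖x - w‖ := by linarith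
      have j2 : m ≤ ‖x - y‖ + ‖x - w‖ := by
        have := norm_nonneg (x - w)
        linarith
      nlinarith
    have i2 : m ^ 2 ≤ ‖y‖ ^ 2 - ‖w‖ ^ 2 := by
      have j1 : m ≤ ‖y‖ - ‖w‖ := by linarith
      have j2 : m ≤ ‖y‖ + ‖w‖ := by linarith [norm_nonneg w]
      nlinarith
    have i3 : ‖y - w‖ ^ 2 ≤ 4 * s₂ ^ 2 := by
      have : ‖y - w‖ ≤ 2 * s₂ := by linarith
      nlinarith
    have i4 : m ^ 4 ≤ (‖x - y‖ ^ 2 - ‖x - w‖ ^ 2) * (‖y‖ ^ 2 - ‖w‖ ^ 2) := by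
      calc m ^ 4 = m ^ 2 * m ^ 2 := by ring
        _ ≤ _ := mul_le_mul i1 i2 (by positivity) ((by positivity : (0:ℝ) ≤ m ^ 2).trans i1)
    have i5 : 2 * R₁ * δ < (‖x - y‖ ^ 2 - ‖x - w‖ ^ 2) * (‖y‖ ^ 2 - ‖w‖ ^ 2) / ‖y - w‖ ^ 2 := by
      rw [lt_div_iff₀ (by positivity)]
      calc 2 * R₁ * δ * ‖y - w‖ ^ 2 ≤ 2 * R₁ * δ * (4 * s₂ ^ 2) := by gcongr
        _ < m ^ 4 := hδR
        _ ≤ _ := i4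
    have i6 : (r - s₂) ^ 2 - 2 * R₁ * δ ≤ ‖x‖ ^ 2 := by
      have j1 : r - s₂ - δ ≤ ‖x‖ := by linarith
      have j2 : r - s₂ ≤ R₁ := by linarith
      have j3 : 0 ≤ r - s₂ := hx0.trans hρ
      rcases le_total (r - s₂) δ with h | h
      · nlinarith
      · nlinarith
    refine lt_of_pow_lt_pow_left₀ 2 (norm_nonneg _) ?_
    rw [e]
    linarith
  have h2 := h2 hkey
  rcases h3 with h3 | h3
  · exact h3.1
  · rw [h3.1, ← h2, h3.2]

theorem Fam.contra [Nontrivial E] {R₀ R₁ s₁ s₂ : ℝ} {u : E → E → ℝ} (F : Fam R₀ R₁ s₁ s₂ u)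
    (hs : 0 ≤ s₁) (hs12 : s₁ < s₂) (hR₀ : 0 < R₀) (hR₁ : s₂ + R₀ < R₁)
    {w v : E} (hw : ‖w‖ = s₁) (hv : ‖v‖ = s₂) : False := by
  have hR1p : 0 < R₁ := by linarith
  have hs2 : 0 < s₂ := by linarith
  set m := (s₂ - s₁) / 2 with hm
  have hm0 : 0 < m := by linarith
  obtain ⟨δ, hδ0, hδ⟩ := exists_between (show 0 < min m (m ^ 4 / (2 * R₁ * (4 * s₂ ^ 2))) by
    positivity)
  have hδ1 : δ ≤ m := (hδ.trans_le (min_le_left _ _)).le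
  have hδ2 : 2 * R₁ * δ * (4 * s₂ ^ 2) < m ^ 4 := by
    have := hδ.trans_le (min_le_right _ _)
    rw [lt_div_iff₀ (by positivity)] at this
    linarith
  have hw1 : s₁ ≤ ‖w‖ := hw.ge
  have hw2 : ‖w‖ ≤ s₂ := hw.le.trans hs12.le
  have ind : ∀ n : ℕ, ∀ y, s₁ ≤ ‖y‖ → ‖y‖ ≤ s₂ →
      ∀ᵐ x, max R₀ (R₁ + s₂ - n * δ) < ‖x - y‖ → u y x = u w x := by
    intro n
    induction n with
    | zero =>
      intro y hy1 hy2
      refine Eventually.of_forall fun x hx => ?_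
      have h1 := (le_max_right _ _).trans_lt hx
      have h2 : ‖x - y‖ ≤ ‖x‖ + ‖y‖ := norm_sub_le _ _
      have h3 : ¬ ‖x‖ < R₁ := by
        rw [not_lt]
        simp only [Nat.cast_zero, zero_mul, sub_zero] at h1
        linarith
      rw [F.zero y hy1 hy2 x fun h' => h3 (mem_An.1 h').1,
        F.zero w hw1 hw2 x fun h' => h3 (mem_An.1 h').1]
    | succ n ih =>
      have hle : max R₀ (R₁ + s₂ - n * δ) ≤ R₁ + s₂ := by
        refine max_le (by linarith) ?_
        have : 0 ≤ (n:ℝ) * δ := by positivity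
        linarith
      have d := F.step1 hs hs12 hw (le_max_left _ _) ih
      have k := F.step2 hs hs12 hR1p hw hle hδ0 hδ1 hδ2 d
      intro y hy1 hy2
      filter_upwards [k y hy1 hy2] with x hx hxl
      refine hx (lt_of_le_of_lt ?_ hxl)
      rcases le_total R₀ (R₁ + s₂ - n * δ) with h | h
      · rw [max_eq_right h]
        refine le_trans ?_ (le_max_right _ _)
        push_cast; linarith
      · rw [max_eq_left h]
        refine le_trans ?_ (le_max_left _ _)
        linarith
  obtain ⟨n, hn⟩ := exists_nat_gt ((R₁ + s₂) / δ)
  rw [div_lt_iff₀ hδ0] at hn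
  have hK := ind n v (by linarith) hv.le
  rw [max_eq_left (by linarith)] at hK
  have hvw : v ≠ w := by rintro rfl; linarith
  have hn0 : 0 < ‖v - w‖ := norm_pos_iff.2 (sub_ne_zero.2 hvw)
  let V : Set E := {x | ‖x - w‖ < R₀ ∧ R₀ < ‖x - v‖ ∧ ‖x‖ < R₁}
  have hV : IsOpen V := by
    have a1 : IsOpen {x : E | ‖x - w‖ < R₀} := isOpen_lt (by fun_prop) continuous_const
    have a2 : IsOpen {x : E | R₀ < ‖x - v‖} := isOpen_lt continuous_const (by fun_prop)
    have a3 : IsOpen {x : E | ‖x‖ < R₁} := isOpen_lt (by fun_prop) continuous_const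
    exact a1.inter (a2.inter a3)
  have hVne : V.Nonempty := by
    obtain ⟨t, ht1, ht2⟩ := exists_between (max_lt hR₀ (show R₀ - ‖v - w‖ < R₀ by linarith))
    have ht1' := (le_max_left _ _).trans_lt ht1
    have ht1'' := (le_max_right _ _).trans_lt ht1
    have e1 : ‖w - (t / ‖v - w‖) • (v - w) - w‖ = t := by
      have : w - (t / ‖v - w‖) • (v - w) - w = -((t / ‖v - w‖) • (v - w)) := by abel
      rw [this, norm_neg, norm_smul, norm_div, norm_norm, Real.norm_of_nonneg ht1'.le,
        div_mul_cancel₀ _ hn0.ne']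
    refine ⟨w - (t / ‖v - w‖) • (v - w), ?_, ?_, ?_⟩
    · rw [e1]; exact ht2
    · have : w - (t / ‖v - w‖) • (v - w) - v = -((1 + t / ‖v - w‖) • (v - w)) := by module
      rw [this, norm_neg, norm_smul, Real.norm_of_nonneg (by positivity), add_mul, one_mul,
        div_mul_cancel₀ _ hn0.ne']
      linarith
    · have := norm_add_le (w - (t / ‖v - w‖) • (v - w) - w) w
      rw [sub_add_cancel, e1] at this
      linarith
  obtain ⟨x, hx, h1, h2⟩ := exists_of_ae_open (P := fun x => u v x = u w x ∧ 0 < u v x) hV hVne (by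
    filter_upwards [hK, F.pos v (by linarith) hv.le] with x h1 h2 hx
    exact ⟨h1 hx.2.1, h2 (mem_An.2 ⟨hx.2.2, hx.2.1⟩)⟩)
  rw [h1, F.zero w hw1 hw2 x fun h => (mem_An.1 h).2.not_gt hx.1] at h2
  exact lt_irrefl _ h2

end PartN

section PartO
variable {E : Type*} [NormedAddCommGroup E] [InnerProductSpace ℝ E] [FiniteDimensional ℝ E]
  [MeasurableSpace E] [BorelSpace E]

/-- If `v` agrees a.e. with the polarisation of `u`, then on each pair `{x, σ x}` it is a
rearrangement of `u`. -/
theorem pol_pair {y z : E} (hne : y ≠ z) {u v : E → ℝ} (h : ∀ᵐ x, v x = pol y z u x) :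
    ∀ᵐ x, (v x = u x ∧ v (rfx y z x) = u (rfx y z x)) ∨
      (v x = u (rfx y z x) ∧ v (rfx y z x) = u x) := by
  have h2 := (rfx_mp y z).quasiMeasurePreserving.ae h
  filter_upwards [h, h2] with x hx hx2
  rw [hx, hx2]
  unfold pol
  rw [rfx_rfx hne, rfx_sub_y hne, rfx_sub_z hne]
  rcases lt_trichotomy ‖x - y‖ ‖x - z‖ with hl | he | hl
  · rw [if_pos hl, if_neg hl.not_gt]
    rcases le_total (u x) (u (rfx y z x)) with h' | h'
    · right; simp [h']
    · left; simp [h']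
  · left
    rw [rfx_fix he]; simp [he]
  · rw [if_neg hl.not_gt, if_pos hl]
    rcases le_total (u x) (u (rfx y z x)) with h' | h'
    · left; simp [h']
    · right; simp [h']

theorem no_const [Nontrivial E] {p : ℝ} (hp : 1 < p) {R₀ R₁ s₁ s₂ : ℝ}
    (hr : 1 < Module.rank ℝ E) (hs : 0 ≤ s₁) (hs12 : s₁ < s₂)
    (hR₀ : 0 < R₀) (hR₁ : s₂ + R₀ < R₁) {w v : E} (hw : ‖w‖ = s₁) (hv : ‖v‖ = s₂)
    {Λ : E → ℝ≥0∞} (hΛ : ∀ z, ‖z‖ ≤ s₂ → IsL p (An R₀ R₁ z) (Λ z)) (hle : Λ w ≤ Λ v) : False := by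
  have hsub : ∀ z : E, An R₀ R₁ z ⊆ ball 0 R₁ := fun z => sdiff_subset
  have hmin : ∀ z : E, ∃ u : E → ℝ, ‖z‖ ≤ s₂ → ∃ U, IsMnz p (An R₀ R₁ z) (Λ z) u U := by
    intro z
    by_cases h : ‖z‖ ≤ s₂
    · obtain ⟨u, U, hu⟩ := exists_min hp (hsub z) (An_open R₀ R₁ z) (hΛ z h)
      exact ⟨u, fun _ => ⟨U, hu⟩⟩
    · exact ⟨0, fun h' => absurd h' h⟩
  choose u hu using hmin
  have mono : ∀ y z : E, ‖y‖ ≤ ‖z‖ → ‖z‖ ≤ s₂ → Λ z ≤ Λ y := by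
    intro y z hyz hz
    by_cases hne : y = z
    · rw [hne]
    · obtain ⟨U, hU⟩ := hu y (hyz.trans hz)
      exact (pol_min hp hne hyz (hΛ y (hyz.trans hz)) (hΛ z hz) hU).1
  have heq : ∀ z : E, s₁ ≤ ‖z‖ → ‖z‖ ≤ s₂ → Λ z = Λ w := fun z h1 h2 =>
    le_antisymm (mono w z (hw.le.trans h1) h2) (hle.trans (mono z v (h2.trans hv.ge) hv.le))
  have hcon : ∀ z : E, ‖z‖ ≤ s₂ → IsPreconnected (An R₀ R₁ z) := fun z hz =>
    annulus_preconnected hr hR₀ (by linarith)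
  have pair : ∀ y, s₁ ≤ ‖y‖ → ‖y‖ ≤ s₂ → ∀ z, s₁ ≤ ‖z‖ → ‖z‖ ≤ s₂ → y ≠ z → ‖y‖ ≤ ‖z‖ →
      ∀ᵐ x, (u z x = u y x ∧ u z (rfx y z x) = u y (rfx y z x)) ∨
        (u z x = u y (rfx y z x) ∧ u z (rfx y z x) = u y x) := by
    intro y hy1 hy2 z hz1 hz2 hne hyz
    obtain ⟨U, hU⟩ := hu y hy2
    obtain ⟨U', hU'⟩ := hu z hz2
    obtain ⟨W, hW⟩ := (pol_min hp hne hyz (hΛ y hy2) (hΛ z hz2) hU).2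
      ((heq z hz1 hz2).trans (heq y hy1 hy2).symm)
    exact pol_pair hne (hU'.unique hp (An_open R₀ R₁ z) (hcon z hz2) (hΛ z hz2) hW)
  have F : Fam R₀ R₁ s₁ s₂ u := by
    refine ⟨fun y _ h2 => ?_, fun y _ h2 => ?_, fun y _ h2 => ?_, ?_, ?_⟩
    · obtain ⟨U, hU⟩ := hu y h2
      exact hU.mu
    · obtain ⟨U, hU⟩ := hu y h2
      exact hU.pos_ae hp (An_open R₀ R₁ y) (hcon y h2) (hΛ y h2)
    · obtain ⟨U, hU⟩ := hu y h2
      exact hU.z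
    · intro y hy1 hy2 z hz1 hz2 hne
      rcases le_total ‖y‖ ‖z‖ with h | h
      · exact pair y hy1 hy2 z hz1 hz2 hne h
      · filter_upwards [pair z hz1 hz2 y hy1 hy2 hne.symm h] with x hx
        rw [rfx_symm y z x]
        rcases hx with ⟨a, b⟩ | ⟨a, b⟩
        · exact Or.inl ⟨a.symm, b.symm⟩
        · exact Or.inr ⟨b.symm, a.symm⟩
    · intro y hy1 hy2 κ hκ V hV hVs hVne h
      obtain ⟨U, hU⟩ := hu y hy2
      exact hU.no_plateau hp (hΛ y hy2) ((hΛ y hy2).pos hp (hsub y)) hκ hV hVs hVne h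
  exact F.contra hs hs12 hR₀ hR₁ hw hv

end PartO

theorem norm_e1 {N : ℕ} (hN : 2 ≤ N) : ‖e1 N‖ = 1 := by
  have : e1 N = EuclideanSpace.single (⟨0, by omega⟩ : Fin N) (1 : ℝ) := by
    ext i
    simp [e1, Fin.ext_iff, Pi.single_apply]
  rw [this]; simp

theorem Om_eq {N : ℕ} {R₀ : ℝ} (hR₀ : 0 < R₀) (R₁ s : ℝ) :
    Om N R₀ R₁ s = An R₀ R₁ (s • e1 N) := by
  rw [Om, An, closure_ball _ hR₀.ne']

theorem stmt0 (N : ℕ) (hN : 2 ≤ N) (R₀ R₁ : ℝ) (hR₀ : 0 < R₀) (hR : R₀ < R₁)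
    (p : ℝ) (hp : 1 < p) (s₁ s₂ : ℝ) (hs₁ : 0 ≤ s₁) (h12 : s₁ < s₂) (hs₂ : s₂ < R₁ - R₀) :
    lam1 p (Om N R₀ R₁ s₂) < lam1 p (Om N R₀ R₁ s₁) := by
  have hR₁ : s₂ + R₀ < R₁ := by linarith
  have hnt : Nontrivial (EuclideanSpace ℝ (Fin N)) := by
    refine ⟨⟨e1 N, 0, ?_⟩⟩
    rw [← norm_ne_zero_iff, norm_e1 hN]; exact one_ne_zero
  have hr : 1 < Module.rank ℝ (EuclideanSpace ℝ (Fin N)) := by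
    rw [← Module.finrank_eq_rank, finrank_euclideanSpace, Fintype.card_fin]
    exact_mod_cast (by omega : 1 < N)
  rw [Om_eq hR₀, Om_eq hR₀]
  by_contra hcon
  have hn : ∀ s : ℝ, 0 ≤ s → ‖s • e1 N‖ = s := fun s h => by
    rw [norm_smul, norm_e1 hN, mul_one, Real.norm_of_nonneg h]
  refine no_const hp hr hs₁ h12 hR₀ hR₁ (hn s₁ hs₁) (hn s₂ (hs₁.trans h12.le))
    (Λ := fun z => ENNReal.ofReal (lam1 p (An R₀ R₁ z))) (fun z hz => ?_)
    (ENNReal.ofReal_le_ofReal (not_lt.1 hcon))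
  refine isL_lam1 hp (An_open R₀ R₁ z) ?_
  obtain ⟨r, h1, h2⟩ := exists_between hR₁
  have hr0 : 0 ≤ r := by linarith
  refine ⟨r • e1 N, mem_An.2 ⟨by rw [hn r hr0]; exact h2, ?_⟩⟩
  have := norm_sub_norm_le (r • e1 N) z
  rw [hn r hr0] at this
  linarith
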